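/- arXiv:2507.13770 — 2 statements merged into one kernel-verified Lean document; each statement's English description precedes it below -/
import Mathlib

section
/- Let J be an open interval whose closure is contained in (0,1). There exist C^∞ vector fields X and Y on ℝ, supported in (0,1), and τ > 0 such that for every t ∈ (0,τ): (1) for every x ∈ J, the derivative with respect to t of the map t ↦ [φ_X^t, φ_Y^t](x) is strictly positive; (2) for every x ∈ (0,1), this derivative is nonnegative. Here [φ_X^t, φ_Y^t] = φ_X^t∘φ_Y^t∘φ_X^{−t}∘φ_Y^{−t}. -/
open Filter Set

noncomputable section

/-- The commutator map `t ↦ [φ_X^t, φ_Y^t](x) = φ_X^t(φ_Y^t(φ_X^{-t}(φ_Y^{-t}(x))))`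
associated with two flows `ΦX`, `ΦY`. -/
def flowComm (ΦX ΦY : ℝ → ℝ → ℝ) (t x : ℝ) : ℝ :=
  ΦX t (ΦY t (ΦX (-t) (ΦY (-t) x)))

/-- `Φ` is the (complete) flow of the vector field `X` on `ℝ`. -/
def IsFlowOf (Φ : ℝ → ℝ → ℝ) (X : ℝ → ℝ) : Prop :=
  (∀ x : ℝ, Φ 0 x = x) ∧ (∀ s t : ℝ, ∀ x : ℝ, Φ (s + t) x = Φ s (Φ t x)) ∧
    ∀ t x : ℝ, HasDerivAt (fun s => Φ s x) (X (Φ t x)) t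

open Topology

/-- The self-map of `ℝ` that acts as `f` in the coordinate `θ` (with inverse `ψ`) on `(c, d)` and
as the identity outside `(c, d)`. -/
def conjIoo (c d : ℝ) (θ ψ f : ℝ → ℝ) (x : ℝ) : ℝ :=
  if x ∈ Ioo c d then ψ (f (θ x)) else x

section conjIoo

variable {c d : ℝ} {θ ψ : ℝ → ℝ}

theorem conjIoo_of_mem (f : ℝ → ℝ) {x : ℝ} (hx : x ∈ Ioo c d) :
    conjIoo c d θ ψ f x = ψ (f (θ x)) := if_pos hx

theorem conjIoo_of_notMem (f : ℝ → ℝ) {x : ℝ} (hx : x ∉ Ioo c d) :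
    conjIoo c d θ ψ f x = x := if_neg hx

theorem conjIoo_comp (hψ : ∀ y, ψ y ∈ Ioo c d) (hθψ : ∀ y, θ (ψ y) = y) (f g : ℝ → ℝ) (x : ℝ) :
    conjIoo c d θ ψ f (conjIoo c d θ ψ g x) = conjIoo c d θ ψ (f ∘ g) x := by
  by_cases hx : x ∈ Ioo c d
  · rw [conjIoo_of_mem g hx, conjIoo_of_mem f (hψ _), hθψ, conjIoo_of_mem _ hx, Function.comp_apply]
  · rw [conjIoo_of_notMem g hx, conjIoo_of_notMem f hx, conjIoo_of_notMem _ hx]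

/-- A flow `F` of the vector field `V` on `ℝ`, transported to `(c, d)`, is the flow of the
transported vector field. -/
theorem isFlowOf_conjIoo {V X Y : ℝ → ℝ} {F : ℝ → ℝ → ℝ} (hψ : ∀ y, ψ y ∈ Ioo c d)
    (hθψ : ∀ y, θ (ψ y) = y) (hψθ : ∀ x ∈ Ioo c d, ψ (θ x) = x)
    (hψ' : ∀ y, HasDerivAt ψ (Y (ψ y)) y) (hF : IsFlowOf F V)
    (hX : ∀ x ∈ Ioo c d, X x = V (θ x) * Y x) (hX0 : ∀ x ∉ Ioo c d, X x = 0) :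
    IsFlowOf (fun t => conjIoo c d θ ψ (F t)) X := by
  obtain ⟨h0, hadd, hderiv⟩ := hF
  refine ⟨fun x => ?_, fun s t x => ?_, fun t x => ?_⟩ <;> beta_reduce
  · by_cases hx : x ∈ Ioo c d
    · rw [conjIoo_of_mem _ hx, h0, hψθ x hx]
    · exact conjIoo_of_notMem _ hx
  · rw [conjIoo_comp hψ hθψ]
    congr 1
    exact funext (hadd s t)
  · by_cases hx : x ∈ Ioo c d
    · simp only [conjIoo_of_mem _ hx]
      rw [hX _ (hψ _), hθψ, mul_comm]
      exact (hψ' (F t (θ x))).comp t (hderiv t (θ x))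
    · simp only [conjIoo_of_notMem _ hx, hX0 x hx]
      exact hasDerivAt_const t x

end conjIoo

theorem isFlowOf_translation : IsFlowOf (fun t y => y + t) (fun _ => 1) :=
  ⟨fun x => add_zero x, fun s t x => by ring, fun t x => (hasDerivAt_id t).const_add x⟩

theorem isFlowOf_dilation : IsFlowOf (fun t y => Real.exp t * y) (fun y => y) :=
  ⟨fun x => by simp, fun s t x => by simp only [Real.exp_add, mul_assoc],
    fun t x => (Real.hasDerivAt_exp t).mul_const x⟩

/-- A differentiable function on `(c, d)` with positive derivative `(Y x)⁻¹` and with range `ℝ` has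
an inverse, whose derivative is given by `Y`. -/
theorem exists_inverse_of_surjOn_Ioo {c d : ℝ} {θ Y : ℝ → ℝ} (hY : ∀ x ∈ Ioo c d, 0 < Y x)
    (hθ : ∀ x ∈ Ioo c d, HasDerivAt θ (Y x)⁻¹ x) (hsurj : SurjOn θ (Ioo c d) univ) :
    ∃ ψ : ℝ → ℝ, (∀ y, ψ y ∈ Ioo c d) ∧ (∀ y, θ (ψ y) = y) ∧ (∀ x ∈ Ioo c d, ψ (θ x) = x) ∧
      ∀ y, HasDerivAt ψ (Y (ψ y)) y := by
  have hmono : StrictMonoOn θ (Ioo c d) := by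
    refine strictMonoOn_of_deriv_pos (convex_Ioo c d)
      (fun x hx => (hθ x hx).continuousAt.continuousWithinAt) fun x hx => ?_
    rw [interior_Ioo] at hx
    rw [(hθ x hx).deriv]
    exact inv_pos.2 (hY x hx)
  choose ψ hψ hθψ using fun y => hsurj (mem_univ y)
  have hψθ : ∀ x ∈ Ioo c d, ψ (θ x) = x := fun x hx => hmono.injOn (hψ _) hx (hθψ _)
  have hψmono : Monotone ψ := fun y z hyz => by
    rwa [← hmono.le_iff_le (hψ y) (hψ z), hθψ, hθψ]
  have hcont : ∀ y, ContinuousAt ψ y := fun y => by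
    refine continuousAt_of_monotoneOn_of_image_mem_nhds (hψmono.monotoneOn univ) univ_mem ?_
    refine mem_of_superset (isOpen_Ioo.mem_nhds (hψ y)) fun x hx => ?_
    exact ⟨θ x, mem_univ _, hψθ x hx⟩
  refine ⟨ψ, hψ, hθψ, hψθ, fun y => ?_⟩
  rw [← inv_inv (Y (ψ y))]
  exact HasDerivAt.of_local_left_inverse (hcont y) (hθ _ (hψ y))
    (inv_pos.2 (hY _ (hψ y))).ne' (Eventually.of_forall hθψ)

/-- Transporting the affine vector fields `y ∂y` and `∂y` to `(c, d)` gives flows whose commutator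
is, in the coordinate `θ`, the translation by `t (exp t - 1)`. -/
theorem exists_flows_hasDerivAt_flowComm {c d : ℝ} {θ X Y : ℝ → ℝ} (hY : ∀ x ∈ Ioo c d, 0 < Y x)
    (hY0 : ∀ x ∉ Ioo c d, Y x = 0) (hX : ∀ x ∈ Ioo c d, X x = θ x * Y x)
    (hX0 : ∀ x ∉ Ioo c d, X x = 0) (hθ : ∀ x ∈ Ioo c d, HasDerivAt θ (Y x)⁻¹ x)
    (hsurj : SurjOn θ (Ioo c d) univ) :
    ∃ ΦX ΦY : ℝ → ℝ → ℝ, IsFlowOf ΦX X ∧ IsFlowOf ΦY Y ∧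
      (∀ x ∈ Ioo c d, ∀ t > 0, ∃ v > 0, HasDerivAt (fun s => flowComm ΦX ΦY s x) v t) ∧
      ∀ x ∉ Ioo c d, ∀ t, HasDerivAt (fun s => flowComm ΦX ΦY s x) 0 t := by
  obtain ⟨ψ, hψ, hθψ, hψθ, hψ'⟩ := exists_inverse_of_surjOn_Ioo hY hθ hsurj
  refine ⟨fun t => conjIoo c d θ ψ fun y => Real.exp t * y, fun t => conjIoo c d θ ψ fun y => y + t,
    isFlowOf_conjIoo hψ hθψ hψθ hψ' isFlowOf_dilation hX hX0,
    isFlowOf_conjIoo hψ hθψ hψθ hψ' isFlowOf_translation (fun x _ => (one_mul _).symm) hY0,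
    fun x hx t ht => ?_, fun x hx t => ?_⟩
  · have hcomm : (fun s => flowComm (fun t => conjIoo c d θ ψ fun y => Real.exp t * y)
        (fun t => conjIoo c d θ ψ fun y => y + t) s x) =
        fun s => ψ (θ x + s * (Real.exp s - 1)) := by
      funext s
      simp only [flowComm, conjIoo_comp hψ hθψ]
      rw [conjIoo_of_mem _ hx]
      simp only [Function.comp_apply]
      congr 1
      have : Real.exp s * Real.exp (-s) = 1 := by rw [← Real.exp_add, add_neg_cancel, Real.exp_zero]
      linear_combination (θ x - s) * this
    rw [hcomm]
    have hinner : HasDerivAt (fun s => θ x + s * (Real.exp s - 1))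
        (1 * (Real.exp t - 1) + t * Real.exp t) t :=
      ((hasDerivAt_id t).mul ((Real.hasDerivAt_exp t).sub_const 1)).const_add (θ x)
    have hexp : 0 < Real.exp t - 1 := sub_pos.2 (Real.one_lt_exp_iff.2 ht)
    exact ⟨_, mul_pos (hY _ (hψ _)) (by positivity), (hψ' _).comp t hinner⟩
  · simp only [flowComm, conjIoo_of_notMem _ hx]
    exact hasDerivAt_const t x

theorem expNegInvGlue_of_pos {x : ℝ} (hx : 0 < x) : expNegInvGlue x = Real.exp (-x⁻¹) := by
  simp [expNegInvGlue, hx.not_ge]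

theorem tendsto_inv_expNegInvGlue_nhdsGT_zero :
    Tendsto (fun u => (expNegInvGlue u)⁻¹) (𝓝[>] 0) atTop := by
  refine tendsto_inv_nhdsGT_zero.comp (tendsto_nhdsWithin_iff.2 ⟨?_, ?_⟩)
  · simpa using ((expNegInvGlue.contDiff (n := 0)).continuous.tendsto 0).mono_left
      nhdsWithin_le_nhds
  · filter_upwards [self_mem_nhdsWithin] with u hu using expNegInvGlue.pos_of_pos hu

theorem hasDerivAt_inv_expNegInvGlue {u : ℝ} (hu : 0 < u) :
    HasDerivAt (fun u => (expNegInvGlue u)⁻¹) (-(expNegInvGlue u * u ^ 2)⁻¹) u := by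
  have h : HasDerivAt (fun u : ℝ => Real.exp u⁻¹) (Real.exp u⁻¹ * -(u ^ 2)⁻¹) u :=
    (hasDerivAt_inv hu.ne').exp
  have heq : ∀ v : ℝ, 0 < v → (expNegInvGlue v)⁻¹ = Real.exp v⁻¹ := fun v hv => by
    rw [expNegInvGlue_of_pos hv, Real.exp_neg, inv_inv]
  refine (h.congr_of_eventuallyEq ?_).congr_deriv ?_
  · filter_upwards [lt_mem_nhds hu] with v hv using heq v hv
  · rw [mul_inv, heq u hu, mul_neg]

/-- A function on `(c, d)` growing doubly exponentially at both ends. -/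
def endCoord (c d x : ℝ) : ℝ := (expNegInvGlue (d - x))⁻¹ - (expNegInvGlue (x - c))⁻¹

/-- The smooth extension by zero of the reciprocal of the derivative of `endCoord c d`. -/
def endField (c d x : ℝ) : ℝ :=
  (expNegInvGlue (d - x) * (d - x) ^ 2) * (expNegInvGlue (x - c) * (x - c) ^ 2) /
    (expNegInvGlue (d - x) * (d - x) ^ 2 + expNegInvGlue (x - c) * (x - c) ^ 2)

/-- The iterated flat function appearing in `exp (± endCoord c d)`. -/
def doubleGlue (u : ℝ) : ℝ := expNegInvGlue (expNegInvGlue u)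

theorem contDiff_doubleGlue {n : ℕ∞} : ContDiff ℝ n doubleGlue :=
  expNegInvGlue.contDiff.comp expNegInvGlue.contDiff

theorem doubleGlue_pos {u : ℝ} (hu : 0 < u) : 0 < doubleGlue u :=
  expNegInvGlue.pos_of_pos (expNegInvGlue.pos_of_pos hu)

section Field

variable {c d : ℝ}

theorem contDiff_endField (hcd : c < d) {n : ℕ∞} : ContDiff ℝ n (endField c d) := by
  have h1 : ContDiff ℝ n fun x => expNegInvGlue (d - x) * (d - x) ^ 2 :=
    (expNegInvGlue.contDiff.comp (contDiff_const.sub contDiff_id)).mul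
      ((contDiff_const.sub contDiff_id).pow 2)
  have h2 : ContDiff ℝ n fun x => expNegInvGlue (x - c) * (x - c) ^ 2 :=
    (expNegInvGlue.contDiff.comp (contDiff_id.sub contDiff_const)).mul
      ((contDiff_id.sub contDiff_const).pow 2)
  refine (h1.mul h2).div (h1.add h2) fun x => ?_
  have hd := expNegInvGlue.nonneg (d - x)
  have hc := expNegInvGlue.nonneg (x - c)
  rcases lt_or_ge x d with hx | hx
  · have := expNegInvGlue.pos_of_pos (sub_pos.2 hx)
    have := sub_pos.2 hx
    positivity
  · have := expNegInvGlue.pos_of_pos (sub_pos.2 (hcd.trans_le hx))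
    have := sub_pos.2 (hcd.trans_le hx)
    positivity

theorem endField_pos {x : ℝ} (hx : x ∈ Ioo c d) : 0 < endField c d x := by
  have h1 := sub_pos.2 hx.1
  have h2 := sub_pos.2 hx.2
  have h3 := expNegInvGlue.pos_of_pos h1
  have h4 := expNegInvGlue.pos_of_pos h2
  unfold endField
  positivity

theorem endField_of_notMem {x : ℝ} (hx : x ∉ Ioo c d) : endField c d x = 0 := by
  rw [mem_Ioo, not_and_or, not_lt, not_lt] at hx
  rcases hx with hx | hx
  · simp [endField, expNegInvGlue.zero_of_nonpos (sub_nonpos.2 hx)]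
  · simp [endField, expNegInvGlue.zero_of_nonpos (sub_nonpos.2 hx)]

theorem hasDerivAt_endCoord {x : ℝ} (hx : x ∈ Ioo c d) :
    HasDerivAt (endCoord c d) (endField c d x)⁻¹ x := by
  have h1 := sub_pos.2 hx.1
  have h2 := sub_pos.2 hx.2
  have h3 := expNegInvGlue.pos_of_pos h1
  have h4 := expNegInvGlue.pos_of_pos h2
  have hd : HasDerivAt (fun x => d - x) (-1) x := (hasDerivAt_id x).const_sub d
  have hc : HasDerivAt (fun x => x - c) 1 x := (hasDerivAt_id x).sub_const c
  refine (((hasDerivAt_inv_expNegInvGlue h2).comp x hd).sub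
    ((hasDerivAt_inv_expNegInvGlue h1).comp x hc)).congr_deriv ?_
  unfold endField
  field_simp
  ring

theorem surjOn_endCoord (hcd : c < d) : SurjOn (endCoord c d) (Ioo c d) univ := by
  have hcont : ContinuousOn (endCoord c d) (Ioo c d) := fun x hx =>
    (hasDerivAt_endCoord hx).continuousAt.continuousWithinAt
  have hglue : Continuous expNegInvGlue := (expNegInvGlue.contDiff (n := 0)).continuous
  have hinv : ∀ {f : ℝ → ℝ} {p : ℝ}, Continuous f → 0 < f p →
      Tendsto (fun x => (expNegInvGlue (f x))⁻¹) (𝓝 p) (𝓝 (expNegInvGlue (f p))⁻¹) :=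
    fun hf hp => ((hglue.comp hf).tendsto _).inv₀ (expNegInvGlue.pos_of_pos hp).ne'
  refine hcont.surjOn_of_tendsto (nonempty_Ioo.2 hcd) ?_ ?_
  · rw [tendsto_comp_coe_Ioo_atBot hcd]
    have h1 : Tendsto (fun x => x - c) (𝓝[>] c) (𝓝[>] 0) := by
      refine tendsto_nhdsWithin_iff.2 ⟨?_, ?_⟩
      · have : Tendsto (fun x => x - c) (𝓝 c) (𝓝 (c - c)) :=
          (continuous_id.sub continuous_const).tendsto c
        rw [sub_self] at this
        exact this.mono_left nhdsWithin_le_nhds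
      · filter_upwards [self_mem_nhdsWithin] with x hx using sub_pos.2 (mem_Ioi.1 hx)
    have h2 := (hinv (continuous_const.sub continuous_id) (sub_pos.2 hcd)).mono_left
      (nhdsWithin_le_nhds (s := Ioi c))
    exact h2.add_atBot (tendsto_neg_atTop_atBot.comp
      (tendsto_inv_expNegInvGlue_nhdsGT_zero.comp h1))
  · rw [tendsto_comp_coe_Ioo_atTop hcd]
    have h1 : Tendsto (fun x => d - x) (𝓝[<] d) (𝓝[>] 0) := by
      refine tendsto_nhdsWithin_iff.2 ⟨?_, ?_⟩
      · have : Tendsto (fun x => d - x) (𝓝 d) (𝓝 (d - d)) :=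
          (continuous_const.sub continuous_id).tendsto d
        rw [sub_self] at this
        exact this.mono_left nhdsWithin_le_nhds
      · filter_upwards [self_mem_nhdsWithin] with x hx using sub_pos.2 (mem_Iio.1 hx)
    have h2 := (hinv (continuous_id.sub continuous_const) (sub_pos.2 hcd)).mono_left
      (nhdsWithin_le_nhds (s := Iio d))
    exact (tendsto_inv_expNegInvGlue_nhdsGT_zero.comp h1).atTop_add h2.neg

theorem exp_endCoord {x : ℝ} (hx : x ∈ Ioo c d) :
    Real.exp (endCoord c d x) = doubleGlue (x - c) / doubleGlue (d - x) := by
  rw [doubleGlue, doubleGlue, expNegInvGlue_of_pos (expNegInvGlue.pos_of_pos (sub_pos.2 hx.1)),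
    expNegInvGlue_of_pos (expNegInvGlue.pos_of_pos (sub_pos.2 hx.2)), ← Real.exp_sub, endCoord]
  congr 1
  ring

theorem doubleGlue_sq_add_sq_pos (hcd : c < d) (x : ℝ) :
    0 < doubleGlue (d - x) ^ 2 + doubleGlue (x - c) ^ 2 := by
  rcases lt_or_ge x d with hx | hx
  · have := doubleGlue_pos (sub_pos.2 hx)
    positivity
  · have := doubleGlue_pos (sub_pos.2 (hcd.trans_le hx))
    positivity

/-- The vector field on `(c, d)` equal to `∂y` in the coordinate `y = sinh (endCoord c d)`. -/
def translationField (c d x : ℝ) : ℝ :=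
  endField c d x * (2 * doubleGlue (d - x) * doubleGlue (x - c) /
    (doubleGlue (d - x) ^ 2 + doubleGlue (x - c) ^ 2))

/-- The vector field on `(c, d)` equal to `y ∂y` in the coordinate `y = sinh (endCoord c d)`. -/
def dilationField (c d x : ℝ) : ℝ :=
  endField c d x * ((doubleGlue (x - c) ^ 2 - doubleGlue (d - x) ^ 2) /
    (doubleGlue (d - x) ^ 2 + doubleGlue (x - c) ^ 2))

theorem contDiff_translationField (hcd : c < d) {n : ℕ∞} :
    ContDiff ℝ n (translationField c d) := by
  have h1 : ContDiff ℝ n fun x => doubleGlue (d - x) :=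
    contDiff_doubleGlue.comp (contDiff_const.sub contDiff_id)
  have h2 : ContDiff ℝ n fun x => doubleGlue (x - c) :=
    contDiff_doubleGlue.comp (contDiff_id.sub contDiff_const)
  exact (contDiff_endField hcd).mul (((contDiff_const.mul h1).mul h2).div
    ((h1.pow 2).add (h2.pow 2)) fun x => (doubleGlue_sq_add_sq_pos hcd x).ne')

theorem contDiff_dilationField (hcd : c < d) {n : ℕ∞} : ContDiff ℝ n (dilationField c d) := by
  have h1 : ContDiff ℝ n fun x => doubleGlue (d - x) :=
    contDiff_doubleGlue.comp (contDiff_const.sub contDiff_id)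
  have h2 : ContDiff ℝ n fun x => doubleGlue (x - c) :=
    contDiff_doubleGlue.comp (contDiff_id.sub contDiff_const)
  exact (contDiff_endField hcd).mul (((h2.pow 2).sub (h1.pow 2)).div
    ((h1.pow 2).add (h2.pow 2)) fun x => (doubleGlue_sq_add_sq_pos hcd x).ne')

theorem translationField_pos {x : ℝ} (hx : x ∈ Ioo c d) : 0 < translationField c d x := by
  have h1 := doubleGlue_pos (sub_pos.2 hx.1)
  have h2 := doubleGlue_pos (sub_pos.2 hx.2)
  have h3 := endField_pos hx
  unfold translationField
  positivity

theorem dilationField_eq {x : ℝ} (hx : x ∈ Ioo c d) :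
    dilationField c d x = Real.sinh (endCoord c d x) * translationField c d x := by
  have h1 := doubleGlue_pos (sub_pos.2 hx.1)
  have h2 := doubleGlue_pos (sub_pos.2 hx.2)
  rw [dilationField, translationField, Real.sinh_eq, Real.exp_neg, exp_endCoord hx]
  field_simp

theorem hasDerivAt_sinh_endCoord {x : ℝ} (hx : x ∈ Ioo c d) :
    HasDerivAt (fun x => Real.sinh (endCoord c d x)) (translationField c d x)⁻¹ x := by
  refine (hasDerivAt_endCoord hx).sinh.congr_deriv ?_
  have h1 := doubleGlue_pos (sub_pos.2 hx.1)
  have h2 := doubleGlue_pos (sub_pos.2 hx.2)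
  have h3 := endField_pos hx
  rw [translationField, Real.cosh_eq, Real.exp_neg, exp_endCoord hx]
  field_simp
  ring

end Field

theorem tsupport_subset_Icc_of_eq_zero {c d : ℝ} {f : ℝ → ℝ} (hf : ∀ x ∉ Ioo c d, f x = 0) :
    tsupport f ⊆ Icc c d :=
  closure_minimal (fun x hx => Ioo_subset_Icc_self (by_contra fun h => hx (hf x h))) isClosed_Icc

/-- Given an open interval `J = (a,b)` with closure contained in `(0,1)`, there are
smooth vector fields `X`, `Y` supported in `(0,1)` such that, for all small `t > 0`,
the derivative in `t` of the commutator `[φ_X^t, φ_Y^t](x)` is positive for `x ∈ J` and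
nonnegative for `x ∈ (0,1)`. -/
theorem commutator_of_flows_moves_right (a b : ℝ) (hab : a < b) (h0 : 0 < a) (h1 : b < 1) :
    ∃ X Y : ℝ → ℝ, ∃ ΦX ΦY : ℝ → ℝ → ℝ, ∃ τ > (0 : ℝ),
      ContDiff ℝ (⊤ : ℕ∞) X ∧ ContDiff ℝ (⊤ : ℕ∞) Y ∧
      HasCompactSupport X ∧ tsupport X ⊆ Set.Ioo 0 1 ∧
      HasCompactSupport Y ∧ tsupport Y ⊆ Set.Ioo 0 1 ∧
      IsFlowOf ΦX X ∧ IsFlowOf ΦY Y ∧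
      ∀ t ∈ Set.Ioo (0 : ℝ) τ,
        (∀ x ∈ Set.Ioo a b, 0 < deriv (fun s => flowComm ΦX ΦY s x) t) ∧
        (∀ x ∈ Set.Ioo (0 : ℝ) 1,
          DifferentiableAt ℝ (fun s => flowComm ΦX ΦY s x) t ∧
            0 ≤ deriv (fun s => flowComm ΦX ΦY s x) t) := by
  obtain ⟨c, hc0, hca⟩ := exists_between h0
  obtain ⟨d, hbd, hd1⟩ := exists_between h1
  have hcd : c < d := hca.trans (hab.trans hbd)
  have hY0 : ∀ x ∉ Ioo c d, translationField c d x = 0 := fun x hx => by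
    rw [translationField, endField_of_notMem hx, zero_mul]
  have hX0 : ∀ x ∉ Ioo c d, dilationField c d x = 0 := fun x hx => by
    rw [dilationField, endField_of_notMem hx, zero_mul]
  have hIcc : Icc c d ⊆ Ioo 0 1 := fun x hx => ⟨hc0.trans_le hx.1, hx.2.trans_lt hd1⟩
  have hsurj : SurjOn (fun x => Real.sinh (endCoord c d x)) (Ioo c d) univ :=
    (surjOn_univ.2 Real.sinh_surjective).comp (surjOn_endCoord hcd)
  obtain ⟨ΦX, ΦY, hΦX, hΦY, hpos, hzero⟩ :=
    exists_flows_hasDerivAt_flowComm (fun x hx => translationField_pos hx) hY0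
      (fun x hx => dilationField_eq hx) hX0 (fun x hx => hasDerivAt_sinh_endCoord hx) hsurj
  have hcomp : ∀ {f : ℝ → ℝ}, (∀ x ∉ Ioo c d, f x = 0) → HasCompactSupport f := fun hf =>
    isCompact_Icc.of_isClosed_subset (isClosed_tsupport _) (tsupport_subset_Icc_of_eq_zero hf)
  refine ⟨dilationField c d, translationField c d, ΦX, ΦY, 1, one_pos, contDiff_dilationField hcd,
    contDiff_translationField hcd, hcomp hX0, (tsupport_subset_Icc_of_eq_zero hX0).trans hIcc,
    hcomp hY0, (tsupport_subset_Icc_of_eq_zero hY0).trans hIcc, hΦX, hΦY,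
    fun t ht => ⟨fun x hx => ?_, fun x _ => ?_⟩⟩
  · obtain ⟨v, hv, h⟩ := hpos x ⟨hca.trans hx.1, hx.2.trans hbd⟩ t ht.1
    rwa [h.deriv]
  · by_cases hx : x ∈ Ioo c d
    · obtain ⟨v, hv, h⟩ := hpos x hx t ht.1
      exact ⟨h.differentiableAt, h.deriv.symm ▸ hv.le⟩
    · exact ⟨(hzero x hx t).differentiableAt, (hzero x hx t).deriv.ge⟩
end
end

section
/- There exists a sequence (r_n, ε_n)_{n≥0} with r_n ∈ ℕ and ε_n > 0 such that the following holds: for any sequence (f_n)_{n≥0} of elements of Diff^∞_c(ℝ), all equal to the identity outside a common compact set, satisfying d_{r_n}(f_n, id) < ε_n for every n, there exists a finite subset S of Diff^∞_c(ℝ) such that, for every n, f_n belongs to the subgroup generated by S and ℓ_S(f_n) ≤ 70n + 70. -/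
open Filter Set

noncomputable section

/-- `f` is an increasing `C^∞` diffeomorphism of `ℝ` with compact support,
i.e. an element of `Diff^∞_c(ℝ)`. -/
def IsCDiffC (f : Equiv.Perm ℝ) : Prop :=
  ContDiff ℝ (⊤ : ℕ∞) (f : ℝ → ℝ) ∧ ContDiff ℝ (⊤ : ℕ∞) (f.symm : ℝ → ℝ) ∧ StrictMono (f : ℝ → ℝ) ∧
    ∃ K : Set ℝ, IsCompact K ∧ ∀ x ∉ K, f x = x

/-- `g` can be written as a product of at most `m` elements of `S ∪ S⁻¹`. -/
def WordLenLe {G : Type*} [Group G] (S : Finset G) (g : G) (m : ℕ) : Prop :=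
  ∃ l : List G, l.length ≤ m ∧ (∀ x ∈ l, x ∈ S ∨ x⁻¹ ∈ S) ∧ l.prod = g

/-- The word length of `g` with respect to the finite set `S`. -/
def wordLength {G : Type*} [Group G] (S : Finset G) (g : G) : ℕ :=
  sInf {m | WordLenLe S g m}

/-- `d_r(f, g) < ε`, where `d_r` is the `C^r` distance on maps of `ℝ`. -/
def DistLt (r : ℕ) (ε : ℝ) (f g : ℝ → ℝ) : Prop :=
  ∀ k ≤ r, ∀ x : ℝ, |iteratedDeriv k f x - iteratedDeriv k g x| < ε

open scoped commutatorElement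

/-- `f` is an increasing smooth diffeomorphism of the line. -/
def IsDiffeo (f : Equiv.Perm ℝ) : Prop :=
  ContDiff ℝ (⊤ : ℕ∞) (f : ℝ → ℝ) ∧ ContDiff ℝ (⊤ : ℕ∞) (f.symm : ℝ → ℝ) ∧ StrictMono (f : ℝ → ℝ)

/-- The displacement of `f`. -/
def disp (f : Equiv.Perm ℝ) : ℝ → ℝ := fun x => f x - x

/-- The `R`-th derivative of the displacement of `f` is bounded by `m`. -/
def DB (f : Equiv.Perm ℝ) (R : ℕ) (m : ℝ) : Prop := ∀ x, |iteratedDeriv R (disp f) x| ≤ m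

/-- `f` is the identity outside `[a, b]`. -/
def SuppIn (f : Equiv.Perm ℝ) (a b : ℝ) : Prop := ∀ x, x ≤ a ∨ b ≤ x → f x = x

theorem IsDiffeo.one : IsDiffeo 1 := ⟨contDiff_id, contDiff_id, strictMono_id⟩

theorem IsDiffeo.mul {f g : Equiv.Perm ℝ} (hf : IsDiffeo f) (hg : IsDiffeo g) :
    IsDiffeo (f * g) :=
  ⟨hf.1.comp hg.1, hg.2.1.comp hf.2.1, hf.2.2.comp hg.2.2⟩

theorem IsDiffeo.inv {f : Equiv.Perm ℝ} (hf : IsDiffeo f) : IsDiffeo f⁻¹ := by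
  refine ⟨hf.2.1, hf.1, fun x y h => ?_⟩
  by_contra hc
  have := hf.2.2.monotone (not_lt.1 hc)
  simp at this
  exact absurd h (not_lt.2 this)

theorem IsDiffeo.pow {f : Equiv.Perm ℝ} (hf : IsDiffeo f) (n : ℕ) : IsDiffeo (f ^ n) := by
  induction n with
  | zero => exact IsDiffeo.one
  | succ n ih => rw [pow_succ]; exact ih.mul hf

theorem IsDiffeo.contDiff_disp {f : Equiv.Perm ℝ} (hf : IsDiffeo f) :
    ContDiff ℝ (⊤ : ℕ∞) (disp f) := hf.1.sub contDiff_id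

theorem SuppIn.one (a b : ℝ) : SuppIn 1 a b := fun _ _ => rfl

theorem SuppIn.mul {f g : Equiv.Perm ℝ} {a b : ℝ} (hf : SuppIn f a b) (hg : SuppIn g a b) :
    SuppIn (f * g) a b := fun x hx => by
  rw [Equiv.Perm.mul_apply, hg x hx, hf x hx]

theorem SuppIn.pow {f : Equiv.Perm ℝ} {a b : ℝ} (hf : SuppIn f a b) (n : ℕ) :
    SuppIn (f ^ n) a b := by
  induction n with
  | zero => exact SuppIn.one a b
  | succ n ih => rw [pow_succ]; exact ih.mul hf

theorem SuppIn.inv {f : Equiv.Perm ℝ} {a b : ℝ} (hf : SuppIn f a b) : SuppIn f⁻¹ a b :=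
  fun x hx => by rw [Equiv.Perm.inv_eq_iff_eq, hf x hx]

theorem SuppIn.mono {f : Equiv.Perm ℝ} {a b a' b' : ℝ} (hf : SuppIn f a b) (ha : a' ≤ a)
    (hb : b ≤ b') : SuppIn f a' b' := fun x hx => hf x (by
  rcases hx with hx | hx
  · left; linarith
  · right; linarith)

theorem SuppIn.disp_eq_zero {f : Equiv.Perm ℝ} {a b : ℝ} (hf : SuppIn f a b) {x : ℝ}
    (hx : x ≤ a ∨ b ≤ x) : disp f x = 0 := by
  simp [disp, hf x hx]

theorem DB.mono {f : Equiv.Perm ℝ} {R : ℕ} {m m' : ℝ} (h : DB f R m) (hm : m ≤ m') :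
    DB f R m' := fun x => (h x).trans hm

theorem disp_mul (f g : Equiv.Perm ℝ) : disp (f * g) = fun x => disp f (g x) + disp g x := by
  ext x; simp [disp]

/-- The affine map `x ↦ μ x + c`. -/
def affP (μ c : ℝ) (h : 0 < μ) : Equiv.Perm ℝ where
  toFun x := μ * x + c
  invFun x := μ⁻¹ * (x - c)
  left_inv x := by field_simp; ring
  right_inv x := by field_simp; ring

@[simp] theorem affP_apply (μ c : ℝ) (h : 0 < μ) (x : ℝ) : affP μ c h x = μ * x + c := rfl

@[simp] theorem affP_inv_apply (μ c : ℝ) (h : 0 < μ) (x : ℝ) :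
    (affP μ c h)⁻¹ x = μ⁻¹ * (x - c) := rfl

theorem affP_isDiffeo (μ c : ℝ) (h : 0 < μ) : IsDiffeo (affP μ c h) := by
  refine ⟨?_, ?_, fun x y hxy => ?_⟩
  · exact (contDiff_const.mul contDiff_id).add contDiff_const
  · exact contDiff_const.mul (contDiff_id.sub contDiff_const)
  · simp only [affP_apply]; nlinarith

theorem disp_conj_affP (μ c : ℝ) (h : 0 < μ) (f : Equiv.Perm ℝ) :
    disp (affP μ c h * f * (affP μ c h)⁻¹) = fun x => μ * disp f (μ⁻¹ * (x - c)) := by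
  ext x
  simp only [disp, Equiv.Perm.mul_apply, affP_apply, affP_inv_apply]
  field_simp
  ring

theorem iteratedDeriv_comp_affine {u : ℝ → ℝ} (hu : ContDiff ℝ (⊤ : ℕ∞) u) (n : ℕ) (a b c : ℝ) :
    iteratedDeriv n (fun x => c * u (a * (x - b))) =
      fun x => c * a ^ n * iteratedDeriv n u (a * (x - b)) := by
  induction n with
  | zero => simp
  | succ n ih =>
    rw [iteratedDeriv_succ, ih]
    ext x
    have h1 : HasDerivAt (fun x => a * (x - b)) a x := by
      simpa using ((hasDerivAt_id x).sub_const b).const_mul a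
    have h2 : DifferentiableAt ℝ (iteratedDeriv n u) (a * (x - b)) :=
      (hu.differentiable_iteratedDeriv n (by exact_mod_cast WithTop.coe_lt_top _)).differentiableAt
    have h3 := (h2.hasDerivAt.comp x h1).const_mul (c * a ^ n)
    have h4 := h3.deriv
    simp only [Function.comp_def] at h4
    rw [h4, iteratedDeriv_succ]
    ring

theorem iteratedDeriv_disp_conj_affP (μ c : ℝ) (h : 0 < μ) {f : Equiv.Perm ℝ} (hf : IsDiffeo f)
    (n : ℕ) (x : ℝ) :
    iteratedDeriv n (disp (affP μ c h * f * (affP μ c h)⁻¹)) x =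
      μ * μ⁻¹ ^ n * iteratedDeriv n (disp f) (μ⁻¹ * (x - c)) := by
  rw [disp_conj_affP, iteratedDeriv_comp_affine hf.contDiff_disp]

theorem DB.conj_affP {f : Equiv.Perm ℝ} {n : ℕ} {m : ℝ} (hm : DB f n m) (hf : IsDiffeo f)
    (μ c : ℝ) (h : 0 < μ) :
    DB (affP μ c h * f * (affP μ c h)⁻¹) n (μ * μ⁻¹ ^ n * m) := fun x => by
  rw [iteratedDeriv_disp_conj_affP _ _ _ hf, abs_mul, abs_of_pos (by positivity)]
  exact mul_le_mul_of_nonneg_left (hm _) (by positivity)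

theorem SuppIn.conj_affP {f : Equiv.Perm ℝ} {a b : ℝ} (hf : SuppIn f a b) (μ c : ℝ) (h : 0 < μ) :
    SuppIn (affP μ c h * f * (affP μ c h)⁻¹) (μ * a + c) (μ * b + c) := fun x hx => by
  simp only [Equiv.Perm.mul_apply, affP_apply, affP_inv_apply]
  rw [hf]
  · field_simp; ring
  · rcases hx with hx | hx
    · left; rw [inv_mul_le_iff₀ h]; linarith
    · right; rw [le_inv_mul_iff₀ h]; linarith

/-- A smooth perturbation of the identity with small derivative is a diffeomorphism. -/
theorem exists_diffeo_of_disp {v : ℝ → ℝ} (hv : ContDiff ℝ (⊤ : ℕ∞) v)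
    (hv' : ∀ x, |deriv v x| ≤ 1 / 2) : ∃ f : Equiv.Perm ℝ, IsDiffeo f ∧ disp f = v := by
  have hd : Differentiable ℝ v := hv.differentiable (by simp)
  set F : ℝ → ℝ := fun x => x + v x with hF
  have hFd : ∀ x, HasDerivAt F (1 + deriv v x) x := fun x =>
    (hasDerivAt_id x).add (hd x).hasDerivAt
  have hpos : ∀ x, 1 / 2 ≤ 1 + deriv v x := fun x => by linarith [(abs_le.1 (hv' x)).1]
  have hmono : StrictMono F := strictMono_of_deriv_pos fun x => by
    rw [(hFd x).deriv]; linarith [hpos x]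
  have hgrow : Monotone fun x => F x - x / 2 := by
    apply monotone_of_deriv_nonneg
    · exact fun x => ((hFd x).sub ((hasDerivAt_id x).div_const 2)).differentiableAt
    · intro x
      have := ((hFd x).sub ((hasDerivAt_id x).div_const 2)).deriv
      change 0 ≤ deriv (F - fun x => id x / 2) x
      rw [this]; linarith [hpos x]
  have hcont : Continuous F := continuous_id.add hv.continuous
  have hsurj : Function.Surjective F := by
    apply hcont.surjective
    · refine tendsto_atTop_mono' (f₁ := fun x => x / 2 + F 0) _ ?_ ?_
      · filter_upwards [eventually_ge_atTop 0] with x hx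
        have := hgrow hx
        simp only at this; linarith
      · exact tendsto_atTop_add_const_right _ _ (tendsto_id.atTop_div_const (by norm_num))
    · refine tendsto_atBot_mono' (f₂ := F) (f₁ := fun x => x / 2 + F 0) _ ?_ ?_
      · filter_upwards [eventually_le_atBot 0] with x hx
        have := hgrow hx
        simp only at this; linarith
      · exact tendsto_atBot_add_const_right _ _ (tendsto_id.atBot_div_const (by norm_num))
  set e : ℝ ≃o ℝ := StrictMono.orderIsoOfSurjective F hmono hsurj with he
  have hFs : ContDiff ℝ (⊤ : ℕ∞) F := contDiff_id.add hv
  refine ⟨e.toEquiv, ⟨hFs, ?_, hmono⟩, ?_⟩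
  · exact Homeomorph.contDiff_symm_deriv e.toHomeomorph (f' := fun x => 1 + deriv v x)
      (fun x => by linarith [hpos x]) (fun x => hFd x) hFs
  · ext x
    change F x - x = v x
    simp [hF]

theorem smooth_iteratedDeriv {w : ℝ → ℝ} (hw : ContDiff ℝ (⊤ : ℕ∞) w) (n : ℕ) :
    ContDiff ℝ (⊤ : ℕ∞) (iteratedDeriv n w) := by
  induction n with
  | zero => simpa using hw
  | succ n ih =>
    rw [iteratedDeriv_succ]
    exact ((contDiff_infty_iff_deriv (𝕜 := ℝ)).1 ih).2

theorem hasDerivAt_iteratedDeriv {w : ℝ → ℝ} (hw : ContDiff ℝ (⊤ : ℕ∞) w) (n : ℕ) (x : ℝ) :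
    HasDerivAt (iteratedDeriv n w) (iteratedDeriv (n + 1) w x) x := by
  rw [iteratedDeriv_succ]
  exact ((smooth_iteratedDeriv hw n).differentiable (by simp) x).hasDerivAt

theorem abs_iteratedDeriv_sub_le {w : ℝ → ℝ} (hw : ContDiff ℝ (⊤ : ℕ∞) w) (n : ℕ) {s : Set ℝ}
    (hs : Convex ℝ s) {B : ℝ} (hB : ∀ x ∈ s, |iteratedDeriv (n + 1) w x| ≤ B) {x y : ℝ}
    (hx : x ∈ s) (hy : y ∈ s) :
    |iteratedDeriv n w y - iteratedDeriv n w x| ≤ B * |y - x| :=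
  hs.norm_image_sub_le_of_norm_hasDerivWithin_le
    (fun z _ => (hasDerivAt_iteratedDeriv hw n z).hasDerivWithinAt) hB hx hy

theorem iteratedDeriv_fun_add_smooth {u v : ℝ → ℝ} (hu : ContDiff ℝ (⊤ : ℕ∞) u)
    (hv : ContDiff ℝ (⊤ : ℕ∞) v) (n : ℕ) (x : ℝ) :
    iteratedDeriv n (fun y => u y + v y) x = iteratedDeriv n u x + iteratedDeriv n v x :=
  iteratedDeriv_fun_add (hu.of_le (by exact_mod_cast le_top)).contDiffAt
    (hv.of_le (by exact_mod_cast le_top)).contDiffAt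

theorem exists_iteratedDeriv_small (l : ℕ) : ∀ h : ℝ, 0 < h → ∃ C : ℝ, 0 < C ∧
    ∀ (w : ℝ → ℝ) (β : ℝ), ContDiff ℝ (⊤ : ℕ∞) w → (∀ x, |w x| ≤ β) →
      ∀ x, ∃ ξ ∈ Icc x (x + h), |iteratedDeriv l w ξ| ≤ C * β := by
  induction l with
  | zero =>
    intro h hh
    refine ⟨1, one_pos, fun w β _ hβ x => ⟨x, ⟨le_rfl, by linarith⟩, ?_⟩⟩
    simpa using hβ x
  | succ l ih =>
    intro h hh
    obtain ⟨C, hC, H⟩ := ih (h / 3) (by positivity)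
    refine ⟨6 * C / h, by positivity, fun w β hw hβ x => ?_⟩
    obtain ⟨a, ⟨ha1, ha2⟩, ha⟩ := H w β hw hβ x
    obtain ⟨b, ⟨hb1, hb2⟩, hb⟩ := H w β hw hβ (x + 2 * h / 3)
    have hab : a < b := by linarith
    obtain ⟨c, ⟨hc1, hc2⟩, hc⟩ := exists_hasDerivAt_eq_slope (iteratedDeriv l w) _ hab
      (smooth_iteratedDeriv hw l).continuous.continuousOn
      (fun x _ => hasDerivAt_iteratedDeriv hw l x)
    refine ⟨c, ⟨by linarith, by linarith⟩, ?_⟩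
    rw [hc, abs_div, abs_of_pos (sub_pos.2 hab), div_le_iff₀ (sub_pos.2 hab)]
    have h1 : |iteratedDeriv l w b - iteratedDeriv l w a| ≤ 2 * (C * β) := by
      have := abs_sub (iteratedDeriv l w b) (iteratedDeriv l w a)
      linarith
    have hβ0 : 0 ≤ β := (abs_nonneg _).trans (hβ 0)
    calc _ ≤ 2 * (C * β) := h1
      _ = 6 * C / h * β * (h / 3) := by field_simp; ring
      _ ≤ _ := by gcongr; linarith

/-- Landau's inequality: intermediate derivatives are controlled by the extreme ones. -/
theorem landau (n : ℕ) : ∃ C : ℝ, 1 ≤ C ∧ ∀ (w : ℝ → ℝ) (β : ℝ), ContDiff ℝ (⊤ : ℕ∞) w →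
    (∀ x, |w x| ≤ β) → (∀ x, |iteratedDeriv n w x| ≤ β) →
      ∀ j ≤ n, ∀ x, |iteratedDeriv j w x| ≤ C * β := by
  induction n with
  | zero =>
    refine ⟨1, le_rfl, fun w β _ hβ _ j hj x => ?_⟩
    obtain rfl : j = 0 := by omega
    simpa using hβ x
  | succ n ih =>
    obtain ⟨C, hC, H⟩ := ih
    obtain ⟨C₀, hC₀, H₀⟩ := exists_iteratedDeriv_small n 1 one_pos
    refine ⟨C * (C₀ + 1), by nlinarith, fun w β hw hβ hn j hj x => ?_⟩
    have hβ0 : 0 ≤ β := (abs_nonneg _).trans (hβ 0)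
    rcases Nat.lt_or_ge n j with h | h
    · obtain rfl : j = n + 1 := by omega
      refine (hn x).trans ?_
      nlinarith [mul_nonneg (by nlinarith : 0 ≤ C * (C₀ + 1) - 1) hβ0]
    · rw [mul_assoc]
      refine H w ((C₀ + 1) * β) hw (fun x => (hβ x).trans (by nlinarith)) (fun y => ?_) j h x
      obtain ⟨ξ, ⟨h1, h2⟩, hξ⟩ := H₀ w β hw hβ y
      have := abs_iteratedDeriv_sub_le hw n convex_univ (fun x _ => hn x) (mem_univ ξ) (mem_univ y)
      have h3 : |y - ξ| ≤ 1 := by rw [abs_le]; constructor <;> linarith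
      have h4 := abs_sub_abs_le_abs_sub (iteratedDeriv n w y) (iteratedDeriv n w ξ)
      nlinarith

theorem landau_disp (R : ℕ) (hR : 2 ≤ R) : ∃ C : ℝ, 1 ≤ C ∧ ∀ (f : Equiv.Perm ℝ) (β : ℝ),
    IsDiffeo f → DB f 1 β → DB f R β → ∀ j, 1 ≤ j → j ≤ R → DB f j (C * β) := by
  obtain ⟨C, hC, H⟩ := landau (R - 1)
  refine ⟨C, hC, fun f β hf h1 h2 j hj hjR x => ?_⟩
  obtain ⟨j, rfl⟩ : ∃ i, j = i + 1 := ⟨j - 1, by omega⟩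
  obtain ⟨R, rfl⟩ : ∃ i, R = i + 1 := ⟨R - 1, by omega⟩
  have hs : ContDiff ℝ (⊤ : ℕ∞) (deriv (disp f)) := by
    simpa [iteratedDeriv_one] using smooth_iteratedDeriv hf.contDiff_disp 1
  rw [iteratedDeriv_succ']
  refine H _ β hs (fun x => ?_) (fun x => ?_) j (by omega) x
  · simpa [iteratedDeriv_one] using h1 x
  · have := h2 x
    rwa [iteratedDeriv_succ'] at this

theorem abs_iteratedDeriv_comp_le {u G : ℝ → ℝ} (hu : ContDiff ℝ (⊤ : ℕ∞) u)
    (hG : ContDiff ℝ (⊤ : ℕ∞) G) {j : ℕ} (hj : 1 ≤ j) {x B : ℝ} (hB : 0 ≤ B)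
    (h1 : ∀ i, 1 ≤ i → i ≤ j → |iteratedDeriv i u (G x)| ≤ B)
    (h2 : ∀ i, 1 ≤ i → i ≤ j → |iteratedDeriv i G x| ≤ 2 ^ i) :
    |iteratedDeriv j (fun y => u (G y)) x| ≤ j.factorial * B * 2 ^ j := by
  set w : ℝ → ℝ := fun y => - u (G x) + u y with hw
  have hws : ContDiff ℝ (⊤ : ℕ∞) w := contDiff_const.add hu
  have hD : ∀ i, 1 ≤ i → iteratedDeriv i w = iteratedDeriv i u := fun i hi => by
    ext y
    exact iteratedDeriv_const_add (by omega) _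
  have key : ‖iteratedFDeriv ℝ j (w ∘ G) x‖ ≤ j.factorial * B * 2 ^ j := by
    refine norm_iteratedFDeriv_comp_le hws hG (by exact_mod_cast le_top) x (fun i hi => ?_)
      (fun i hi hij => ?_)
    · rw [norm_iteratedFDeriv_eq_norm_iteratedDeriv, Real.norm_eq_abs]
      rcases Nat.eq_zero_or_pos i with rfl | h
      · simpa [hw] using hB
      · rw [hD i h]; exact h1 i h hi
    · rw [norm_iteratedFDeriv_eq_norm_iteratedDeriv, Real.norm_eq_abs]
      exact h2 i hi hij
  rw [norm_iteratedFDeriv_eq_norm_iteratedDeriv, Real.norm_eq_abs] at key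
  have : (w ∘ G) = fun y => - u (G x) + u (G y) := rfl
  rwa [this, iteratedDeriv_const_add (by omega)] at key

theorem abs_iteratedDeriv_coe_le {f : Equiv.Perm ℝ} (hf : IsDiffeo f) {i : ℕ} (hi : 1 ≤ i) (x : ℝ) :
    |iteratedDeriv i f x| ≤ 1 + |iteratedDeriv i (disp f) x| := by
  have h1 : (f : ℝ → ℝ) = id + disp f := by ext x; simp [disp]
  rw [h1, iteratedDeriv_add contDiff_id.contDiffAt
    (hf.contDiff_disp.of_le (by exact_mod_cast le_top)).contDiffAt]
  refine (abs_add_le _ _).trans ?_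
  gcongr
  rw [iteratedDeriv_id]
  split_ifs <;> simp_all

theorem abs_iteratedDeriv_coe_le_pow {f : Equiv.Perm ℝ} (hf : IsDiffeo f) {i : ℕ} (hi : 1 ≤ i)
    {x : ℝ} (h : |iteratedDeriv i (disp f) x| ≤ 1) : |iteratedDeriv i f x| ≤ 2 ^ i := by
  refine (abs_iteratedDeriv_coe_le hf hi x).trans ?_
  calc _ ≤ (2 : ℝ) ^ 1 := by linarith
    _ ≤ _ := pow_le_pow_right₀ (by norm_num) hi

theorem IsDiffeo.list_prod {l : List (Equiv.Perm ℝ)} (h : ∀ f ∈ l, IsDiffeo f) :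
    IsDiffeo l.prod := by
  induction l with
  | nil => exact IsDiffeo.one
  | cons f l ih =>
    rw [List.prod_cons]
    exact (h f (by simp)).mul (ih fun g hg => h g (by simp [hg]))

theorem disp_one : disp 1 = fun _ => 0 := by ext; simp [disp]

theorem comp_uniform (R : ℕ) : ∃ C : ℝ, 1 ≤ C ∧ ∀ (β : ℝ) (_ : 0 < β) (l : List (Equiv.Perm ℝ)),
    (∀ f ∈ l, IsDiffeo f ∧ ∀ j, 1 ≤ j → j ≤ R → DB f j β) → C * l.length * β ≤ 1 →
      ∀ j, 1 ≤ j → j ≤ R → DB l.prod j (C * l.length * β) := by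
  refine ⟨R.factorial * 2 ^ R, ?_, fun β hβ l => ?_⟩
  · have : (1 : ℝ) ≤ R.factorial := by exact_mod_cast Nat.factorial_pos R
    have : (1 : ℝ) ≤ 2 ^ R := one_le_pow₀ (by norm_num)
    nlinarith
  induction l with
  | nil =>
    intro _ _ j _ _ x
    simp [disp_one]
  | cons f l ih =>
    intro hl hC j hj hjR x
    have hf := hl f (by simp)
    have hl' : ∀ g ∈ l, IsDiffeo g ∧ ∀ j, 1 ≤ j → j ≤ R → DB g j β :=
      fun g hg => hl g (by simp [hg])
    have hCβ : 0 < (R.factorial * 2 ^ R : ℝ) * β := by positivity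
    rw [List.length_cons] at hC ⊢
    push_cast at hC ⊢
    have hC' : (R.factorial * 2 ^ R : ℝ) * l.length * β ≤ 1 := by nlinarith
    have ih := ih hl' hC'
    have hG : IsDiffeo l.prod := IsDiffeo.list_prod fun g hg => (hl' g hg).1
    rw [List.prod_cons, disp_mul,
      iteratedDeriv_fun_add_smooth (u := fun y => disp f (l.prod y))
        (hf.1.contDiff_disp.comp hG.1) hG.contDiff_disp]
    have h1 : |iteratedDeriv j (fun y => disp f (l.prod y)) x| ≤ j.factorial * β * 2 ^ j :=
      abs_iteratedDeriv_comp_le hf.1.contDiff_disp hG.1 hj hβ.le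
        (fun i hi hij => hf.2 i hi (hij.trans hjR) _)
        (fun i hi hij => abs_iteratedDeriv_coe_le_pow hG hi
          ((ih i hi (hij.trans hjR) x).trans hC'))
    have h2 : (j.factorial * β * 2 ^ j : ℝ) ≤ R.factorial * β * 2 ^ R := by
      have : (j.factorial : ℝ) ≤ R.factorial := by exact_mod_cast Nat.factorial_le hjR
      have : (2 : ℝ) ^ j ≤ 2 ^ R := pow_le_pow_right₀ (by norm_num) hjR
      gcongr
    refine (abs_add_le _ _).trans ?_
    have := ih j hj hjR x
    nlinarith

theorem exists_scale (R : ℕ) (hR : 2 ≤ R) {β m : ℝ} (hβ : 0 < β) (hm : 0 < m) :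
    ∃ θ : ℝ, 0 < θ ∧ θ * θ⁻¹ ^ R * m = β := by
  refine ⟨(m / β) ^ (1 / ((R - 1 : ℕ) : ℝ)), by positivity, ?_⟩
  set θ := (m / β) ^ (1 / ((R - 1 : ℕ) : ℝ)) with hθ
  have h0 : 0 < θ := by positivity
  have h1 : θ ^ (R - 1) = m / β := by
    rw [hθ, ← Real.rpow_natCast, ← Real.rpow_mul (by positivity), one_div,
      inv_mul_cancel₀, Real.rpow_one]
    have : 0 < R - 1 := by omega
    positivity
  obtain ⟨S, rfl⟩ : ∃ S, R = S + 1 := ⟨R - 1, by omega⟩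
  simp only [Nat.add_sub_cancel] at h1
  rw [pow_succ, inv_pow, h1]
  field_simp

theorem DB.of_conj_affP {f : Equiv.Perm ℝ} {n : ℕ} {m : ℝ} (μ c : ℝ) (h : 0 < μ)
    (hm : DB (affP μ c h * f * (affP μ c h)⁻¹) n (μ * μ⁻¹ ^ n * m)) (hf : IsDiffeo f) :
    DB f n m := fun x => by
  have := hm (μ * x + c)
  rw [iteratedDeriv_disp_conj_affP _ _ _ hf, abs_mul, abs_of_pos (by positivity)] at this
  have h2 := le_of_mul_le_mul_left this (by positivity)
  simpa [h.ne'] using h2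

theorem IsDiffeo.conj_affP {f : Equiv.Perm ℝ} (hf : IsDiffeo f) (μ c : ℝ) (h : 0 < μ) :
    IsDiffeo (affP μ c h * f * (affP μ c h)⁻¹) :=
  ((affP_isDiffeo μ c h).mul hf).mul (affP_isDiffeo μ c h).inv

/-- Tame estimates for compositions of many diffeomorphisms. -/
theorem comp_bound (R : ℕ) (hR : 2 ≤ R) : ∃ C : ℝ, 1 ≤ C ∧ ∀ (β m : ℝ) (_ : 0 < β) (_ : 0 < m)
    (l : List (Equiv.Perm ℝ)), (∀ f ∈ l, IsDiffeo f ∧ DB f 1 β ∧ DB f R m) →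
      C * l.length * β ≤ 1 → DB l.prod 1 (C * l.length * β) ∧ DB l.prod R (C * l.length * m) := by
  obtain ⟨C₁, hC₁, H₁⟩ := comp_uniform R
  obtain ⟨C₂, hC₂, H₂⟩ := landau_disp R hR
  refine ⟨C₁ * C₂, by nlinarith, fun β m hβ hm l hl hlen => ?_⟩
  obtain ⟨θ, hθ, hθm⟩ := exists_scale R hR hβ hm
  set A := affP θ 0 hθ with hA
  have key := H₁ (C₂ * β) (by positivity) (l.map (MulAut.conj A)) (fun g hg => by
    obtain ⟨f, hf, rfl⟩ := List.mem_map.1 hg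
    obtain ⟨h1, h2, h3⟩ := hl f hf
    refine ⟨h1.conj_affP _ _ _, fun j hj hjR => H₂ _ β (h1.conj_affP _ _ _) ?_ ?_ j hj hjR⟩
    · have := h2.conj_affP h1 θ 0 hθ
      rwa [pow_one, mul_inv_cancel₀ hθ.ne', one_mul] at this
    · have := h3.conj_affP h1 θ 0 hθ
      rwa [hθm] at this) (by simpa [mul_assoc, mul_left_comm, mul_comm] using hlen)
  rw [← map_list_prod, List.length_map] at key
  have hG : IsDiffeo l.prod := IsDiffeo.list_prod fun g hg => (hl g hg).1
  refine ⟨DB.of_conj_affP θ 0 hθ ?_ hG, DB.of_conj_affP θ 0 hθ ?_ hG⟩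
  · refine DB.mono (key 1 le_rfl (by omega)) ?_
    rw [pow_one, mul_inv_cancel₀ hθ.ne', one_mul]
    exact le_of_eq (by ring)
  · refine DB.mono (key R (by omega) le_rfl) (le_of_eq ?_)
    calc _ = C₁ * C₂ * l.length * β := by ring
      _ = _ := by rw [← hθm]; ring

theorem recip_bound {w : ℝ → ℝ} (hw : ContDiff ℝ (⊤ : ℕ∞) w) (R : ℕ) {β : ℝ}
    (hβ : 2 ^ R * 4 * β ≤ 1) (x : ℝ) (hne : ∀ y, 1 + w y ≠ 0)
    (h : ∀ i ≤ R, |iteratedDeriv i w x| ≤ β) :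
    ∀ i ≤ R, |iteratedDeriv i (fun y => (1 + w y)⁻¹ - 1) x| ≤ 4 * β := by
  set ψ : ℝ → ℝ := fun y => (1 + w y)⁻¹ - 1 with hψ
  have hψs : ContDiff ℝ (⊤ : ℕ∞) ψ := ((contDiff_const.add hw).inv hne).sub contDiff_const
  have heq : ψ = fun y => - (w y + w y * ψ y) := by
    ext y
    have := hne y
    simp only [hψ]; field_simp; ring
  have hβ0 : 0 ≤ β := (abs_nonneg _).trans (h 0 (by omega))
  have h2R : (1 : ℝ) ≤ 2 ^ R := one_le_pow₀ (by norm_num)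
  have hβ4 : 4 * β ≤ 1 := by nlinarith
  intro i
  induction i using Nat.strong_induction_on with
  | _ i ih =>
    intro hi
    have h1 : iteratedDeriv i ψ x =
        -(iteratedDeriv i w x + iteratedDeriv i (fun y => w y * ψ y) x) := by
      conv_lhs => rw [heq]
      rw [iteratedDeriv_fun_neg,
        iteratedDeriv_fun_add_smooth (v := fun y => w y * ψ y) hw (hw.mul hψs)]
    have h2 := iteratedDeriv_fun_mul (n := i) (x := x)
      (hw.of_le (by exact_mod_cast le_top)).contDiffAt
      (hψs.of_le (by exact_mod_cast le_top)).contDiffAt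
    rw [Finset.sum_range_succ'] at h2
    have h3 : |∑ k ∈ Finset.range i, (i.choose (k + 1) : ℝ) * iteratedDeriv (k + 1) w x *
        iteratedDeriv (i - (k + 1)) ψ x| ≤ 2 ^ R * β * (4 * β) := by
      refine (Finset.abs_sum_le_sum_abs _ _).trans ?_
      calc _ ≤ ∑ k ∈ Finset.range i, (i.choose (k + 1) : ℝ) * β * (4 * β) := by
            refine Finset.sum_le_sum fun k hk => ?_
            rw [Finset.mem_range] at hk
            rw [abs_mul, abs_mul, Nat.abs_cast]
            have e1 := h (k + 1) (by omega)
            have e2 := ih (i - (k + 1)) (by omega) (by omega)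
            gcongr
        _ = (∑ k ∈ Finset.range i, (i.choose (k + 1) : ℝ)) * (β * (4 * β)) := by
            rw [Finset.sum_mul]; exact Finset.sum_congr rfl fun _ _ => by ring
        _ ≤ 2 ^ i * (β * (4 * β)) := by
            gcongr
            have := Nat.sum_range_choose i
            rw [Finset.sum_range_succ'] at this
            have h' : ∑ k ∈ Finset.range i, i.choose (k + 1) ≤ 2 ^ i := by omega
            exact_mod_cast h'
        _ ≤ 2 ^ R * (β * (4 * β)) := by
            gcongr; norm_num
        _ = _ := by ring
    simp only [Nat.choose_zero_right, Nat.cast_one, one_mul, iteratedDeriv_zero, tsub_zero] at h2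
    rw [h1, h2, abs_neg]
    have e0 := h i hi
    have e1 : |w x| ≤ β := by simpa using h 0 (by omega)
    set S := ∑ k ∈ Finset.range i, (i.choose (k + 1) : ℝ) * iteratedDeriv (k + 1) w x *
        iteratedDeriv (i - (k + 1)) ψ x
    have h4 : |iteratedDeriv i ψ x| ≤ β + (2 ^ R * β * (4 * β) + β * |iteratedDeriv i ψ x|) := by
      conv_lhs => rw [h1, h2, abs_neg]
      refine (abs_add_le _ _).trans (add_le_add e0 ((abs_add_le _ _).trans (add_le_add h3 ?_)))
      rw [abs_mul]
      gcongr
    have h5 : |iteratedDeriv i ψ x| ≤ 4 * β := by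
      nlinarith [abs_nonneg (iteratedDeriv i ψ x)]
    rwa [h1, h2, abs_neg] at h5

theorem inv_uniform (R : ℕ) : ∃ C : ℝ, 1 ≤ C ∧ ∀ (f : Equiv.Perm ℝ) (β : ℝ), IsDiffeo f →
    (∀ j, 1 ≤ j → j ≤ R → DB f j β) → C * β ≤ 1 →
      ∀ j, 1 ≤ j → j ≤ R → DB f⁻¹ j (C * β) := by
  refine ⟨R.factorial * 4 * 2 ^ R, ?_, fun f β hf hβ hC j hj hjR => ?_⟩
  · have : (1 : ℝ) ≤ R.factorial := by exact_mod_cast Nat.factorial_pos R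
    have : (1 : ℝ) ≤ 2 ^ R := one_le_pow₀ (by norm_num)
    nlinarith
  have hF1 : (1 : ℝ) ≤ R.factorial := by exact_mod_cast Nat.factorial_pos R
  have h2R : (1 : ℝ) ≤ 2 ^ R := one_le_pow₀ (by norm_num)
  have hβ0 : 0 ≤ β := (abs_nonneg _).trans (hβ 1 le_rfl (by omega) 0)
  have hsm : 2 ^ R * 4 * β ≤ 1 := by
    refine le_trans ?_ hC
    have : (2 : ℝ) ^ R * 4 * β * 1 ≤ 2 ^ R * 4 * β * R.factorial := by gcongr
    linarith
  set w := deriv (disp f) with hw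
  have hws : ContDiff ℝ (⊤ : ℕ∞) w := by
    simpa [iteratedDeriv_one] using smooth_iteratedDeriv hf.contDiff_disp 1
  have hwb : ∀ x, |w x| ≤ β := fun x => by
    simpa [iteratedDeriv_one] using hβ 1 le_rfl (by omega) x
  have hne : ∀ y, 1 + w y ≠ 0 := fun y => by
    have := (abs_le.1 (hwb y)).1
    have : 4 * β ≤ 1 := by nlinarith
    linarith
  set ψ : ℝ → ℝ := fun y => (1 + w y)⁻¹ - 1 with hψ
  have hψs : ContDiff ℝ (⊤ : ℕ∞) ψ := ((contDiff_const.add hws).inv hne).sub contDiff_const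
  have hψb : ∀ i, i + 1 ≤ R → ∀ x, |iteratedDeriv i ψ x| ≤ 4 * β := fun i hi x =>
    recip_bound hws (R - 1) (by
      refine le_trans ?_ hsm
      have : (2 : ℝ) ^ (R - 1) ≤ 2 ^ R := pow_le_pow_right₀ (by norm_num) (by omega)
      gcongr) x hne (fun i hi => by
        have := hβ (i + 1) (by omega) (by omega) x
        rwa [iteratedDeriv_succ'] at this) i (by omega)
  have hder : deriv (disp f⁻¹) = fun x => ψ (f⁻¹ x) := by
    ext x
    have h1 : HasDerivAt f (1 + w (f⁻¹ x)) (f⁻¹ x) := by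
      have := (hasDerivAt_id (f⁻¹ x)).add
        ((hf.contDiff_disp.differentiable (by simp) (f⁻¹ x)).hasDerivAt)
      refine this.congr_of_eventuallyEq (Eventually.of_forall fun y => ?_)
      simp [disp]
    have h2 := (HasDerivAt.of_local_left_inverse (f := f) (g := (f⁻¹ : Equiv.Perm ℝ))
      hf.inv.1.continuous.continuousAt h1 (hne _)
      (Eventually.of_forall fun y => by simp)).sub (hasDerivAt_id x)
    exact h2.deriv
  have hC1 : 4 * β * (R.factorial * 2 ^ R) ≤ 1 := by linarith
  revert hj hjR
  induction j using Nat.strong_induction_on with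
  | _ j ih =>
    intro hj hjR x
    obtain ⟨j, rfl⟩ : ∃ i, j = i + 1 := ⟨j - 1, by omega⟩
    rw [iteratedDeriv_succ', hder]
    have hle : 4 * β ≤ R.factorial * 4 * 2 ^ R * β := by
      calc 4 * β = 1 * 4 * 1 * β := by ring
        _ ≤ _ := by gcongr
    rcases Nat.eq_zero_or_pos j with rfl | h
    · simpa using (hψb 0 (by omega) (f⁻¹ x)).trans hle
    · refine (abs_iteratedDeriv_comp_le hψs hf.inv.1 h (by positivity : 0 ≤ 4 * β)
        (fun i hi hij => hψb i (by omega) _)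
        (fun i hi hij => abs_iteratedDeriv_coe_le_pow hf.inv hi
          ((ih i (by omega) hi (by omega) x).trans hC))).trans ?_
      have : (j.factorial : ℝ) ≤ R.factorial := by exact_mod_cast Nat.factorial_le (by omega)
      have : (2 : ℝ) ^ j ≤ 2 ^ R := pow_le_pow_right₀ (by norm_num) (by omega)
      calc _ ≤ (R.factorial * (4 * β) * 2 ^ R : ℝ) := by gcongr
        _ = _ := by ring

/-- Tame estimates for the inverse. -/
theorem inv_bound (R : ℕ) (hR : 2 ≤ R) : ∃ C : ℝ, 1 ≤ C ∧ ∀ (β m : ℝ) (_ : 0 < β) (_ : 0 < m)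
    (f : Equiv.Perm ℝ), IsDiffeo f → DB f 1 β → DB f R m →
      C * β ≤ 1 → DB f⁻¹ 1 (C * β) ∧ DB f⁻¹ R (C * m) := by
  obtain ⟨C₁, hC₁, H₁⟩ := inv_uniform R
  obtain ⟨C₂, hC₂, H₂⟩ := landau_disp R hR
  refine ⟨C₁ * C₂, by nlinarith, fun β m hβ hm f h1 h2 h3 hC => ?_⟩
  obtain ⟨θ, hθ, hθm⟩ := exists_scale R hR hβ hm
  set A := affP θ 0 hθ with hA
  have key := H₁ (A * f * A⁻¹) (C₂ * β) (h1.conj_affP _ _ _) (fun j hj hjR => by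
    refine H₂ _ β (h1.conj_affP _ _ _) ?_ ?_ j hj hjR
    · have := h2.conj_affP h1 θ 0 hθ
      rwa [pow_one, mul_inv_cancel₀ hθ.ne', one_mul] at this
    · have := h3.conj_affP h1 θ 0 hθ
      rwa [hθm] at this) (by linarith)
  have hconj : (A * f * A⁻¹)⁻¹ = A * f⁻¹ * A⁻¹ := by group
  rw [hconj] at key
  refine ⟨DB.of_conj_affP θ 0 hθ ?_ h1.inv, DB.of_conj_affP θ 0 hθ ?_ h1.inv⟩
  · refine DB.mono (key 1 le_rfl (by omega)) ?_
    rw [pow_one, mul_inv_cancel₀ hθ.ne', one_mul]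
    exact le_of_eq (by ring)
  · refine DB.mono (key R (by omega) le_rfl) (le_of_eq ?_)
    calc _ = C₁ * C₂ * β := by ring
      _ = _ := by rw [← hθm]; ring

theorem eqOn_iteratedDeriv_closure {u v : ℝ → ℝ} (hu : ContDiff ℝ (⊤ : ℕ∞) u)
    (hv : ContDiff ℝ (⊤ : ℕ∞) v) {s : Set ℝ} (hs : IsOpen s) (h : EqOn u v s) (n : ℕ) :
    EqOn (iteratedDeriv n u) (iteratedDeriv n v) (closure s) :=
  (h.iteratedDeriv_of_isOpen hs n).closure (smooth_iteratedDeriv hu n).continuous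
    (smooth_iteratedDeriv hv n).continuous

theorem SuppIn.iteratedDeriv_eq_zero {f : Equiv.Perm ℝ} {a b : ℝ} (hs : SuppIn f a b)
    (hf : IsDiffeo f) (n : ℕ) {x : ℝ} (hx : x ≤ a ∨ b ≤ x) : iteratedDeriv n (disp f) x = 0 := by
  have h0 : iteratedDeriv n (fun _ : ℝ => (0 : ℝ)) x = 0 := by
    rw [iteratedDeriv_fun_const_zero]
  rcases hx with hx | hx
  · have := eqOn_iteratedDeriv_closure hf.contDiff_disp (contDiff_const (c := (0 : ℝ)))
      (isOpen_Iio (a := a)) (fun y hy => hs.disp_eq_zero (Or.inl (le_of_lt hy))) n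
    rw [closure_Iio] at this
    rw [this hx, h0]
  · have := eqOn_iteratedDeriv_closure hf.contDiff_disp (contDiff_const (c := (0 : ℝ)))
      (isOpen_Ioi (a := b)) (fun y hy => hs.disp_eq_zero (Or.inr (le_of_lt hy))) n
    rw [closure_Ioi] at this
    rw [this hx, h0]

theorem SuppIn.DB_lower {f : Equiv.Perm ℝ} {a b : ℝ} (hs : SuppIn f a b) (hf : IsDiffeo f)
    (hab : a ≤ b) {m : ℝ} (hm0 : 0 ≤ m) (j d : ℕ) (hm : DB f (j + d) m) :
    DB f j ((b - a) ^ d * m) := by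
  induction d generalizing j with
  | zero => simpa using hm
  | succ d ih =>
    have h1 : DB f (j + 1) ((b - a) ^ d * m) := ih (j + 1) (by convert hm using 1; ring)
    intro x
    have hba : 0 ≤ b - a := sub_nonneg.2 hab
    by_cases hx : x ≤ a ∨ b ≤ x
    · rw [hs.iteratedDeriv_eq_zero hf j hx, abs_zero]
      positivity
    · push Not at hx
      have h2 := abs_iteratedDeriv_sub_le hf.contDiff_disp j convex_univ (fun y _ => h1 y)
        (mem_univ a) (mem_univ x)
      rw [hs.iteratedDeriv_eq_zero hf j (Or.inl le_rfl), sub_zero,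
        abs_of_pos (sub_pos.2 hx.1)] at h2
      refine h2.trans ?_
      rw [pow_succ]
      calc (b - a) ^ d * m * (x - a) ≤ (b - a) ^ d * m * (b - a) := by
            gcongr; exact hx.2.le
        _ = _ := by ring

theorem SuppIn.exists_DB {f : Equiv.Perm ℝ} {a b : ℝ} (hs : SuppIn f a b) (hf : IsDiffeo f)
    (j : ℕ) : ∃ m, 0 ≤ m ∧ DB f j m := by
  obtain ⟨C, hC⟩ := (isCompact_Icc (a := a) (b := b)).exists_bound_of_continuousOn
    (smooth_iteratedDeriv hf.contDiff_disp j).continuous.continuousOn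
  refine ⟨max C 0, le_max_right _ _, fun x => ?_⟩
  by_cases hx : x ≤ a ∨ b ≤ x
  · rw [hs.iteratedDeriv_eq_zero hf j hx, abs_zero]
    exact le_max_right _ _
  · push Not at hx
    exact (hC x ⟨hx.1.le, hx.2.le⟩).trans (le_max_left _ _)

/-- Infinitely many diffeomorphisms with disjoint supports can be combined into one. -/
theorem exists_glue {g : ℕ → Equiv.Perm ℝ} {u v : ℕ → ℝ} {U V : ℝ} (hg : ∀ n, IsDiffeo (g n))
    (hs : ∀ n, SuppIn (g n) (u n) (v n)) (hU : ∀ n, U ≤ u n) (hV : ∀ n, v n ≤ V)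
    (hdisj : ∀ n m, n ≠ m → v n ≤ u m ∨ v m ≤ u n)
    (h1 : ∀ n, DB (g n) 1 (1 / 2))
    (hB : ∀ j, ∃ B : ℕ → ℝ, Summable B ∧ ∀ n, DB (g n) j (B n)) :
    ∃ G : Equiv.Perm ℝ, IsDiffeo G ∧ SuppIn G U V ∧
      (∀ n, ∀ x, u n ≤ x → x ≤ v n → G x = g n x) ∧
      (∀ x, (∀ n, x ≤ u n ∨ v n ≤ x) → G x = x) ∧
      ∀ j η, (∀ n, DB (g n) j η) → DB G j η := by
  choose B hBs hB using hB
  have hbd : ∀ (k n : ℕ) (x : ℝ), ‖iteratedFDeriv ℝ k (disp (g n)) x‖ ≤ B k n := fun k n x => by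
    rw [norm_iteratedFDeriv_eq_norm_iteratedDeriv]
    exact hB k n x
  set w : ℝ → ℝ := fun x => ∑' n, disp (g n) x with hw
  have hws : ContDiff ℝ (⊤ : ℕ∞) w :=
    contDiff_tsum (fun n => (hg n).contDiff_disp) (fun k _ => hBs k) fun k n x _ => hbd k n x
  have hsingle : ∀ (n m : ℕ) (x : ℝ), u n < x → x < v n → m ≠ n → x ≤ u m ∨ v m ≤ x := by
    intro n m x h1 h2 hmn
    rcases hdisj m n hmn with h | h
    · right; linarith
    · left; linarith
  have hbound : ∀ j η, (∀ n, DB (g n) j η) → ∀ x, |iteratedDeriv j w x| ≤ η := by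
    intro j η hη x
    rw [← Real.norm_eq_abs, ← norm_iteratedFDeriv_eq_norm_iteratedDeriv,
      iteratedFDeriv_tsum_apply (N := ⊤) (fun n => (hg n).contDiff_disp) (fun k _ => hBs k)
        (fun k n x _ => hbd k n x) le_top]
    have hzero : ∀ m, x ≤ u m ∨ v m ≤ x → iteratedFDeriv ℝ j (disp (g m)) x = 0 := fun m hm => by
      rw [← norm_eq_zero, norm_iteratedFDeriv_eq_norm_iteratedDeriv,
        (hs m).iteratedDeriv_eq_zero (hg m) j hm, norm_zero]
    by_cases hx : ∃ n, u n < x ∧ x < v n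
    · obtain ⟨n, hn1, hn2⟩ := hx
      rw [tsum_eq_single n fun m hm => hzero m (hsingle n m x hn1 hn2 hm),
        norm_iteratedFDeriv_eq_norm_iteratedDeriv]
      exact hη n x
    · push Not at hx
      rw [tsum_congr fun m => hzero m ?_, tsum_zero, norm_zero]
      · exact (abs_nonneg _).trans (hη 0 x)
      · by_cases h : x ≤ u m
        · exact Or.inl h
        · exact Or.inr (hx m (not_le.1 h))
  obtain ⟨G, hG, hGw⟩ := exists_diffeo_of_disp hws fun x => by
    rw [← iteratedDeriv_one]; exact hbound 1 _ h1 x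
  have hGx : ∀ x, G x = x + w x := fun x => by rw [← hGw]; simp [disp]
  have hout : ∀ x, (∀ n, x ≤ u n ∨ v n ≤ x) → G x = x := fun x hx => by
    rw [hGx, hw]
    simp only
    rw [tsum_congr fun n => (hs n).disp_eq_zero (hx n)]
    simp
  refine ⟨G, hG, fun x hx => hout x fun n => ?_, fun n x h1 h2 => ?_, hout, fun j η hη => ?_⟩
  · rcases hx with hx | hx
    · exact Or.inl (hx.trans (hU n))
    · exact Or.inr ((hV n).trans hx)
  · rw [hGx, hw]
    simp only
    rw [tsum_eq_single n]
    · simp [disp]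
    · intro m hm
      refine (hs m).disp_eq_zero ?_
      rcases hdisj m n hm with h | h
      · right; linarith
      · left; linarith
  · unfold DB
    rw [hGw]
    exact hbound j η hη

/-- The homothety of ratio `μ ^ n` centred at `c`. -/
def homot (μ c : ℝ) (hμ : 0 < μ) (n : ℕ) : Equiv.Perm ℝ :=
  affP (μ ^ n) (c - μ ^ n * c) (pow_pos hμ n)

theorem summable_bounds_homot {a : ℕ → Equiv.Perm ℝ} {U V μ : ℝ} (c : ℝ) (hμ : 0 < μ)
    (ha : ∀ n, IsDiffeo (a n)) (hs : ∀ n, SuppIn (a n) U V)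
    (hdec : ∀ j, ∀ Λ : ℝ, 0 < Λ → ∀ᶠ n in atTop, DB (a n) j (Λ ^ n)) (j : ℕ) :
    ∃ B : ℕ → ℝ, Summable B ∧
      ∀ n, DB (homot μ c hμ n * a n * (homot μ c hμ n)⁻¹) j (B n) := by
  obtain ⟨n₀, hn₀⟩ := eventually_atTop.1 (hdec j (μ⁻¹ * μ ^ j / 2) (by positivity))
  have : ∀ n, ∃ b, DB (homot μ c hμ n * a n * (homot μ c hμ n)⁻¹) j b ∧
      (n₀ ≤ n → b = (1 / 2) ^ n) := by
    intro n
    by_cases hn : n₀ ≤ n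
    · refine ⟨_, ((hn₀ n hn).conj_affP (ha n) _ _ _).mono (le_of_eq ?_), fun _ => rfl⟩
      rw [← inv_pow, ← pow_mul, mul_comm n j, pow_mul, ← mul_pow, ← mul_pow]
      congr 1
      field_simp
      rw [← mul_pow, one_div_mul_cancel hμ.ne', one_pow]
    · obtain ⟨m, -, hm⟩ := (hs n).exists_DB (ha n) j
      exact ⟨_, hm.conj_affP (ha n) _ _ _, fun h => absurd h hn⟩
  choose B hB hB' using this
  refine ⟨B, ?_, hB⟩
  rw [← summable_nat_add_iff n₀]
  have : (fun n => B (n + n₀)) = fun n => (1 / 2 : ℝ) ^ (n + n₀) := by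
    ext n; exact hB' _ (by omega)
  rw [this, summable_nat_add_iff n₀]
  exact summable_geometric_two

theorem exists_contraction (c d : ℝ) : ∃ (ρ : ℝ) (s : Equiv.Perm ℝ), 0 < ρ ∧
    ρ ≤ 1 / 32 ∧ IsDiffeo s ∧ SuppIn s (c - 1) (d + 1) ∧
      ∀ x, c ≤ x → x ≤ d → s x = c + ρ * (x - c) := by
  set u : ℝ → ℝ := fun x =>
    (x - c) * (Real.smoothTransition (x - (c - 1)) * Real.smoothTransition (d + 1 - x)) with hu
  have hus : ContDiff ℝ (⊤ : ℕ∞) u := by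
    refine (contDiff_id.sub contDiff_const).mul ((Real.smoothTransition.contDiff.comp ?_).mul
      (Real.smoothTransition.contDiff.comp ?_))
    · exact contDiff_id.sub contDiff_const
    · exact contDiff_const.sub contDiff_id
  have hout : ∀ x, x ≤ c - 1 ∨ d + 1 ≤ x → u x = 0 := by
    rintro x (hx | hx)
    · simp [hu, Real.smoothTransition.zero_of_nonpos (by linarith : x - (c - 1) ≤ 0)]
    · simp [hu, Real.smoothTransition.zero_of_nonpos (by linarith : d + 1 - x ≤ 0)]
  have hin : ∀ x, c ≤ x → x ≤ d → u x = x - c := fun x h1 h2 => by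
    simp [hu, Real.smoothTransition.one_of_one_le (by linarith : 1 ≤ x - (c - 1)),
      Real.smoothTransition.one_of_one_le (by linarith : 1 ≤ d + 1 - x)]
  have hud : ContDiff ℝ (⊤ : ℕ∞) (deriv u) := by
    simpa [iteratedDeriv_one] using smooth_iteratedDeriv hus 1
  obtain ⟨C, hC0, hC⟩ : ∃ C, 0 ≤ C ∧ ∀ x, |deriv u x| ≤ C := by
    have hcs : HasCompactSupport u := HasCompactSupport.intro (isCompact_Icc (a := c - 1)
      (b := d + 1)) fun x hx => hout x (by
        by_contra hc; push Not at hc; exact hx ⟨hc.1.le, hc.2.le⟩)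
    obtain ⟨C, hC⟩ := hcs.deriv.exists_bound_of_continuous hud.continuous
    exact ⟨C, (norm_nonneg _).trans (hC 0), hC⟩
  set δ : ℝ := 1 / (2 * (C + 1)) with hδ
  have hδ0 : 0 < δ := by positivity
  have hδC : δ * C ≤ 1 / 2 := by
    rw [hδ, div_mul_eq_mul_div, div_le_iff₀ (by positivity)]; linarith
  have hδ1 : δ ≤ 1 / 2 := by
    rw [hδ, div_le_iff₀ (by positivity)]; linarith
  obtain ⟨s, hs, hsd⟩ := exists_diffeo_of_disp (v := fun x => -δ * u x)
    (contDiff_const.mul hus) fun x => by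
      rw [deriv_const_mul_field, abs_mul, abs_neg, abs_of_pos hδ0]
      exact (mul_le_mul_of_nonneg_left (hC x) hδ0.le).trans hδC
  have hsx : ∀ x, s x = x - δ * u x := fun x => by
    have := congrFun hsd x
    simp only [disp] at this; linarith
  have hsupp : SuppIn s (c - 1) (d + 1) := fun x hx => by rw [hsx, hout x hx]; ring
  obtain ⟨m, hm⟩ := exists_pow_lt_of_lt_one (by norm_num : (0 : ℝ) < 1 / 32)
    (by linarith : 1 - δ < 1)
  refine ⟨(1 - δ) ^ m, s ^ m, by have : 0 < 1 - δ := by linarith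
                                 positivity, hm.le, hs.pow m, hsupp.pow m, ?_⟩
  clear hm
  induction m with
  | zero => intro x _ _; simp
  | succ m ih =>
    intro x h1 h2
    have h3 : s x = c + (1 - δ) * (x - c) := by rw [hsx, hin x h1 h2]; ring
    rw [pow_succ, Equiv.Perm.mul_apply, ih (s x), h3]
    · ring
    · rw [h3]; nlinarith
    · rw [h3]; nlinarith

/-- Sequences of decaying diffeomorphisms can be recovered, up to junk located elsewhere, from
one diffeomorphism by conjugation by the powers of a contraction. -/
theorem exists_localization {c d : ℝ} (hc : c ≤ -15) (hc' : -16 ≤ c) (hd : 12 ≤ d)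
    (hd' : d ≤ 13) :
    ∃ s : Equiv.Perm ℝ, IsDiffeo s ∧ SuppIn s (-17) 14 ∧
      ∀ a : ℕ → Equiv.Perm ℝ, (∀ n, IsDiffeo (a n)) → (∀ n, SuppIn (a n) (-14) 12) →
        (∀ n, DB (a n) 1 (1 / 2)) →
        (∀ j, ∀ Λ : ℝ, 0 < Λ → ∀ᶠ n in atTop, DB (a n) j (Λ ^ n)) →
        ∃ A : Equiv.Perm ℝ, IsDiffeo A ∧ SuppIn A (-17) 14 ∧ ∀ n, ∃ e : Equiv.Perm ℝ,
          (s ^ n)⁻¹ * A * s ^ n = a n * e ∧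
            ∀ x, (x ≤ c ∨ c + 1 ≤ x) → (x ≤ d ∨ d + 1 ≤ x) → e x = x := by
  obtain ⟨ρ, s, hρ, hρ', hs, hss, hsx⟩ := exists_contraction c d
  refine ⟨s, hs, hss.mono (by linarith) (by linarith), fun a ha has ha1 hdec => ?_⟩
  have hρn : ∀ n : ℕ, ρ ^ n ≤ 1 := fun n => pow_le_one₀ hρ.le (by linarith)
  have hρp : ∀ n : ℕ, 0 < ρ ^ n := fun n => pow_pos hρ n
  have hρn1 : ∀ n : ℕ, 1 ≤ n → ρ ^ n ≤ 1 / 32 := fun n hn => by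
    obtain ⟨k, rfl⟩ : ∃ k, n = k + 1 := ⟨n - 1, by omega⟩
    rw [pow_succ]; nlinarith [hρn k, hρp k]
  have hpow : ∀ (n : ℕ) x, c ≤ x → x ≤ d → (s ^ n) x = c + ρ ^ n * (x - c) := by
    intro n
    induction n with
    | zero => intro x _ _; simp
    | succ n ih =>
      intro x h1 h2
      have h3 := hsx x h1 h2
      rw [pow_succ, Equiv.Perm.mul_apply, ih (s x), h3]
      · ring
      · rw [h3]; nlinarith
      · rw [h3]; nlinarith
  have hanti : ∀ m n : ℕ, m < n → ρ ^ n ≤ ρ ^ m * (1 / 32) := fun m n h => by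
    obtain ⟨k, rfl⟩ : ∃ k, n = m + k := ⟨n - m, by omega⟩
    rw [pow_add]
    exact mul_le_mul_of_nonneg_left (hρn1 k (by omega)) (hρp m).le
  obtain ⟨A, hA, hAs, hAin, hAout, -⟩ := exists_glue
    (g := fun n => homot ρ c hρ n * a n * (homot ρ c hρ n)⁻¹)
    (u := fun n => ρ ^ n * (-14) + (c - ρ ^ n * c)) (v := fun n => ρ ^ n * 12 + (c - ρ ^ n * c))
    (U := c) (V := 12)
    (fun n => (ha n).conj_affP _ _ _) (fun n => (has n).conj_affP _ _ _)
    (fun n => by nlinarith [hρp n]) (fun n => by nlinarith [hρn n])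
    (fun n m hnm => by
      rcases Nat.lt_or_gt_of_ne hnm with h | h
      · right; nlinarith [hanti _ _ h, hρp n, hρp m]
      · left; nlinarith [hanti _ _ h, hρp n, hρp m])
    (fun n => ((ha1 n).conj_affP (ha n) _ _ _).mono (by
      rw [pow_one, mul_inv_cancel₀ (hρp n).ne', one_mul]))
    (summable_bounds_homot c hρ ha has hdec)
  refine ⟨A, hA, hAs.mono (by linarith) (by linarith), fun n => ?_⟩
  refine ⟨(a n)⁻¹ * ((s ^ n)⁻¹ * A * s ^ n), by group, fun x hx1 hx2 => ?_⟩
  rw [Equiv.Perm.mul_apply, Equiv.Perm.inv_eq_iff_eq]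
  simp only [Equiv.Perm.mul_apply]
  rw [Equiv.Perm.inv_eq_iff_eq]
  by_cases hx : x ≤ -14 ∨ 12 ≤ x
  · rw [has n x hx]
    apply hAout
    intro m
    by_contra hcon
    push Not at hcon
    obtain ⟨hm1, hm2⟩ := hcon
    set w := c + (ρ ^ m)⁻¹ * ((s ^ n) x - c) with hw
    have hyw : (s ^ n) x = c + ρ ^ m * (w - c) := by
      rw [hw]; field_simp [(hρp m).ne']; ring
    have hw1 : -14 < w := by
      by_contra h; nlinarith [mul_le_mul_of_nonneg_left (not_lt.1 h) (hρp m).le]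
    have hw2 : w < 12 := by
      by_contra h; nlinarith [mul_le_mul_of_nonneg_left (not_lt.1 h) (hρp m).le]
    rw [← hpow m w (by linarith) (by linarith)] at hyw
    rcases le_total n m with hnm | hnm
    · obtain ⟨k, rfl⟩ : ∃ k, m = n + k := ⟨m - n, by omega⟩
      rw [pow_add, Equiv.Perm.mul_apply, (s ^ n).injective.eq_iff,
        hpow k w (by linarith) (by linarith)] at hyw
      rcases Nat.eq_zero_or_pos k with rfl | hk
      · rw [pow_zero] at hyw
        rcases hx with h | h <;> linarith
      · have h1 := hρn1 k hk
        have h2 := hρp k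
        rcases hx1 with h | h <;> nlinarith
    · obtain ⟨k, rfl⟩ : ∃ k, n = m + k := ⟨n - m, by omega⟩
      rw [pow_add, Equiv.Perm.mul_apply, (s ^ m).injective.eq_iff] at hyw
      rcases Nat.eq_zero_or_pos k with rfl | hk
      · rw [pow_zero, Equiv.Perm.one_apply] at hyw
        rcases hx with h | h <;> linarith
      · rcases hx2 with h | h
        · rcases le_or_gt c x with h' | h'
          · rw [hpow k x h' h] at hyw
            nlinarith [hρn1 k hk, hρp k]
          · have h1 := (hs.pow k).2.2 h'
            rw [hpow k c le_rfl (by linarith)] at h1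
            linarith
        · rw [hss.pow k x (Or.inr h)] at hyw
          linarith
  · push Not at hx
    have hax1 : -14 < a n x := by
      have := (ha n).2.2 hx.1
      rwa [has n (-14) (Or.inl le_rfl)] at this
    have hax2 : a n x < 12 := by
      have := (ha n).2.2 hx.2
      rwa [has n 12 (Or.inr le_rfl)] at this
    rw [hpow n x (by linarith) (by linarith), hpow n (a n x) (by linarith) (by linarith)]
    rw [hAin n]
    · simp only [homot, Equiv.Perm.mul_apply, affP_apply, affP_inv_apply]
      have : (ρ ^ n)⁻¹ * (c + ρ ^ n * (x - c) - (c - ρ ^ n * c)) = x := by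
        field_simp [(hρp n).ne']; ring
      rw [this]; ring
    · nlinarith [hρp n]
    · nlinarith [hρp n]

theorem WordLenLe.mono {G : Type*} [Group G] {S T : Finset G} {g : G} {m n : ℕ}
    (h : WordLenLe S g m) (hST : S ⊆ T) (hmn : m ≤ n) : WordLenLe T g n := by
  obtain ⟨l, h1, h2, h3⟩ := h
  exact ⟨l, h1.trans hmn, fun x hx => (h2 x hx).imp (fun h => hST h) (fun h => hST h), h3⟩

theorem WordLenLe.of_mem {G : Type*} [Group G] {S : Finset G} {g : G} (h : g ∈ S) :
    WordLenLe S g 1 := ⟨[g], by simp, by simp [h], by simp⟩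

theorem WordLenLe.mul {G : Type*} [Group G] {S : Finset G} {g h : G} {m n : ℕ}
    (hg : WordLenLe S g m) (hh : WordLenLe S h n) : WordLenLe S (g * h) (m + n) := by
  obtain ⟨l, h1, h2, h3⟩ := hg
  obtain ⟨l', h1', h2', h3'⟩ := hh
  refine ⟨l ++ l', by simp; omega, fun x hx => ?_, by simp [h3, h3']⟩
  rcases List.mem_append.1 hx with hx | hx
  exacts [h2 x hx, h2' x hx]

theorem WordLenLe.inv {G : Type*} [Group G] {S : Finset G} {g : G} {m : ℕ}
    (hg : WordLenLe S g m) : WordLenLe S g⁻¹ m := by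
  obtain ⟨l, h1, h2, h3⟩ := hg
  refine ⟨(l.map (·⁻¹)).reverse, by simpa using h1, fun x hx => ?_, ?_⟩
  · simp only [List.mem_reverse, List.mem_map] at hx
    obtain ⟨y, hy, rfl⟩ := hx
    simpa using (h2 y hy).symm
  · rw [← h3, List.prod_inv_reverse]

theorem WordLenLe.pow {G : Type*} [Group G] {S : Finset G} {g : G} {m : ℕ}
    (hg : WordLenLe S g m) (n : ℕ) : WordLenLe S (g ^ n) (n * m) := by
  induction n with
  | zero => exact ⟨[], by simp, by simp, by simp⟩
  | succ n ih => rw [pow_succ, Nat.succ_mul]; exact ih.mul hg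

theorem WordLenLe.commutator {G : Type*} [Group G] {S : Finset G} {g h : G} {m : ℕ}
    (hg : WordLenLe S g m) (hh : WordLenLe S h m) : WordLenLe S ⁅g, h⁆ (4 * m) := by
  rw [commutatorElement_def]
  exact (((hg.mul hh).mul hg.inv).mul hh.inv).mono (Finset.Subset.refl S) (by omega)

theorem WordLenLe.map {G H : Type*} [Group G] [Group H] [DecidableEq H] {S : Finset G} {g : G}
    {m : ℕ} (hg : WordLenLe S g m) (φ : G →* H) : WordLenLe (S.image φ) (φ g) m := by
  obtain ⟨l, h1, h2, h3⟩ := hg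
  refine ⟨l.map φ, by simpa using h1, fun x hx => ?_, by rw [← h3, map_list_prod]⟩
  obtain ⟨y, hy, rfl⟩ := List.mem_map.1 hx
  rw [← map_inv]
  exact (h2 y hy).imp (fun h => Finset.mem_image_of_mem _ h) fun h => Finset.mem_image_of_mem _ h

theorem WordLenLe.mem_closure {G : Type*} [Group G] {S : Finset G} {g : G} {m : ℕ}
    (hg : WordLenLe S g m) : g ∈ Subgroup.closure (S : Set G) := by
  obtain ⟨l, -, h2, rfl⟩ := hg
  refine Subgroup.list_prod_mem _ fun x hx => ?_
  rcases h2 x hx with h | h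
  · exact Subgroup.subset_closure h
  · exact (Subgroup.inv_mem_iff _).1 (Subgroup.subset_closure h)

theorem commutator_mul_mul {G : Type*} [Group G] {a e b e' : G} (h1 : Commute e b)
    (h2 : Commute a e') (h3 : Commute e e') : ⁅a * e, b * e'⁆ = ⁅a, b⁆ := by
  have h1' : e * b = b * e := h1.eq
  have h3' : e * e' * e⁻¹ = e' := by rw [h3.eq]; group
  have h2' : e' * a⁻¹ * e'⁻¹ = a⁻¹ := by rw [← (h2.inv_left).eq]; group
  rw [commutatorElement_def, commutatorElement_def]
  calc a * e * (b * e') * (a * e)⁻¹ * (b * e')⁻¹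
      = a * (e * b) * e' * e⁻¹ * a⁻¹ * e'⁻¹ * b⁻¹ := by group
    _ = a * b * (e * e' * e⁻¹) * a⁻¹ * e'⁻¹ * b⁻¹ := by rw [h1']; group
    _ = a * b * (e' * a⁻¹ * e'⁻¹) * b⁻¹ := by rw [h3']; group
    _ = a * b * a⁻¹ * b⁻¹ := by rw [h2']

theorem IsDiffeo.isCDiffC {f : Equiv.Perm ℝ} {a b : ℝ} (hf : IsDiffeo f) (hs : SuppIn f a b) :
    IsCDiffC f := by
  refine ⟨hf.1, hf.2.1, hf.2.2, Icc a b, isCompact_Icc, fun x hx => hs x ?_⟩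
  by_contra hc; push Not at hc; exact hx ⟨hc.1.le, hc.2.le⟩

/-- A smooth diffeomorphism supported in `[-14, 12]` whose first `r` derivatives are
`η`-close to those of the identity. -/
def IsSmall (r : ℕ) (η : ℝ) (a : Equiv.Perm ℝ) : Prop :=
  IsDiffeo a ∧ SuppIn a (-14) 12 ∧ ∀ j ≤ r, DB a j η

/-- Sequences of products of two commutators of rapidly decaying elements. -/
theorem exists_finset_of_commutators {f a b a' b' : ℕ → Equiv.Perm ℝ} {η : ℕ → ℝ}
    (hη : ∀ n, η n ≤ 1 / 2) (hη' : ∀ Λ : ℝ, 0 < Λ → ∀ᶠ n in atTop, η n ≤ Λ ^ n)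
    (ha : ∀ n, IsSmall (n + 1) (η n) (a n)) (hb : ∀ n, IsSmall (n + 1) (η n) (b n))
    (ha' : ∀ n, IsSmall (n + 1) (η n) (a' n)) (hb' : ∀ n, IsSmall (n + 1) (η n) (b' n))
    (hf : ∀ n, f n = ⁅a n, b n⁆ * ⁅a' n, b' n⁆) :
    ∃ S : Finset (Equiv.Perm ℝ), (∀ s ∈ S, IsDiffeo s ∧ SuppIn s (-17) 14) ∧
      ∀ n, WordLenLe S (f n) (16 * n + 8) := by
  obtain ⟨s, hs, hss, Hs⟩ := exists_localization (c := -16) (d := 13)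
    (by norm_num) (by norm_num) (by norm_num) (by norm_num)
  obtain ⟨t, ht, hts, Ht⟩ := exists_localization (c := -15) (d := 12)
    (by norm_num) (by norm_num) (by norm_num) (by norm_num)
  have hdec : ∀ a : ℕ → Equiv.Perm ℝ, (∀ n, IsSmall (n + 1) (η n) (a n)) →
      (∀ n, DB (a n) 1 (1 / 2)) ∧ (∀ j, ∀ Λ : ℝ, 0 < Λ → ∀ᶠ n in atTop, DB (a n) j (Λ ^ n)) :=
    fun a ha => ⟨fun n => ((ha n).2.2 1 (by omega)).mono (hη n), fun j Λ hΛ => by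
      filter_upwards [hη' Λ hΛ, eventually_ge_atTop j] with n h1 h2
      exact ((ha n).2.2 j (by omega)).mono h1⟩
  obtain ⟨A, hA, hAs, HA⟩ := Hs a (fun n => (ha n).1) (fun n => (ha n).2.1) (hdec a ha).1
    (hdec a ha).2
  obtain ⟨A', hA', hAs', HA'⟩ := Hs a' (fun n => (ha' n).1) (fun n => (ha' n).2.1) (hdec a' ha').1
    (hdec a' ha').2
  obtain ⟨B, hB, hBs, HB⟩ := Ht b (fun n => (hb n).1) (fun n => (hb n).2.1) (hdec b hb).1
    (hdec b hb).2
  obtain ⟨B', hB', hBs', HB'⟩ := Ht b' (fun n => (hb' n).1) (fun n => (hb' n).2.1)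
    (hdec b' hb').1 (hdec b' hb').2
  classical
  refine ⟨{s, t, A, A', B, B'}, ?_, fun n => ?_⟩
  · intro x hx
    simp only [Finset.mem_insert, Finset.mem_singleton] at hx
    rcases hx with rfl | rfl | rfl | rfl | rfl | rfl
    exacts [⟨hs, hss⟩, ⟨ht, hts⟩, ⟨hA, hAs⟩, ⟨hA', hAs'⟩, ⟨hB, hBs⟩, ⟨hB', hBs'⟩]
  · set S : Finset (Equiv.Perm ℝ) := {s, t, A, A', B, B'} with hS
    have hcomm : ∀ a b A B e e' : Equiv.Perm ℝ, SuppIn a (-14) 12 → SuppIn b (-14) 12 →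
        A = a * e → B = b * e' →
        (∀ x : ℝ, (x ≤ -16 ∨ -16 + 1 ≤ x) → (x ≤ 13 ∨ 13 + 1 ≤ x) → e x = x) →
        (∀ x : ℝ, (x ≤ -15 ∨ -15 + 1 ≤ x) → (x ≤ 12 ∨ 12 + 1 ≤ x) → e' x = x) →
        ⁅A, B⁆ = ⁅a, b⁆ := by
      rintro a b _ _ e e' ha hb rfl rfl he he'
      refine commutator_mul_mul (Equiv.Perm.Disjoint.commute fun x => ?_)
        (Equiv.Perm.Disjoint.commute fun x => ?_) (Equiv.Perm.Disjoint.commute fun x => ?_)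
      · by_cases h : x ≤ -14 ∨ 12 ≤ x
        · exact Or.inr (hb x h)
        · push Not at h
          exact Or.inl (he x (Or.inr (by linarith)) (Or.inl (by linarith)))
      · by_cases h : x ≤ -14 ∨ 12 ≤ x
        · exact Or.inl (ha x h)
        · push Not at h
          exact Or.inr (he' x (Or.inr (by linarith)) (Or.inl (by linarith)))
      · by_cases h1 : x ≤ -15
        · by_cases h2 : x ≤ -16 ∨ -16 + 1 ≤ x
          · exact Or.inl (he x h2 (Or.inl (by linarith)))
          · exact Or.inr (he' x (Or.inl h1) (Or.inl (by linarith)))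
        · by_cases h2 : x ≤ 13
          · exact Or.inl (he x (Or.inr (by linarith)) (Or.inl h2))
          · exact Or.inr (he' x (Or.inr (by linarith)) (Or.inr (by linarith)))
    have hconj : ∀ x ∈ S, ∀ y ∈ S, WordLenLe S ((x ^ n)⁻¹ * y * x ^ n) (2 * n + 1) :=
      fun x hx y hy => by
        have h1 := (WordLenLe.of_mem hx).pow n
        exact ((h1.inv.mul (WordLenLe.of_mem hy)).mul h1).mono (Finset.Subset.refl S) (by omega)
    obtain ⟨e₁, h₁, h₁'⟩ := HA n
    obtain ⟨e₂, h₂, h₂'⟩ := HB n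
    obtain ⟨e₃, h₃, h₃'⟩ := HA' n
    obtain ⟨e₄, h₄, h₄'⟩ := HB' n
    rw [hf, ← hcomm _ _ _ _ e₁ e₂ (ha n).2.1 (hb n).2.1 h₁ h₂ h₁' h₂',
      ← hcomm _ _ _ _ e₃ e₄ (ha' n).2.1 (hb' n).2.1 h₃ h₄ h₃' h₄']
    refine WordLenLe.mono (((hconj s (by simp [hS]) A (by simp [hS])).commutator
      (hconj t (by simp [hS]) B (by simp [hS]))).mul
      ((hconj s (by simp [hS]) A' (by simp [hS])).commutator
      (hconj t (by simp [hS]) B' (by simp [hS])))) (Finset.Subset.refl S) (by omega)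

theorem IsSmall.one (r : ℕ) {η : ℝ} (hη : 0 ≤ η) : IsSmall r η 1 :=
  ⟨IsDiffeo.one, SuppIn.one _ _, fun j _ x => by simpa [disp_one] using hη⟩

/-- If diffeomorphisms close to the identity are products of two commutators of diffeomorphisms
close to the identity, then rapidly decaying sequences have linear word length. -/
theorem sequence_of_commutators
    (H : ∀ (r : ℕ) (η : ℝ), 0 < η → ∃ (R : ℕ) (ε : ℝ), 1 ≤ R ∧ 0 < ε ∧ ∀ f : Equiv.Perm ℝ,
      IsDiffeo f → SuppIn f (-12) (-47 / 4) → DB f 1 ε → DB f R ε →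
        ∃ a b a' b', IsSmall r η a ∧ IsSmall r η b ∧ IsSmall r η a' ∧ IsSmall r η b' ∧
          f = ⁅a, b⁆ * ⁅a', b'⁆) :
    ∃ (r : ℕ → ℕ) (ε : ℕ → ℝ), (∀ n, 0 < ε n) ∧
      ∀ f : ℕ → Equiv.Perm ℝ,
        (∀ n, IsCDiffC (f n)) →
        (∃ K : Set ℝ, IsCompact K ∧ ∀ n, ∀ x ∉ K, f n x = x) →
        (∀ n, DistLt (r n) (ε n) (⇑(f n)) id) →
        ∃ S : Finset (Equiv.Perm ℝ), (∀ s ∈ S, IsCDiffC s) ∧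
          ∀ n, f n ∈ Subgroup.closure (S : Set (Equiv.Perm ℝ)) ∧
            wordLength S (f n) ≤ 70 * n + 70 := by
  set η : ℕ → ℝ := fun n => 1 / 2 * (1 / ((n : ℝ) + 1)) ^ n with hη
  have hη0 : ∀ n, 0 < η n := fun n => by positivity
  choose R ε hR hε H using fun n : ℕ => H (n + 1) (η n) (hη0 n)
  refine ⟨R, fun n => ε n * (1 / ((n : ℝ) + 1)) ^ (R n), fun n => mul_pos (hε n) (by positivity),
    fun f hf hK hd => ?_⟩
  have hfd : ∀ n, IsDiffeo (f n) := fun n => ⟨(hf n).1, (hf n).2.1, (hf n).2.2.1⟩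
  obtain ⟨K, hKc, hK⟩ := hK
  obtain ⟨L, hL⟩ := hKc.isBounded.subset_closedBall 0
  set M := max L 0 + 1 with hM
  have hM1 : 1 ≤ M := by linarith [le_max_right L 0]
  have hML : L < M := by linarith [le_max_left L 0]
  have hfs : ∀ n, SuppIn (f n) (-M) M := fun n x hx => hK n x fun hxK => by
    have := hL hxK
    rw [Metric.mem_closedBall, Real.dist_0_eq_abs] at this
    have h2 := abs_le.1 this
    rcases hx with hx | hx <;> linarith
  have hμ : 0 < 1 / (8 * M) := by positivity
  have hμM : 1 / (8 * M) * M = 1 / 8 := by field_simp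
  have hμ1 : 1 / (8 * M) ≤ 1 := by rw [div_le_one (by positivity)]; linarith
  set ψ := affP (1 / (8 * M)) (-95 / 8) hμ with hψ
  obtain ⟨n₀, hn₀⟩ := exists_nat_ge (8 * M)
  have hder : ∀ n k, k ≤ R n → DB (f n) k (ε n * (1 / ((n : ℝ) + 1)) ^ (R n)) := by
    intro n k hk x
    have h1 := (hd n k hk x).le
    have h2 : disp (f n) = fun y => f n y - id y := rfl
    rwa [h2, iteratedDeriv_fun_sub ((hfd n).1.of_le (by exact_mod_cast le_top)).contDiffAt
      contDiff_id.contDiffAt]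
  have key : ∀ n, ∃ a b a' b', IsSmall (n + 1) (η n) a ∧ IsSmall (n + 1) (η n) b ∧
      IsSmall (n + 1) (η n) a' ∧ IsSmall (n + 1) (η n) b' ∧
      (n₀ ≤ n → ψ * f n * ψ⁻¹ = ⁅a, b⁆ * ⁅a', b'⁆) := by
    intro n
    by_cases hn : n₀ ≤ n
    · have hn' : 8 * M ≤ n + 1 := by
        have : (n₀ : ℝ) ≤ n := by exact_mod_cast hn
        linarith
      have hpw : (1 / ((n : ℝ) + 1)) ^ (R n) ≤ 1 := by
        refine pow_le_one₀ (by positivity) ?_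
        rw [div_le_one (by positivity)]; linarith
      obtain ⟨a, b, a', b', h1, h2, h3, h4, h5⟩ := H n (ψ * f n * ψ⁻¹) ((hfd n).conj_affP _ _ _)
        (((hfs n).conj_affP _ _ hμ).mono (by linarith) (by linarith))
        (((hder n 1 (hR n)).conj_affP (hfd n) _ _ _).mono (by
          rw [pow_one, mul_inv_cancel₀ hμ.ne', one_mul]
          exact mul_le_of_le_one_right (hε n).le hpw))
        (((hder n (R n) le_rfl).conj_affP (hfd n) _ _ _).mono (by
          have e1 : ((1 / (8 * M))⁻¹ : ℝ) ^ (R n) * (1 / ((n : ℝ) + 1)) ^ (R n) ≤ 1 := by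
            rw [← mul_pow]
            refine pow_le_one₀ (by positivity) ?_
            rw [one_div, inv_inv, mul_one_div, div_le_one (by positivity)]
            exact hn'
          calc _ = 1 / (8 * M) * ε n * (((1 / (8 * M))⁻¹ : ℝ) ^ (R n) *
                (1 / ((n : ℝ) + 1)) ^ (R n)) := by ring
            _ ≤ 1 * ε n * 1 := by
                have := hε n
                gcongr
            _ = ε n := by ring))
      exact ⟨a, b, a', b', h1, h2, h3, h4, fun _ => h5⟩
    · have := IsSmall.one (n + 1) (hη0 n).le
      exact ⟨1, 1, 1, 1, this, this, this, this, fun h => absurd h hn⟩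
  choose a b a' b' ha hb ha' hb' hF using key
  obtain ⟨S, hS, hSw⟩ := exists_finset_of_commutators (η := η)
    (f := fun n => ⁅a n, b n⁆ * ⁅a' n, b' n⁆)
    (fun n => by
      have : (1 / ((n : ℝ) + 1)) ^ n ≤ 1 := by
        refine pow_le_one₀ (by positivity) ?_
        rw [div_le_one (by positivity)]; linarith [(Nat.cast_nonneg n : (0 : ℝ) ≤ n)]
      simp only [hη]; linarith)
    (fun Λ hΛ => by
      obtain ⟨m, hm⟩ := exists_nat_ge (1 / Λ)
      filter_upwards [eventually_ge_atTop m] with n hn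
      have hn' : (m : ℝ) ≤ n := by exact_mod_cast hn
      have : 1 / ((n : ℝ) + 1) ≤ Λ := by
        rw [div_le_iff₀ (by positivity)]
        rw [div_le_iff₀ hΛ] at hm
        nlinarith
      have h2 : (1 / ((n : ℝ) + 1)) ^ n ≤ Λ ^ n := by gcongr
      have h3 : 0 ≤ (1 / ((n : ℝ) + 1)) ^ n := by positivity
      simp only [hη]; linarith) ha hb ha' hb' (fun n => rfl)
  classical
  set φ : Equiv.Perm ℝ →* Equiv.Perm ℝ := (MulAut.conj ψ⁻¹).toMonoidHom with hφ
  have hφx : ∀ g, φ g = ψ⁻¹ * g * ψ := fun g => by simp [hφ]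
  set T := S.image φ ∪ (Finset.range n₀).image f with hT
  have hw : ∀ n, WordLenLe T (f n) (70 * n + 70) := by
    intro n
    by_cases hn : n₀ ≤ n
    · have h1 := (hSw n).map φ
      rw [← hF n hn, hφx] at h1
      have h2 : ψ⁻¹ * (ψ * f n * ψ⁻¹) * ψ = f n := by group
      rw [h2] at h1
      exact h1.mono Finset.subset_union_left (by omega)
    · refine (WordLenLe.of_mem ?_).mono (Finset.Subset.refl T) (by omega : 1 ≤ 70 * n + 70)
      exact Finset.mem_union_right _ (Finset.mem_image_of_mem _ (Finset.mem_range.2 (by omega)))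
  refine ⟨T, fun s hs => ?_, fun n => ⟨(hw n).mem_closure, Nat.sInf_le (hw n)⟩⟩
  rcases Finset.mem_union.1 hs with h | h
  · obtain ⟨g, hg, rfl⟩ := Finset.mem_image.1 h
    obtain ⟨hg1, hg2⟩ := hS g hg
    rw [hφx]
    have hψd := affP_isDiffeo _ (-95 / 8) hμ
    refine IsDiffeo.isCDiffC (a := ψ⁻¹ (-17)) (b := ψ⁻¹ 14) ((hψd.inv.mul hg1).mul hψd)
      fun x hx => ?_
    rw [Equiv.Perm.mul_apply, Equiv.Perm.mul_apply, Equiv.Perm.inv_eq_iff_eq]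
    refine hg2 _ (hx.imp (fun h => ?_) fun h => ?_)
    · have := hψd.2.2.monotone h
      rwa [show ψ (ψ⁻¹ _) = _ from ψ.apply_symm_apply _] at this
    · have := hψd.2.2.monotone h
      rwa [show ψ (ψ⁻¹ _) = _ from ψ.apply_symm_apply _] at this
  · obtain ⟨k, -, rfl⟩ := Finset.mem_image.1 h
    exact hf k

theorem exists_partial_bound (j : ℕ) : ∀ {H : ℝ × ℝ → ℝ},
    ContDiffOn ℝ (⊤ : ℕ∞) H (Ioo (-1 / 2) (1 / 2) ×ˢ univ) → (∀ x, H (0, x) = 0) → ∀ a b : ℝ,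
    ∃ C : ℝ, ∀ t x, |t| ≤ 1 / 4 → a ≤ x → x ≤ b →
      |iteratedDeriv j (fun x => H (t, x)) x| ≤ C * |t| := by
  have hU : IsOpen (Ioo (-1 / 2 : ℝ) (1 / 2) ×ˢ (univ : Set ℝ)) := isOpen_Ioo.prod isOpen_univ
  induction j with
  | zero =>
    intro H hH h0 a b
    have hK : IsCompact (Icc (-1 / 4 : ℝ) (1 / 4) ×ˢ Icc a b) := isCompact_Icc.prod isCompact_Icc
    have hsub : Icc (-1 / 4 : ℝ) (1 / 4) ×ˢ Icc a b ⊆ Ioo (-1 / 2 : ℝ) (1 / 2) ×ˢ univ :=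
      prod_mono (fun x hx => ⟨by linarith [hx.1], by linarith [hx.2]⟩) (subset_univ _)
    have hc : ContinuousOn (fderiv ℝ H) (Icc (-1 / 4 : ℝ) (1 / 4) ×ˢ Icc a b) :=
      (hH.continuousOn_fderiv_of_isOpen hU (by simp)).mono hsub
    obtain ⟨C, hC⟩ := hK.exists_bound_of_continuousOn hc
    refine ⟨C, fun t x ht hax hxb => ?_⟩
    have hconv : Convex ℝ (Icc (-1 / 4 : ℝ) (1 / 4) ×ˢ Icc a b) :=
      (convex_Icc _ _).prod (convex_Icc _ _)
    have := hconv.norm_image_sub_le_of_norm_fderiv_le (f := H) (x := (0, x)) (y := (t, x))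
      (fun p hp => (hH.contDiffAt (hU.mem_nhds (hsub hp))).differentiableAt (by simp)) hC
      ⟨⟨by norm_num, by norm_num⟩, hax, hxb⟩
      ⟨⟨by linarith [neg_abs_le t], by linarith [le_abs_self t]⟩, hax, hxb⟩
    simpa [h0, Prod.norm_def] using this
  | succ j ih =>
    intro H hH h0 a b
    have hd : ∀ t x, |t| < 1 / 2 →
        HasDerivAt (fun x => H (t, x)) (fderiv ℝ H (t, x) (0, 1)) x := by
      intro t x ht
      have hp : (t, x) ∈ Ioo (-1 / 2 : ℝ) (1 / 2) ×ˢ (univ : Set ℝ) :=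
        ⟨⟨by linarith [neg_abs_le t], by linarith [le_abs_self t]⟩, trivial⟩
      have h1 := ((hH.contDiffAt (hU.mem_nhds hp)).differentiableAt (by simp)).hasFDerivAt
      have h2 : HasDerivAt (fun x : ℝ => (t, x)) ((0 : ℝ), (1 : ℝ)) x :=
        (hasDerivAt_const x t).prodMk (hasDerivAt_id x)
      exact h1.comp_hasDerivAt x h2
    obtain ⟨C, hC⟩ := ih (H := fun p => fderiv ℝ H p (0, 1))
      ((hH.fderiv_of_isOpen hU (m := (⊤ : ℕ∞)) (by simp)).clm_apply contDiffOn_const)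
      (fun x => by
        have := hd 0 x (by norm_num)
        simp only [h0] at this
        exact this.unique (hasDerivAt_const x 0)) a b
    refine ⟨C, fun t x ht hax hxb => ?_⟩
    rw [iteratedDeriv_succ', show deriv (fun x => H (t, x)) = fun x => fderiv ℝ H (t, x) (0, 1) from
      funext fun x => (hd t x (by linarith)).deriv]
    exact hC t x ht hax hxb

/-- A diffeomorphism from `ℝ` onto `(-∞, 5)` which is the identity on `(-∞, 2]`. -/
def chart (y : ℝ) : ℝ := y + Real.smoothTransition (y - 2) * (5 - (Real.log y)⁻¹ - y)

theorem chart_of_le {y : ℝ} (h : y ≤ 2) : chart y = y := by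
  simp [chart, Real.smoothTransition.zero_of_nonpos (sub_nonpos.2 h)]

theorem chart_of_ge {y : ℝ} (h : 3 ≤ y) : chart y = 5 - (Real.log y)⁻¹ := by
  simp [chart, Real.smoothTransition.one_of_one_le (show 1 ≤ y - 2 by linarith)]

theorem log_two_le_log {y : ℝ} (h : 2 ≤ y) : 2 / 3 < Real.log y :=
  lt_of_lt_of_le (by linarith [Real.log_two_gt_d9]) (Real.log_le_log two_pos h)

theorem contDiff_chart : ContDiff ℝ (⊤ : ℕ∞) chart := by
  rw [contDiff_iff_contDiffAt]
  intro y
  rcases lt_or_ge y 2 with h | h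
  · refine contDiffAt_id.congr_of_eventuallyEq ?_
    filter_upwards [Iio_mem_nhds h] with z hz using chart_of_le (le_of_lt hz)
  · have := log_two_le_log h
    refine contDiffAt_id.add ((Real.smoothTransition.contDiff.contDiffAt.comp y
      (contDiffAt_id.sub contDiffAt_const)).mul ((contDiffAt_const.sub
        ((Real.contDiffAt_log.2 (by linarith)).inv (by linarith))).sub contDiffAt_id))

theorem deriv_chart_pos (y : ℝ) : 0 < deriv chart y := by
  have hlog : ∀ y : ℝ, 2 ≤ y → HasDerivAt (fun y => 5 - (Real.log y)⁻¹)
      (y⁻¹ / Real.log y ^ 2) y := fun y h => by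
    have h1 := log_two_le_log h
    have := ((Real.hasDerivAt_log (by linarith : y ≠ 0)).inv (by linarith)).const_sub 5
    rw [neg_div, neg_neg] at this
    exact this
  have hpos : ∀ y : ℝ, 2 ≤ y → 0 < y⁻¹ / Real.log y ^ 2 := fun y h => by
    have h1 := log_two_le_log h
    positivity
  rcases lt_or_ge y 2 with h | h
  · have : chart =ᶠ[nhds y] id := by
      filter_upwards [Iio_mem_nhds h] with z hz using chart_of_le (le_of_lt hz)
    simp [this.deriv_eq]
  rcases lt_or_ge 3 y with h' | h'
  · have : chart =ᶠ[nhds y] fun y => 5 - (Real.log y)⁻¹ := by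
      filter_upwards [Ioi_mem_nhds h'] with z hz using chart_of_ge (le_of_lt hz)
    rw [this.deriv_eq, (hlog y h).deriv]
    exact hpos y h
  · have hχ : HasDerivAt (fun y => Real.smoothTransition (y - 2))
        (deriv Real.smoothTransition (y - 2)) y := by
      have := ((Real.smoothTransition.contDiff (n := (⊤ : ℕ∞))).differentiable
        (by simp) (y - 2)).hasDerivAt
      simpa using this.comp_sub_const y 2
    have hd := (hasDerivAt_id y).add (hχ.mul ((hlog y h).sub (hasDerivAt_id y)))
    have hd' : HasDerivAt chart _ y := hd
    rw [hd'.deriv]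
    have h1 := log_two_le_log h
    have h2 : (Real.log y)⁻¹ < 3 / 2 := by
      rw [show (3 / 2 : ℝ) = (2 / 3)⁻¹ by norm_num]
      exact inv_strictAnti₀ (by norm_num) h1
    have h3 : 0 ≤ deriv Real.smoothTransition (y - 2) := Real.smoothTransition.monotone.deriv_nonneg
    have h4 := Real.smoothTransition.nonneg (y - 2)
    have h5 := Real.smoothTransition.le_one (y - 2)
    have h6 := hpos y h
    have h7 : 0 ≤ deriv Real.smoothTransition (y - 2) * (5 - (Real.log y)⁻¹ - y) :=
      mul_nonneg h3 (by linarith)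
    simp only [Pi.sub_apply, id]
    rcases h5.lt_or_eq with h5 | h5
    · nlinarith [mul_nonneg h4 h6.le]
    · rw [h5]; linarith

theorem chart_strictMono : StrictMono chart := strictMono_of_deriv_pos deriv_chart_pos

theorem chart_lt (y : ℝ) : chart y < 5 := by
  rcases le_total y 3 with h | h
  · refine lt_of_le_of_lt (chart_strictMono.monotone h) ?_
    rw [chart_of_ge le_rfl]
    have := log_two_le_log (show (2 : ℝ) ≤ 3 by norm_num)
    have : 0 < (Real.log 3)⁻¹ := by positivity
    linarith
  · rw [chart_of_ge h]
    have := log_two_le_log (show 2 ≤ y by linarith)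
    have : 0 < (Real.log y)⁻¹ := by positivity
    linarith

theorem exists_chart_eq {x : ℝ} (hx : x < 5) : ∃ y, chart y = x := by
  have h1 : chart (min 2 x) ≤ x := by
    rw [chart_of_le (min_le_left _ _)]; exact min_le_right _ _
  have h2 : x ≤ chart (Real.exp (max 2 (5 - x)⁻¹)) := by
    have h3 : 3 ≤ Real.exp (max 2 (5 - x)⁻¹) := by
      have := Real.add_one_le_exp (max 2 (5 - x)⁻¹)
      have := le_max_left 2 (5 - x)⁻¹
      linarith
    rw [chart_of_ge h3, Real.log_exp]
    have := inv_anti₀ (by have : 0 < 5 - x := by linarith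
                          positivity) (le_max_right 2 (5 - x)⁻¹)
    rw [inv_inv] at this
    linarith
  exact mem_range_of_exists_le_of_exists_ge contDiff_chart.continuous ⟨_, h1⟩ ⟨_, h2⟩

/-- `chart` as a bijection onto `(-∞, 5)`. -/
def chartEquiv : ℝ ≃ {x : ℝ // x < 5} :=
  Equiv.ofBijective (fun y => ⟨chart y, chart_lt y⟩)
    ⟨fun _ _ h => chart_strictMono.injective (congrArg Subtype.val h),
      fun x => (exists_chart_eq x.2).imp fun _ h => Subtype.ext h⟩

/-- Conjugation by `chart`, extended by the identity. -/
def push : Equiv.Perm ℝ →* Equiv.Perm ℝ := Equiv.Perm.extendDomainHom chartEquiv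

theorem push_chart (a : Equiv.Perm ℝ) (y : ℝ) : push a (chart y) = chart (a y) :=
  Equiv.Perm.extendDomain_apply_image a chartEquiv y

theorem push_of_ge (a : Equiv.Perm ℝ) {x : ℝ} (h : 5 ≤ x) : push a x = x :=
  Equiv.Perm.extendDomain_apply_not_subtype a chartEquiv (not_lt.2 h)

theorem push_of_le {a : Equiv.Perm ℝ} {x : ℝ} (h : x ≤ 2) (h' : a x ≤ 2) : push a x = a x := by
  have := push_chart a x
  rwa [chart_of_le h, chart_of_le h'] at this

theorem push_strictMono {a : Equiv.Perm ℝ} (ha : StrictMono a) : StrictMono (push a) := by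
  intro x x' h
  rcases lt_or_ge x 5 with hx | hx
  · obtain ⟨y, rfl⟩ := exists_chart_eq hx
    rw [push_chart]
    rcases lt_or_ge x' 5 with hx' | hx'
    · obtain ⟨y', rfl⟩ := exists_chart_eq hx'
      rw [push_chart]
      exact chart_strictMono (ha (chart_strictMono.lt_iff_lt.1 h))
    · rw [push_of_ge a hx']
      exact (chart_lt _).trans_le hx'
  · rwa [push_of_ge a hx, push_of_ge a (by linarith)]

theorem push_eq_of_translation {a : Equiv.Perm ℝ} {α : ℝ} (ha : ∀ y, 1 / 2 ≤ y → a y = y + α)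
    {x : ℝ} (hx : 1 / 2 ≤ x) : push a x = push (affP 1 α one_pos) x := by
  rcases lt_or_ge x 5 with h | h
  · obtain ⟨y, rfl⟩ := exists_chart_eq h
    rw [push_chart, push_chart, ha y, affP_apply, one_mul]
    rw [← chart_of_le (show (1 / 2 : ℝ) ≤ 2 by norm_num)] at hx
    exact chart_strictMono.le_iff_le.1 hx
  · rw [push_of_ge _ h, push_of_ge _ h]

theorem contDiffAt_chart_symm {x : ℝ} (hx : x < 5) : ∃ G : ℝ → ℝ, ContDiffAt ℝ (⊤ : ℕ∞) G x ∧
    ∀ x < 5, chart (G x) = x := by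
  have hd : ∀ y, HasStrictDerivAt chart (deriv chart y) y := fun y =>
    (contDiff_chart.contDiffAt (x := y)).hasStrictDerivAt (by simp)
  have ho : Topology.IsOpenEmbedding chart := .of_continuous_injective_isOpenMap
    contDiff_chart.continuous chart_strictMono.injective
    (isOpenMap_of_hasStrictDerivAt hd fun y => (deriv_chart_pos y).ne')
  let e := ho.toOpenPartialHomeomorph chart
  have hr : ∀ x < 5, x ∈ e.target := fun x hx => by
    obtain ⟨y, rfl⟩ := exists_chart_eq hx
    simp [e]
  refine ⟨e.symm, ?_, fun x hx => e.right_inv (hr x hx)⟩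
  exact e.contDiffAt_symm_deriv (deriv_chart_pos _).ne' (hr x hx) (hd _).hasDerivAt
    contDiff_chart.contDiffAt

theorem push_translation_of_gt {t x : ℝ} (ht : |t| < 1 / 2) (hx : 9 / 2 < x) :
    push (affP 1 t one_pos) x =
      5 - (5 - x) / (1 + (5 - x) * Real.log (1 + t * expNegInvGlue (5 - x))) := by
  rcases lt_or_ge x 5 with h | h
  · obtain ⟨z, rfl⟩ : ∃ z, x = 5 - z := ⟨5 - x, by ring⟩
    have hz : 0 < z := by linarith
    have hz2 : z < 1 / 2 := by linarith
    have h2 : 2 < z⁻¹ := by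
      rw [show (2 : ℝ) = (1 / 2)⁻¹ by norm_num]; exact inv_strictAnti₀ hz hz2
    have h5 : 4 < Real.exp z⁻¹ := by
      have := Real.quadratic_le_exp_of_nonneg (show 0 ≤ z⁻¹ by linarith)
      nlinarith
    have hy : chart (Real.exp z⁻¹) = 5 - z := by
      rw [chart_of_ge (by linarith), Real.log_exp, inv_inv]
    obtain ⟨ht1, ht2⟩ := abs_lt.1 ht
    have he : Real.exp (-z⁻¹) < 1 := by
      rw [Real.exp_lt_one_iff]; linarith
    have hp : 0 < 1 + t * Real.exp (-z⁻¹) := by nlinarith [Real.exp_pos (-z⁻¹)]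
    have hl : Real.log (Real.exp z⁻¹ + t) = z⁻¹ + Real.log (1 + t * Real.exp (-z⁻¹)) := by
      rw [show z⁻¹ + Real.log (1 + t * Real.exp (-z⁻¹)) =
          Real.log (Real.exp z⁻¹) + Real.log (1 + t * Real.exp (-z⁻¹)) by rw [Real.log_exp],
        ← Real.log_mul (Real.exp_pos _).ne' hp.ne', mul_add, mul_left_comm, ← Real.exp_add]
      simp
    have hg : expNegInvGlue z = Real.exp (-z⁻¹) := by simp [expNegInvGlue, hz.not_ge]
    rw [← hy, push_chart, affP_apply, one_mul, hy, chart_of_ge (by linarith), hl,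
      sub_sub_cancel, hg]
    congr 1
    rw [← one_div, show z⁻¹ + Real.log (1 + t * Real.exp (-z⁻¹)) =
      (1 + z * Real.log (1 + t * Real.exp (-z⁻¹))) / z by field_simp, one_div_div]
  · rw [push_of_ge _ h, expNegInvGlue.zero_of_nonpos (by linarith)]
    simp

theorem contDiffOn_push_translation :
    ContDiffOn ℝ (⊤ : ℕ∞) (fun p : ℝ × ℝ => push (affP 1 p.1 one_pos) p.2)
      (Ioo (-1 / 2) (1 / 2) ×ˢ univ) := by
  rintro ⟨t, x⟩ ⟨⟨ht1, ht2⟩, -⟩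
  simp only at ht1 ht2
  refine ContDiffAt.contDiffWithinAt ?_
  rcases lt_or_ge x 5 with h | h
  · obtain ⟨G, hG, hG'⟩ := contDiffAt_chart_symm h
    have : ContDiffAt ℝ (⊤ : ℕ∞) (fun p : ℝ × ℝ => chart (G p.2 + p.1)) (t, x) :=
      contDiff_chart.contDiffAt.comp (t, x) ((hG.comp (t, x) contDiffAt_snd).add contDiffAt_fst)
    refine this.congr_of_eventuallyEq ?_
    filter_upwards [continuousAt_snd.eventually_lt continuousAt_const h] with p hp
    conv_lhs => rw [← hG' p.2 hp, push_chart, affP_apply, one_mul]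
  · have h1 : 1 + t * expNegInvGlue (5 - x) = 1 := by
      rw [expNegInvGlue.zero_of_nonpos (by linarith)]; simp
    have hz : ContDiffAt ℝ (⊤ : ℕ∞) (fun p : ℝ × ℝ => 5 - p.2) (t, x) :=
      contDiffAt_const.sub contDiffAt_snd
    have hL : ContDiffAt ℝ (⊤ : ℕ∞)
        (fun p : ℝ × ℝ => Real.log (1 + p.1 * expNegInvGlue (5 - p.2))) (t, x) := by
      refine ContDiffAt.log (contDiffAt_const.add (contDiffAt_fst.mul ?_)) (by simp [h1])
      exact expNegInvGlue.contDiff.contDiffAt.comp (t, x) hz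
    have := (contDiffAt_const (c := (5 : ℝ))).sub (hz.div
      ((contDiffAt_const (c := (1 : ℝ))).add (hz.mul hL)) (by simp [h1]))
    refine this.congr_of_eventuallyEq ?_
    filter_upwards [continuousAt_const.eventually_lt continuousAt_snd
        (show (9 / 2 : ℝ) < x by linarith),
      continuousAt_const.eventually_lt continuousAt_fst ht1,
      continuousAt_fst.eventually_lt continuousAt_const ht2] with p hp1 hp2 hp3
    exact push_translation_of_gt (abs_lt.2 ⟨by linarith, hp3⟩) hp1

theorem contDiff_push_translation {t : ℝ} (ht : |t| < 1 / 2) :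
    ContDiff ℝ (⊤ : ℕ∞) (push (affP 1 t one_pos)) := by
  have ht' := abs_lt.1 ht
  rw [← contDiffOn_univ]
  exact contDiffOn_push_translation.comp (f := fun x => (t, x))
    (contDiff_const.prodMk contDiff_id).contDiffOn fun x _ =>
      ⟨⟨by linarith [ht'.1], by linarith [ht'.2]⟩, trivial⟩

theorem push_translation_bound (j : ℕ) : ∃ C : ℝ, 1 ≤ C ∧ ∀ t x, |t| ≤ 1 / 4 → 0 ≤ x →
    |iteratedDeriv j (disp (push (affP 1 t one_pos))) x| ≤ C * |t| := by
  obtain ⟨C, hC⟩ := exists_partial_bound j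
    (H := fun p => push (affP 1 p.1 one_pos) p.2 - p.2)
    (contDiffOn_push_translation.sub contDiffOn_snd) (fun x => by
      have : affP 1 0 one_pos = 1 := by ext; simp
      simp [this]) 0 5
  refine ⟨max 1 C, le_max_left _ _, fun t x ht hx => ?_⟩
  rcases le_or_gt x 5 with h | h
  · exact (hC t x ht hx h).trans (mul_le_mul_of_nonneg_right (le_max_right _ _) (abs_nonneg _))
  · have : EqOn (disp (push (affP 1 t one_pos))) (fun _ => 0) (Ioi 5) := fun y hy => by
      simp [disp, push_of_ge _ (le_of_lt hy)]
    rw [this.iteratedDeriv_of_isOpen isOpen_Ioi j h]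
    simp only [iteratedDeriv_const, ite_self, abs_zero]
    positivity

/-- The equality cases for `push a` when `a` is a translation near `+∞`. -/
theorem push_eqOn_of_translation {a : Equiv.Perm ℝ} (ha : IsDiffeo a) {α : ℝ} (hα : |α| ≤ 1 / 4)
    (h : ∀ y, 1 / 2 ≤ y → a y = y + α) : EqOn (push a) a (Iio 1) ∧
      EqOn (push a) (push (affP 1 α one_pos)) (Ioi (1 / 2)) := by
  refine ⟨fun x hx => push_of_le (by linarith [mem_Iio.1 hx]) ?_,
    fun x hx => push_eq_of_translation h (le_of_lt hx)⟩
  have := ha.2.2 (mem_Iio.1 hx)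
  rw [h 1 (by norm_num)] at this
  linarith [le_abs_self α]

theorem contDiff_push {a : Equiv.Perm ℝ} (ha : IsDiffeo a) {α : ℝ} (hα : |α| ≤ 1 / 4)
    (h : ∀ y, 1 / 2 ≤ y → a y = y + α) : ContDiff ℝ (⊤ : ℕ∞) (push a) := by
  obtain ⟨h1, h2⟩ := push_eqOn_of_translation ha hα h
  rw [contDiff_iff_contDiffAt]
  intro x
  rcases lt_or_ge x 1 with hx | hx
  · exact ha.1.contDiffAt.congr_of_eventuallyEq (h1.eventuallyEq_of_mem (Iio_mem_nhds hx))
  · exact (contDiff_push_translation (by linarith)).contDiffAt.congr_of_eventuallyEq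
      (h2.eventuallyEq_of_mem (Ioi_mem_nhds (by linarith)))

theorem IsDiffeo.push {a : Equiv.Perm ℝ} (ha : IsDiffeo a) {α : ℝ} (hα : |α| ≤ 1 / 4)
    (h : ∀ y, 1 / 4 ≤ y → a y = y + α) : IsDiffeo (push a) := by
  refine ⟨contDiff_push ha hα fun y hy => h y (by linarith), ?_, push_strictMono ha.2.2⟩
  have : ContDiff ℝ (⊤ : ℕ∞) (_root_.push a⁻¹) := by
    refine contDiff_push ha.inv (α := -α) (by rwa [abs_neg]) fun y hy => ?_
    rw [Equiv.Perm.inv_eq_iff_eq, h _ (by linarith [le_abs_self α])]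
    ring
  rwa [map_inv] at this

theorem push_DB {a : Equiv.Perm ℝ} (ha : IsDiffeo a) {α : ℝ} (hα : |α| ≤ 1 / 4)
    (h : ∀ y, 1 / 4 ≤ y → a y = y + α) {R : ℕ} {m : ℝ}
    (hm : ∀ x < 1, |iteratedDeriv R (disp a) x| ≤ m)
    (hm' : ∀ x, 0 ≤ x → |iteratedDeriv R (disp (push (affP 1 α one_pos))) x| ≤ m) :
    DB (push a) R m := by
  obtain ⟨h1, h2⟩ := push_eqOn_of_translation ha hα fun y hy => h y (by linarith)
  intro x
  rcases lt_or_ge x 1 with hx | hx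
  · have : EqOn (disp (push a)) (disp a) (Iio 1) := fun y hy => by simp [disp, h1 hy]
    rw [this.iteratedDeriv_of_isOpen isOpen_Iio R hx]
    exact hm x hx
  · have : EqOn (disp (push a)) (disp (push (affP 1 α one_pos))) (Ioi (1 / 2)) := fun y hy => by
      simp [disp, h2 hy]
    rw [this.iteratedDeriv_of_isOpen isOpen_Ioi R (show 1 / 2 < x by linarith)]
    exact hm' x (by linarith)

theorem abs_iteratedDeriv_le_of_periodic {P : ℝ → ℝ} (hP : ContDiff ℝ (⊤ : ℕ∞) P) {s : ℝ}
    (hs : 0 < s) (h0 : P 0 = 0) (hper : ∀ᶠ x in nhds 0, P (x + s) = P x) {B : ℝ} {R : ℕ}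
    (hB : ∀ x, |iteratedDeriv R P x| ≤ B) (j d : ℕ) (hR : j + d = R) :
    ∀ x ∈ Icc 0 s, |iteratedDeriv j P x| ≤ s ^ d * B := by
  have hend : ∀ i, iteratedDeriv i P s = iteratedDeriv i P 0 := fun i => by
    have h1 : (fun x => P (x + s)) =ᶠ[nhds 0] P := hper
    have h2 := h1.iteratedDeriv_eq i
    rw [iteratedDeriv_comp_add_const] at h2
    simpa using h2
  have hzero : ∀ i, ∃ c ∈ Icc 0 s, iteratedDeriv i P c = 0 := fun i => by
    rcases i with _ | i
    · exact ⟨0, ⟨le_rfl, hs.le⟩, by simpa using h0⟩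
    · obtain ⟨c, hc, hc'⟩ := exists_hasDerivAt_eq_zero hs
        (smooth_iteratedDeriv hP i).continuous.continuousOn (hend i).symm
        fun x _ => hasDerivAt_iteratedDeriv hP i x
      exact ⟨c, Ioo_subset_Icc_self hc, hc'⟩
  have hB0 : 0 ≤ B := (abs_nonneg _).trans (hB 0)
  induction d generalizing j with
  | zero => intro x _; subst hR; simpa using hB x
  | succ d ih =>
    intro x hx
    obtain ⟨c, hc, hc'⟩ := hzero j
    have := abs_iteratedDeriv_sub_le hP j (convex_Icc 0 s) (ih (j + 1) (by omega)) hc hx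
    rw [hc', sub_zero] at this
    refine this.trans ?_
    have : |x - c| ≤ s := abs_le.2 ⟨by linarith [hc.2, hx.1], by linarith [hc.1, hx.2]⟩
    calc s ^ d * B * |x - c| ≤ s ^ d * B * s := by gcongr
      _ = _ := by ring

theorem exists_smoothTransition_bound (i : ℕ) :
    ∃ X : ℝ, 1 ≤ X ∧ ∀ y, |iteratedDeriv i Real.smoothTransition y| ≤ X := by
  have hχ : ContDiff ℝ (⊤ : ℕ∞) Real.smoothTransition := Real.smoothTransition.contDiff
  obtain ⟨C, hC⟩ := (isCompact_Icc (a := (0 : ℝ)) (b := 1)).exists_bound_of_continuousOn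
    (smooth_iteratedDeriv hχ i).continuous.continuousOn
  refine ⟨max 1 C, le_max_left _ _, fun y => ?_⟩
  rcases lt_or_ge y 0 with h | h
  · have : EqOn Real.smoothTransition (fun _ => 0) (Iio 0) := fun z hz =>
      Real.smoothTransition.zero_of_nonpos (le_of_lt hz)
    rw [this.iteratedDeriv_of_isOpen isOpen_Iio i h]
    simp only [iteratedDeriv_const, ite_self, abs_zero]
    positivity
  rcases lt_or_ge 1 y with h' | h'
  · have : EqOn Real.smoothTransition (fun _ => 1) (Ioi 1) := fun z hz =>
      Real.smoothTransition.one_of_one_le (le_of_lt hz)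
    rw [this.iteratedDeriv_of_isOpen isOpen_Ioi i h', iteratedDeriv_const]
    refine le_trans ?_ (le_max_left 1 C)
    split_ifs <;> simp
  · exact (hC y ⟨h, h'⟩).trans (le_max_right _ _)

theorem smooth_cutoff (N : ℝ) {P : ℝ → ℝ} (hP : ContDiff ℝ (⊤ : ℕ∞) P) :
    ContDiff ℝ (⊤ : ℕ∞) fun x => Real.smoothTransition (N * x) * P x :=
  (Real.smoothTransition.contDiff.comp (contDiff_const.mul contDiff_id)).mul hP

theorem cutoff_bound (R : ℕ) : ∃ C : ℝ, 1 ≤ C ∧ ∀ N : ℝ, 0 < N → ∀ P : ℝ → ℝ,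
    ContDiff ℝ (⊤ : ℕ∞) P → P 0 = 0 → (∀ᶠ x in nhds 0, P (x + N⁻¹) = P x) → ∀ B,
    (∀ x, |iteratedDeriv R P x| ≤ B) →
    ∀ x, |iteratedDeriv R (fun x => Real.smoothTransition (N * x) * P x) x| ≤ C * B := by
  choose X hX1 hX using exists_smoothTransition_bound
  set S := ∑ i ∈ Finset.range (R + 1), (R.choose i : ℝ) * X i with hS
  have hS1 : 1 ≤ S := by
    rw [hS, Finset.sum_range_succ']
    have : 0 ≤ ∑ i ∈ Finset.range R, (R.choose (i + 1) : ℝ) * X (i + 1) :=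
      Finset.sum_nonneg fun i _ => mul_nonneg (Nat.cast_nonneg _) (by linarith [hX1 (i + 1)])
    simpa using le_add_of_nonneg_of_le this (hX1 0)
  refine ⟨S, hS1, fun N hN P hP h0 hper B hB x => ?_⟩
  have hB0 : 0 ≤ B := (abs_nonneg _).trans (hB 0)
  have hχ : ContDiff ℝ (⊤ : ℕ∞) Real.smoothTransition := Real.smoothTransition.contDiff
  rcases lt_or_ge x 0 with h | h
  · have : EqOn (fun x => Real.smoothTransition (N * x) * P x) (fun _ => 0) (Iio 0) :=
      fun z hz => by
        simp [Real.smoothTransition.zero_of_nonpos (mul_nonpos_of_nonneg_of_nonpos hN.le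
          (le_of_lt hz))]
    rw [this.iteratedDeriv_of_isOpen isOpen_Iio R h]
    simp only [iteratedDeriv_const, ite_self, abs_zero]
    positivity
  rcases lt_or_ge N⁻¹ x with h' | h'
  · have : EqOn (fun x => Real.smoothTransition (N * x) * P x) P (Ioi N⁻¹) := fun z hz => by
      have : 1 ≤ N * z := by
        rw [← mul_inv_cancel₀ hN.ne']
        exact mul_le_mul_of_nonneg_left (le_of_lt hz) hN.le
      simp [Real.smoothTransition.one_of_one_le this]
    rw [this.iteratedDeriv_of_isOpen isOpen_Ioi R h']
    nlinarith [hB x]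
  · have hd : ∀ i, iteratedDeriv i (fun x => Real.smoothTransition (N * x)) x =
        N ^ i * iteratedDeriv i Real.smoothTransition (N * x) := fun i => by
      have := congrFun (iteratedDeriv_comp_affine hχ i N 0 1) x
      simpa using this
    have hχN : ContDiff ℝ (⊤ : ℕ∞) fun x => Real.smoothTransition (N * x) :=
      hχ.comp (contDiff_const.mul contDiff_id)
    rw [iteratedDeriv_fun_mul (hχN.of_le (by exact_mod_cast le_top)).contDiffAt
      (hP.of_le (by exact_mod_cast le_top)).contDiffAt,
      Finset.sum_mul]
    refine (Finset.abs_sum_le_sum_abs _ _).trans (Finset.sum_le_sum fun i hi => ?_)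
    have hi' : R - i + i = R := Nat.sub_add_cancel (by simpa [Nat.lt_succ_iff] using hi)
    have h1 := abs_iteratedDeriv_le_of_periodic hP (inv_pos.2 hN) h0 hper hB (R - i) i hi' x
      ⟨h, h'⟩
    have hXi : 0 ≤ X i := by linarith [hX1 i]
    rw [hd, abs_mul, abs_mul, abs_mul, abs_of_pos (pow_pos hN i), Nat.abs_cast]
    calc (R.choose i : ℝ) * (N ^ i * |iteratedDeriv i Real.smoothTransition (N * x)|) *
          |iteratedDeriv (R - i) P x| ≤ (R.choose i : ℝ) * (N ^ i * X i) * (N⁻¹ ^ i * B) := by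
          gcongr
          exact hX i _
      _ = (R.choose i : ℝ) * X i * B * (N * N⁻¹) ^ i := by rw [mul_pow]; ring
      _ = _ := by rw [mul_inv_cancel₀ hN.ne', one_pow, mul_one]

theorem DB.mul_translation {f : Equiv.Perm ℝ} {j : ℕ} {m : ℝ} (h : DB f j m) (hf : IsDiffeo f)
    (hj : j ≠ 0) (c : ℝ) : DB (f * affP 1 c one_pos) j m := fun x => by
  have : disp (f * affP 1 c one_pos) = fun x => disp f (x + c) + c := by
    ext; simp [disp]; ring
  have hc : ContDiff ℝ (⊤ : ℕ∞) fun x => disp f (x + c) :=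
    hf.contDiff_disp.comp (contDiff_id.add contDiff_const)
  rw [this, iteratedDeriv_fun_add_smooth hc contDiff_const, iteratedDeriv_comp_add_const,
    iteratedDeriv_const, if_neg hj, add_zero]
  exact h _

/-- The approximate conjugacy between the translation by `1 / N` and its composition with `f`. -/
def stepK (f : Equiv.Perm ℝ) (N : ℕ) : Equiv.Perm ℝ :=
  (f * affP 1 (N : ℝ)⁻¹ one_pos) ^ (14 * N) * affP 1 (-14) one_pos

theorem IsDiffeo.stepK {f : Equiv.Perm ℝ} (hf : IsDiffeo f) (N : ℕ) : IsDiffeo (stepK f N) :=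
  ((hf.mul (affP_isDiffeo _ _ _)).pow _).mul (affP_isDiffeo _ _ _)

theorem stepK_bound (R : ℕ) (hR : 2 ≤ R) : ∃ C : ℝ, 1 ≤ C ∧ ∀ (N : ℕ) (f : Equiv.Perm ℝ) (β m : ℝ),
    1 ≤ N → 0 < β → 0 < m → IsDiffeo f → DB f 1 β → DB f R m → C * (N * β) ≤ 1 →
    DB (stepK f N) 1 (C * (N * β)) ∧ DB (stepK f N) R (C * (N * m)) ∧
    DB (stepK f N)⁻¹ 1 (C * (N * β)) ∧ DB (stepK f N)⁻¹ R (C * (N * m)) := by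
  obtain ⟨C, hC1, hC⟩ := comp_bound R hR
  obtain ⟨C', hC1', hC'⟩ := inv_bound R hR
  refine ⟨14 * C * C', by nlinarith, fun N f β m hN hβ hm hf h1 h2 hle => ?_⟩
  have hN0 : (0 : ℝ) < N := by exact_mod_cast hN
  have hmono : ∀ z : ℝ, 0 < z → C * (14 * N : ℕ) * z ≤ 14 * C * C' * (N * z) := fun z hz => by
    push_cast
    have : 0 < 14 * C * (N * z) := by positivity
    nlinarith
  have hF : ∀ F ∈ List.replicate (14 * N) (f * affP 1 (N : ℝ)⁻¹ one_pos),
      IsDiffeo F ∧ DB F 1 β ∧ DB F R m := fun F hF => by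
    rw [List.eq_of_mem_replicate hF]
    exact ⟨hf.mul (affP_isDiffeo _ _ _), h1.mul_translation hf one_ne_zero _,
      h2.mul_translation hf (by omega) _⟩
  obtain ⟨h3, h4⟩ := hC β m hβ hm _ hF (by
    rw [List.length_replicate]; exact (hmono β hβ).trans hle)
  have hFd : IsDiffeo ((f * affP 1 (N : ℝ)⁻¹ one_pos) ^ (14 * N)) :=
    (hf.mul (affP_isDiffeo _ _ _)).pow _
  rw [List.length_replicate, List.prod_replicate] at h3 h4
  replace h3 := h3.mul_translation hFd one_ne_zero (-14)
  replace h4 := h4.mul_translation hFd (by omega) (-14)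
  have hpos : (0 : ℝ) < C * (14 * N : ℕ) := by push_cast; positivity
  obtain ⟨h5, h6⟩ := hC' _ _ (mul_pos hpos hβ) (mul_pos hpos hm) _ (hf.stepK N) h3 h4 (by
    push_cast; linarith)
  exact ⟨h3.mono (hmono β hβ), h4.mono (hmono m hm),
    h5.mono (by push_cast; linarith), h6.mono (by push_cast; linarith)⟩

theorem stepK_apply (f : Equiv.Perm ℝ) (N : ℕ) (x : ℝ) :
    stepK f N x = ((f * affP 1 (N : ℝ)⁻¹ one_pos) ^ (14 * N)) (x - 14) := by
  simp [stepK, sub_eq_add_neg]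

theorem stepK_of_le {f : Equiv.Perm ℝ} {c : ℝ} (hs : SuppIn f (-12) c) {N : ℕ} (hN : 1 ≤ N) {x : ℝ}
    (hx : x ≤ -12) : stepK f N x = x := by
  have hN0 : (0 : ℝ) < N := by exact_mod_cast hN
  have key : ∀ (i : ℕ) (y : ℝ), y + i * (N : ℝ)⁻¹ ≤ -12 →
      ((f * affP 1 (N : ℝ)⁻¹ one_pos) ^ i) y = y + i * (N : ℝ)⁻¹ := by
    intro i
    induction i with
    | zero => intro y _; simp
    | succ i ih =>
      intro y hy
      have : 0 < (N : ℝ)⁻¹ := by positivity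
      push_cast at hy
      rw [Nat.cast_succ, pow_succ', Equiv.Perm.mul_apply, ih y (by linarith),
        Equiv.Perm.mul_apply, affP_apply,
        hs _ (Or.inl (by linarith))]
      ring
  have h14 : ((14 * N : ℕ) : ℝ) * (N : ℝ)⁻¹ = 14 := by
    push_cast; field_simp
  rw [stepK_apply, key _ _ (by rw [h14]; linarith), h14]
  ring

theorem stepK_shift {f : Equiv.Perm ℝ} {c : ℝ} (hs : SuppIn f (-12) c) {N : ℕ} {x : ℝ}
    (hx : x + (N : ℝ)⁻¹ ≤ 2) : f (stepK f N x + (N : ℝ)⁻¹) = stepK f N (x + (N : ℝ)⁻¹) := by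
  have h := (Commute.refl (f * affP 1 (N : ℝ)⁻¹ one_pos)).pow_right (14 * N)
  have h1 := congrArg (fun p : Equiv.Perm ℝ => p (x - 14)) h.eq
  simp only [Equiv.Perm.mul_apply, affP_apply, one_mul] at h1
  rw [stepK_apply, stepK_apply, h1, hs _ (Or.inl (by linarith))]
  congr 1
  ring

theorem abs_stepK_sub_le {f : Equiv.Perm ℝ} (hf : IsDiffeo f) {c : ℝ} (hs : SuppIn f (-12) c)
    {N : ℕ} (hN : 1 ≤ N) {β : ℝ} (hk : DB (stepK f N) 1 β) {x : ℝ} (hx : -12 ≤ x) :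
    |stepK f N x - x| ≤ β * (x + 12) := by
  have := abs_iteratedDeriv_sub_le (hf.stepK N).contDiff_disp 0 convex_univ (fun y _ => hk y)
    (mem_univ (-12)) (mem_univ x)
  simp only [iteratedDeriv_zero, disp, stepK_of_le hs hN le_rfl] at this
  rw [abs_of_nonneg (show (0 : ℝ) ≤ x - -12 by linarith)] at this
  simpa using this

theorem stepK_add {f : Equiv.Perm ℝ} (hf : IsDiffeo f) (hs : SuppIn f (-12) (-47 / 4))
    {N : ℕ} (hN : 1 ≤ N) (hk : DB (stepK f N) 1 (1 / 100)) {x : ℝ} (hx : -11 ≤ x)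
    (hx' : x + (N : ℝ)⁻¹ ≤ 2) :
    stepK f N (x + (N : ℝ)⁻¹) = stepK f N x + (N : ℝ)⁻¹ := by
  have h0 : 0 < (N : ℝ)⁻¹ := by have : (0 : ℝ) < N := by exact_mod_cast hN
                                positivity
  have := abs_le.1 (abs_stepK_sub_le hf hs hN hk (show -12 ≤ x by linarith))
  rw [← stepK_shift hs hx', hs _ (Or.inr (by linarith [this.1]))]

theorem abs_stepK_zero {f : Equiv.Perm ℝ} (hf : IsDiffeo f) {c : ℝ} (hs : SuppIn f (-12) c)
    {N : ℕ} (hN : 1 ≤ N) {β : ℝ} (hk : DB (stepK f N) 1 β) : |stepK f N 0| ≤ 12 * β := by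
  have := abs_stepK_sub_le hf hs hN hk (show (-12 : ℝ) ≤ 0 by norm_num)
  simp only [sub_zero, zero_add] at this
  linarith

theorem stepK_inv_periodic {f : Equiv.Perm ℝ} (hf : IsDiffeo f) (hs : SuppIn f (-12) (-47 / 4))
    {N : ℕ} (hN : 100 ≤ N) (hk : DB (stepK f N) 1 (1 / 100)) : ∀ᶠ x in nhds (0 : ℝ),
    (stepK f N)⁻¹ (x + (N : ℝ)⁻¹ + stepK f N 0) - (x + (N : ℝ)⁻¹) =
      (stepK f N)⁻¹ (x + stepK f N 0) - x := by
  filter_upwards [Ioo_mem_nhds (show (-1 / 2 : ℝ) < 0 by norm_num)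
    (show (0 : ℝ) < 1 / 2 by norm_num)] with x hx
  obtain ⟨y, hy⟩ : ∃ y, stepK f N y = x + stepK f N 0 := (stepK f N).surjective _
  have hN1 : 1 ≤ N := by omega
  have hN' : (100 : ℝ) ≤ N := by exact_mod_cast hN
  have hi : (N : ℝ)⁻¹ ≤ 1 / 100 := by
    rw [one_div]; exact inv_anti₀ (by norm_num) hN'
  have h0 := abs_le.1 (abs_stepK_zero hf hs hN1 hk)
  have hm1 := abs_le.1 (abs_stepK_sub_le hf hs hN1 hk (show (-12 : ℝ) ≤ -1 by norm_num))
  have h1 := abs_le.1 (abs_stepK_sub_le hf hs hN1 hk (show (-12 : ℝ) ≤ 1 by norm_num))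
  have hmono := (hf.stepK N).2.2
  have hy1 : -1 ≤ y := by
    rw [← hmono.le_iff_le, hy]; linarith [hx.1]
  have hy2 : y ≤ 1 := by
    rw [← hmono.le_iff_le, hy]; linarith [hx.2]
  have h2 := stepK_add hf hs hN1 hk (x := y) (by linarith) (by linarith)
  rw [← hy, show x + (N : ℝ)⁻¹ + stepK f N 0 = stepK f N (y + (N : ℝ)⁻¹) by rw [h2, hy]; ring,
    Equiv.Perm.inv_def, Equiv.symm_apply_apply, Equiv.symm_apply_apply]
  ring

theorem inv_natCast_le {N : ℕ} (hN : 100 ≤ N) : (N : ℝ)⁻¹ ≤ 1 / 100 := by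
  rw [one_div]; exact inv_anti₀ (by norm_num) (by exact_mod_cast hN)

/-- The data from which `f` is decomposed as a commutator times a more concentrated
diffeomorphism. -/
structure StepData (f : Equiv.Perm ℝ) (N : ℕ) (q T : Equiv.Perm ℝ) : Prop where
  hN : 100 ≤ N
  hf : IsDiffeo f
  hs : SuppIn f (-12) (-47 / 4)
  hk : DB (stepK f N) 1 (1 / 100)
  hq : IsDiffeo q
  disp_q : disp q = fun x =>
    Real.smoothTransition (N * x) * ((stepK f N)⁻¹ (x + stepK f N 0) - x)
  hT : IsDiffeo T
  disp_T : disp T = fun x => (N : ℝ)⁻¹ * Real.smoothTransition (x + 14)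

/-- The remainder of the decomposition. -/
def stepG (f : Equiv.Perm ℝ) (N : ℕ) (q T : Equiv.Perm ℝ) : Equiv.Perm ℝ :=
  (stepK f N * q)⁻¹ * f * T * (stepK f N * q) * T⁻¹

namespace StepData

variable {f q T : Equiv.Perm ℝ} {N : ℕ}

theorem one_le (h : StepData f N q T) : 1 ≤ N := by have := h.hN; omega

theorem inv_pos (h : StepData f N q T) : 0 < (N : ℝ)⁻¹ := by
  have : (0 : ℝ) < N := by exact_mod_cast h.one_le
  positivity

theorem q_apply (h : StepData f N q T) (x : ℝ) : q x = x +
    Real.smoothTransition (N * x) * ((stepK f N)⁻¹ (x + stepK f N 0) - x) := by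
  rw [← congrFun h.disp_q x, disp]; ring

theorem q_of_le (h : StepData f N q T) {x : ℝ} (hx : x ≤ 0) : q x = x := by
  rw [h.q_apply, Real.smoothTransition.zero_of_nonpos
    (mul_nonpos_of_nonneg_of_nonpos (Nat.cast_nonneg _) hx)]
  ring

theorem a_of_le (h : StepData f N q T) {x : ℝ} (hx : x ≤ 0) :
    (stepK f N * q) x = stepK f N x := by
  rw [Equiv.Perm.mul_apply, h.q_of_le hx]

theorem a_of_ge (h : StepData f N q T) {x : ℝ} (hx : (N : ℝ)⁻¹ ≤ x) :
    (stepK f N * q) x = x + stepK f N 0 := by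
  have hN : (0 : ℝ) < N := by exact_mod_cast h.one_le
  have : 1 ≤ N * x := by
    rw [← mul_inv_cancel₀ hN.ne']; exact mul_le_mul_of_nonneg_left hx hN.le
  rw [Equiv.Perm.mul_apply, h.q_apply, Real.smoothTransition.one_of_one_le this, one_mul,
    add_sub_cancel, Equiv.Perm.inv_def, Equiv.apply_symm_apply]

theorem abs_alpha (h : StepData f N q T) : |stepK f N 0| ≤ 12 / 100 :=
  (abs_stepK_zero h.hf h.hs h.one_le h.hk).trans (by norm_num)

theorem a_isDiffeo (h : StepData f N q T) : IsDiffeo (stepK f N * q) := (h.hf.stepK N).mul h.hq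

theorem a_of_le' (h : StepData f N q T) {x : ℝ} (hx : x ≤ -12) : (stepK f N * q) x = x := by
  rw [h.a_of_le (by linarith), stepK_of_le h.hs h.one_le hx]

theorem T_apply (h : StepData f N q T) (x : ℝ) :
    T x = x + (N : ℝ)⁻¹ * Real.smoothTransition (x + 14) := by
  rw [← congrFun h.disp_T x, disp]; ring

theorem T_of_le (h : StepData f N q T) {x : ℝ} (hx : x ≤ -14) : T x = x := by
  rw [h.T_apply, Real.smoothTransition.zero_of_nonpos (by linarith)]; ring

theorem T_of_ge (h : StepData f N q T) {x : ℝ} (hx : -13 ≤ x) : T x = x + (N : ℝ)⁻¹ := by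
  rw [h.T_apply, Real.smoothTransition.one_of_one_le (by linarith)]; ring

theorem T_le (h : StepData f N q T) (x : ℝ) : T x ≤ x + (N : ℝ)⁻¹ := by
  rw [h.T_apply]; nlinarith [Real.smoothTransition.le_one (x + 14), h.inv_pos]

theorem T_inv_of_ge (h : StepData f N q T) {x : ℝ} (hx : -12 ≤ x) : T⁻¹ x = x - (N : ℝ)⁻¹ := by
  have := inv_natCast_le h.hN
  rw [Equiv.Perm.inv_eq_iff_eq, h.T_of_ge (by linarith)]; ring

theorem stepG_of_le (h : StepData f N q T) {x : ℝ} (hx : x ≤ 0) : stepG f N q T x = x := by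
  have hs := inv_natCast_le h.hN
  have hs0 := h.inv_pos
  obtain ⟨y, rfl⟩ := T.surjective x
  have hT : T⁻¹ (T y) = y := T.symm_apply_apply y
  rw [stepG, Equiv.Perm.mul_apply, hT, Equiv.Perm.mul_apply, Equiv.Perm.mul_apply,
    Equiv.Perm.mul_apply, Equiv.Perm.inv_eq_iff_eq]
  rcases le_total y (-13) with hy | hy
  · have := h.T_le y
    rw [h.a_of_le' (by linarith), h.a_of_le' (by linarith), h.hs _ (Or.inl (by linarith))]
  · have hTy := h.T_of_ge hy
    have hky : -13 ≤ stepK f N y := by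
      have := (h.hf.stepK N).2.2.monotone hy
      rwa [stepK_of_le h.hs h.one_le (by norm_num)] at this
    rw [h.a_of_le hx, h.a_of_le (by linarith), h.T_of_ge hky, hTy, stepK_shift h.hs (by linarith)]

theorem stepG_of_ge (h : StepData f N q T) {x : ℝ} (hx : 2 / (N : ℝ) ≤ x) :
    stepG f N q T x = x := by
  have hs := inv_natCast_le h.hN
  have hs0 := h.inv_pos
  have hα := abs_le.1 h.abs_alpha
  rw [div_eq_mul_inv] at hx
  rw [stepG, Equiv.Perm.mul_apply, h.T_inv_of_ge (by linarith), Equiv.Perm.mul_apply,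
    h.a_of_ge (by linarith), Equiv.Perm.mul_apply, h.T_of_ge (by linarith), Equiv.Perm.mul_apply,
    h.hs _ (Or.inr (by linarith)), Equiv.Perm.inv_eq_iff_eq, h.a_of_ge (by linarith)]
  ring

theorem suppIn_stepG (h : StepData f N q T) : SuppIn (stepG f N q T) 0 (2 / N) := fun _ hx =>
  hx.elim h.stepG_of_le h.stepG_of_ge

theorem stepG_isDiffeo (h : StepData f N q T) : IsDiffeo (stepG f N q T) :=
  (((h.a_isDiffeo.inv.mul h.hf).mul h.hT).mul h.a_isDiffeo).mul h.hT.inv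

theorem stepG_eq (h : StepData f N q T) {x : ℝ} (hx : x ∈ Ioo (-1) 1) : stepG f N q T x =
    (q⁻¹ * (affP 1 (N : ℝ)⁻¹ one_pos * q * (affP 1 (N : ℝ)⁻¹ one_pos)⁻¹)) x := by
  have hs := inv_natCast_le h.hN
  have hs0 := h.inv_pos
  have hα := abs_le.1 h.abs_alpha
  obtain ⟨hx1, hx2⟩ := hx
  have hlow : -2 ≤ q (x - (N : ℝ)⁻¹) := by
    have := h.hq.2.2.monotone (show -2 ≤ x - (N : ℝ)⁻¹ by linarith)
    rwa [h.q_of_le (by norm_num)] at this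
  have hhigh : q (x - (N : ℝ)⁻¹) ≤ 1 + 1 / 2 := by
    rw [← (h.hf.stepK N).2.2.le_iff_le, ← Equiv.Perm.mul_apply]
    have h1 := h.a_isDiffeo.2.2.monotone (show x - (N : ℝ)⁻¹ ≤ 1 by linarith)
    rw [h.a_of_ge (x := 1) (by linarith)] at h1
    have h2 := abs_le.1 (abs_stepK_sub_le h.hf h.hs h.one_le h.hk
      (show (-12 : ℝ) ≤ 1 + 1 / 2 by norm_num))
    linarith
  have hkq : -13 ≤ stepK f N (q (x - (N : ℝ)⁻¹)) := by
    have := (h.hf.stepK N).2.2.monotone (show -13 ≤ q (x - (N : ℝ)⁻¹) by linarith)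
    rwa [stepK_of_le h.hs h.one_le (by norm_num)] at this
  simp only [stepG, Equiv.Perm.mul_apply, mul_inv_rev, h.T_inv_of_ge (show -12 ≤ x by linarith),
    h.T_of_ge hkq, affP_apply, affP_inv_apply, one_mul, inv_one]
  rw [stepK_shift h.hs (by linarith), ← Equiv.Perm.mul_apply (stepK f N)⁻¹, inv_mul_cancel,
    Equiv.Perm.one_apply]

theorem mul_T_of_ge (h : StepData f N q T) {x : ℝ} (hx : 1 / 4 ≤ x) :
    (stepG f N q T * T) x = x + (N : ℝ)⁻¹ := by
  have hs := inv_natCast_le h.hN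
  rw [Equiv.Perm.mul_apply, h.T_of_ge (by linarith), h.stepG_of_ge]
  rw [div_eq_mul_inv]; linarith [h.inv_pos]

theorem a_of_ge' (h : StepData f N q T) {x : ℝ} (hx : 1 / 4 ≤ x) :
    (stepK f N * q) x = x + stepK f N 0 :=
  h.a_of_ge (by linarith [inv_natCast_le h.hN])

theorem abs_inv_le (h : StepData f N q T) : |(N : ℝ)⁻¹| ≤ 1 / 4 := by
  rw [abs_of_pos h.inv_pos]; linarith [inv_natCast_le h.hN]

theorem push_a_isDiffeo (h : StepData f N q T) : IsDiffeo (push (stepK f N * q)) :=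
  h.a_isDiffeo.push (h.abs_alpha.trans (by norm_num)) fun _ hy => h.a_of_ge' hy

theorem push_b_isDiffeo (h : StepData f N q T) : IsDiffeo (push (stepG f N q T * T)) :=
  (h.stepG_isDiffeo.mul h.hT).push h.abs_inv_le fun _ hy => h.mul_T_of_ge hy

theorem suppIn_push_a (h : StepData f N q T) : SuppIn (push (stepK f N * q)) (-14) 5 := by
  rintro x (hx | hx)
  · have := h.a_of_le' (show x ≤ -12 by linarith)
    rw [push_of_le (by linarith) (by linarith), this]
  · exact push_of_ge _ hx

theorem suppIn_push_b (h : StepData f N q T) : SuppIn (push (stepG f N q T * T)) (-14) 5 := by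
  rintro x (hx | hx)
  · have : (stepG f N q T * T) x = x := by
      rw [Equiv.Perm.mul_apply, h.T_of_le hx, h.stepG_of_le (by linarith)]
    rw [push_of_le (by linarith) (by linarith), this]
  · exact push_of_ge _ hx

end StepData

theorem push_eq_self {f : Equiv.Perm ℝ} (hf : IsDiffeo f) {c : ℝ} (hs : SuppIn f c 2) :
    push f = f := by
  ext x
  rcases le_total x 2 with hx | hx
  · have := hf.2.2.monotone hx
    rw [hs 2 (Or.inr le_rfl)] at this
    exact push_of_le hx this
  · rw [hs x (Or.inr hx)]
    rcases lt_or_ge x 5 with h5 | h5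
    · obtain ⟨y, rfl⟩ := exists_chart_eq h5
      have hy : 2 ≤ y := by
        rw [← chart_strictMono.le_iff_le, chart_of_le le_rfl]; exact hx
      rw [push_chart, hs y (Or.inr hy)]
    · exact push_of_ge _ h5

theorem StepData.eq_commutator_mul {f q T : Equiv.Perm ℝ} {N : ℕ} (h : StepData f N q T) :
    f = ⁅push (stepK f N * q), push (stepG f N q T * T)⁆ * stepG f N q T := by
  have h1 : ⁅stepK f N * q, stepG f N q T * T⁆ * stepG f N q T = f := by
    rw [commutatorElement_def, stepG]; group
  have hs := inv_natCast_le h.hN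
  have h2 := congrArg push h1
  rwa [map_mul, map_commutatorElement, push_eq_self h.hf (h.hs.mono le_rfl (by norm_num)),
    push_eq_self h.stepG_isDiffeo (h.suppIn_stepG.mono le_rfl (by
      rw [div_eq_mul_inv]; linarith)), eq_comm] at h2

/-- The correction that makes `stepK f N` a translation. -/
def stepP (f : Equiv.Perm ℝ) (N : ℕ) (x : ℝ) : ℝ := (stepK f N)⁻¹ (x + stepK f N 0) - x

theorem stepP_eq (f : Equiv.Perm ℝ) (N : ℕ) :
    stepP f N = fun x => disp (stepK f N)⁻¹ (x + stepK f N 0) + stepK f N 0 := by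
  ext x; simp only [stepP, disp]; ring

theorem stepP_zero (f : Equiv.Perm ℝ) (N : ℕ) : stepP f N 0 = 0 := by
  rw [stepP, zero_add, Equiv.Perm.inv_def, Equiv.symm_apply_apply, sub_zero]

theorem contDiff_stepP {f : Equiv.Perm ℝ} (hf : IsDiffeo f) (N : ℕ) :
    ContDiff ℝ (⊤ : ℕ∞) (stepP f N) :=
  ((hf.stepK N).inv.1.comp (contDiff_id.add contDiff_const)).sub contDiff_id

theorem stepP_bound {f : Equiv.Perm ℝ} (hf : IsDiffeo f) {N R : ℕ} (hR : R ≠ 0) {B : ℝ}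
    (hB : DB (stepK f N)⁻¹ R B) (x : ℝ) : |iteratedDeriv R (stepP f N) x| ≤ B := by
  have hc : ContDiff ℝ (⊤ : ℕ∞) fun x => disp (stepK f N)⁻¹ (x + stepK f N 0) :=
    (hf.stepK N).inv.contDiff_disp.comp (contDiff_id.add contDiff_const)
  rw [stepP_eq, iteratedDeriv_fun_add_smooth hc contDiff_const, iteratedDeriv_comp_add_const,
    iteratedDeriv_const, if_neg hR, add_zero]
  exact hB _

theorem disp_T_bound (c : ℝ) {N : ℝ} (hN : 0 < N) (R : ℕ) {X : ℝ}
    (hX : ∀ y, |iteratedDeriv R Real.smoothTransition y| ≤ X) (x : ℝ) :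
    |iteratedDeriv R (fun x => N⁻¹ * Real.smoothTransition (x + c)) x| ≤ X * N⁻¹ := by
  rw [iteratedDeriv_const_mul_field, iteratedDeriv_comp_add_const, abs_mul,
    abs_of_pos (inv_pos.2 hN), mul_comm]
  exact mul_le_mul_of_nonneg_right (hX _) (inv_pos.2 hN).le

theorem exists_stepData : ∃ C : ℝ, 1 ≤ C ∧ ∀ (N : ℕ) (f : Equiv.Perm ℝ) (β : ℝ), 0 < β →
    IsDiffeo f → SuppIn f (-12) (-47 / 4) → DB f 1 β → C * (N * β) ≤ 1 → C ≤ N →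
    ∃ q T, StepData f N q T := by
  obtain ⟨C₁, hC₁, h₁⟩ := stepK_bound 2 le_rfl
  obtain ⟨C₂, hC₂, h₂⟩ := cutoff_bound 1
  obtain ⟨X, hX1, hX⟩ := exists_smoothTransition_bound 1
  have h12 : C₁ ≤ C₁ * C₂ := le_mul_of_one_le_right (by linarith) hC₂
  refine ⟨100 * (C₁ * C₂) + 2 * X, by linarith, fun N f β hβ hf hs hb hle hN => ?_⟩
  have hN' : (100 : ℝ) ≤ N := by linarith
  have hN'' : 100 ≤ N := by exact_mod_cast hN'
  have hNβ : 0 < N * β := by positivity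
  have hle' : C₁ * C₂ * (N * β) ≤ 1 / 100 := by nlinarith
  have hle'' : C₁ * (N * β) ≤ C₁ * C₂ * (N * β) := by gcongr
  obtain ⟨m, hm0, hm⟩ := hs.exists_DB hf 2
  obtain ⟨hk, -, hk', -⟩ := h₁ N f β (m + 1) (by omega) hβ (by linarith) hf hb
    (hm.mono (by linarith)) (by linarith)
  have hk100 : DB (stepK f N) 1 (1 / 100) := hk.mono (by linarith)
  obtain ⟨q, hq, hq'⟩ := exists_diffeo_of_disp (smooth_cutoff N (contDiff_stepP hf N))
    (fun x => by
      have := h₂ N (by linarith) _ (contDiff_stepP hf N) (stepP_zero f N)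
        (stepK_inv_periodic hf hs hN'' hk100) _ (stepP_bound hf one_ne_zero hk') x
      rw [iteratedDeriv_one] at this
      linarith)
  obtain ⟨T, hT, hT'⟩ := exists_diffeo_of_disp (v := fun x => (N : ℝ)⁻¹ *
      Real.smoothTransition (x + 14))
    (contDiff_const.mul (Real.smoothTransition.contDiff.comp (contDiff_id.add contDiff_const)))
    (fun x => by
      have h := disp_T_bound 14 (by linarith : (0 : ℝ) < N) 1 hX x
      rw [iteratedDeriv_one] at h
      refine h.trans ?_
      rw [mul_inv_le_iff₀ (by linarith)]
      nlinarith)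
  exact ⟨q, T, hN'', hf, hs, hk100, hq, hq', hT, hT'⟩

theorem step_bounds (R : ℕ) (hR : 2 ≤ R) : ∃ C : ℝ, 1 ≤ C ∧ ∀ (N : ℕ) (f q T : Equiv.Perm ℝ)
    (β m : ℝ), StepData f N q T → 0 < β → 0 < m → DB f 1 β → DB f R m → C * (N * β) ≤ 1 → C ≤ N →
    DB (stepG f N q T) R (C * (N * m)) ∧ DB (push (stepK f N * q)) R (C * (N * m + N * β)) ∧
      DB (push (stepG f N q T * T)) R (C * (N * m + (N : ℝ)⁻¹)) := by
  obtain ⟨C₁, hC₁, h₁⟩ := stepK_bound R hR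
  obtain ⟨C₂, hC₂, h₂⟩ := cutoff_bound R
  obtain ⟨C₂', hC₂', h₂'⟩ := cutoff_bound 1
  obtain ⟨C₃, hC₃, h₃⟩ := inv_bound R hR
  obtain ⟨C₄, hC₄, h₄⟩ := comp_bound R hR
  obtain ⟨C₅, hC₅, h₅⟩ := push_translation_bound R
  obtain ⟨X₁, hX₁, hX₁'⟩ := exists_smoothTransition_bound 1
  obtain ⟨X₂, hX₂, hX₂'⟩ := exists_smoothTransition_bound R
  set X := X₁ + X₂
  set D := C₂ + C₂'
  set E₂ := D * C₁ with hE₂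
  set E₃ := C₃ * E₂ with hE₃
  set E₄ := C₄ * 2 * E₃ with hE₄
  have e1 : C₁ ≤ E₂ := le_mul_of_one_le_left (by linarith) (by linarith)
  have e2 : E₂ ≤ E₃ := le_mul_of_one_le_left (by linarith) hC₃
  have e3 : C₄ * 2 * E₂ ≤ E₄ := mul_le_mul_of_nonneg_left e2 (by linarith)
  have e4 : E₃ ≤ E₄ := le_mul_of_one_le_left (by linarith) (by linarith)
  have e5 : E₄ ≤ C₄ * 2 * E₄ := le_mul_of_one_le_left (by linarith) (by linarith)
  have e6 : X ≤ C₄ * 2 * X := le_mul_of_one_le_left (by linarith) (by linarith)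
  have e7 : C₁ ≤ C₁ * C₅ := le_mul_of_one_le_right (by linarith) hC₅
  set C := C₄ * 2 * E₄ * 2 + C₄ * 2 * X * 2 + 12 * (C₁ * C₅) + C₅ with hC
  have c1 : C₄ * 2 * E₄ * 2 ≤ C := by linarith
  have c2 : C₄ * 2 * X * 2 ≤ C := by linarith
  have c3 : 12 * (C₁ * C₅) ≤ C := by linarith
  have c4 : C₅ ≤ C := by linarith
  refine ⟨C, by linarith, fun N f q T β m h hβ hm hf1 hfR hle hCN => ?_⟩
  have hN0 : (0 : ℝ) < N := by linarith
  have hi : 0 < (N : ℝ)⁻¹ := inv_pos.2 hN0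
  obtain ⟨b, hb⟩ : ∃ b, b = N * β := ⟨_, rfl⟩
  obtain ⟨M, hM⟩ : ∃ M, M = N * m := ⟨_, rfl⟩
  have hb0 : 0 < b := hb ▸ by positivity
  have hM0 : 0 < M := hM ▸ by positivity
  have small : ∀ c, c ≤ C → c * b ≤ 1 := fun c hc => by
    rw [← hb] at hle
    exact (mul_le_mul_of_nonneg_right hc hb0.le).trans hle
  have hk := h₁ N f β m h.one_le hβ hm h.hf hf1 hfR (by rw [← hb]; exact small _ (by linarith))
  rw [← hb, ← hM] at hk
  obtain ⟨hk1, hkR, hk1', hkR'⟩ := hk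
  have hq1 : DB q 1 (E₂ * b) := fun x => by
    have := h₂' N hN0 _ (contDiff_stepP h.hf N) (stepP_zero f N)
      (stepK_inv_periodic h.hf h.hs h.hN h.hk) _ (stepP_bound h.hf one_ne_zero hk1') x
    rw [h.disp_q]
    refine this.trans ?_
    rw [hE₂, ← mul_assoc]
    gcongr
    linarith
  have hqR : DB q R (E₂ * M) := fun x => by
    have := h₂ N hN0 _ (contDiff_stepP h.hf N) (stepP_zero f N)
      (stepK_inv_periodic h.hf h.hs h.hN h.hk) _ (stepP_bound h.hf (by omega) hkR') x
    rw [h.disp_q]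
    refine this.trans ?_
    rw [hE₂, ← mul_assoc]
    gcongr
    linarith
  have hE₂0 : 0 < E₂ := by linarith
  have hE₃0 : 0 < E₃ := by linarith
  have hE₄0 : 0 < E₄ := by linarith
  have hX0 : 0 < X := by linarith
  have ha : DB (stepK f N * q) R (C₄ * 2 * (E₂ * M)) := by
    have := (h₄ (E₂ * b) (E₂ * M) (by positivity) (by positivity) [stepK f N, q]
      (by
        simp only [List.mem_cons, List.not_mem_nil, or_false]
        rintro p (rfl | rfl)
        · exact ⟨h.hf.stepK N, hk1.mono (by gcongr), hkR.mono (by gcongr)⟩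
        · exact ⟨h.hq, hq1, hqR⟩)
      (by have := small (C₄ * 2 * E₂) (by linarith); simpa [← mul_assoc] using this)).2
    simpa using this
  obtain ⟨hqi1, hqiR⟩ := h₃ (E₂ * b) (E₂ * M) (by positivity) (by positivity) q h.hq hq1 hqR
    (by have := small E₃ (by linarith); rwa [hE₃, mul_assoc] at this)
  rw [← mul_assoc, ← hE₃] at hqi1 hqiR
  have hg' := h₄ (E₃ * b) (E₃ * M) (by positivity) (by positivity)
    [q⁻¹, affP 1 (N : ℝ)⁻¹ one_pos * q * (affP 1 (N : ℝ)⁻¹ one_pos)⁻¹]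
    (by
      simp only [List.mem_cons, List.not_mem_nil, or_false]
      rintro p (rfl | rfl)
      · exact ⟨h.hq.inv, hqi1, hqiR⟩
      · refine ⟨h.hq.conj_affP _ _ _, (hq1.conj_affP h.hq _ _ _).mono ?_,
          (hqR.conj_affP h.hq _ _ _).mono ?_⟩ <;> simp only [inv_one, one_pow, one_mul] <;> gcongr)
    (by have := small E₄ (by linarith); simpa [hE₄, ← mul_assoc] using this)
  simp only [List.length_cons, List.length_nil, List.prod_cons, List.prod_nil, mul_one, zero_add,
    Nat.reduceAdd, Nat.cast_ofNat, ← mul_assoc (C₄ * 2), ← hE₄] at hg'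
  have hgtrans : ∀ (j : ℕ) (m' : ℝ), 0 ≤ m' →
      DB (q⁻¹ * (affP 1 (N : ℝ)⁻¹ one_pos * q * (affP 1 (N : ℝ)⁻¹ one_pos)⁻¹)) j m' →
      DB (stepG f N q T) j m' := fun j m' hm' hd x => by
    by_cases hx : x ≤ 0 ∨ 2 / (N : ℝ) ≤ x
    · rw [h.suppIn_stepG.iteratedDeriv_eq_zero h.stepG_isDiffeo j hx, abs_zero]
      exact hm'
    · push Not at hx
      have hs := inv_natCast_le h.hN
      rw [div_eq_mul_inv] at hx
      have : EqOn (disp (stepG f N q T)) (disp (q⁻¹ * (affP 1 (N : ℝ)⁻¹ one_pos * q *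
          (affP 1 (N : ℝ)⁻¹ one_pos)⁻¹))) (Ioo (-1) 1) := fun y hy => by
        rw [disp, disp, h.stepG_eq hy]
      rw [this.iteratedDeriv_of_isOpen isOpen_Ioo j ⟨by linarith, by linarith⟩]
      exact hd x
  have hg1 := hgtrans _ _ (by positivity) hg'.1
  have hgR := hgtrans _ _ (by positivity) hg'.2
  have hT1 : DB T 1 (X * (N : ℝ)⁻¹) := fun x => by
    rw [h.disp_T]
    refine (disp_T_bound 14 hN0 1 hX₁' x).trans ?_
    gcongr; linarith
  have hTR : DB T R (X * (N : ℝ)⁻¹) := fun x => by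
    rw [h.disp_T]
    refine (disp_T_bound 14 hN0 R hX₂' x).trans ?_
    gcongr; linarith
  have hXN : C₄ * 2 * X * (N : ℝ)⁻¹ * 2 ≤ 1 := by
    have : C₄ * 2 * X * 2 * (N : ℝ)⁻¹ ≤ N * (N : ℝ)⁻¹ := by gcongr; linarith
    rw [mul_inv_cancel₀ hN0.ne'] at this
    linarith
  have hbb : DB (stepG f N q T * T) R (C₄ * 2 * (E₄ * M + X * (N : ℝ)⁻¹)) := by
    have := (h₄ (E₄ * b + X * (N : ℝ)⁻¹) (E₄ * M + X * (N : ℝ)⁻¹) (by positivity) (by positivity)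
      [stepG f N q T, T]
      (by
        have : 0 < X * (N : ℝ)⁻¹ := by positivity
        have : 0 < E₄ * b := by positivity
        have : 0 < E₄ * M := by positivity
        simp only [List.mem_cons, List.not_mem_nil, or_false]
        rintro p (rfl | rfl)
        · exact ⟨h.stepG_isDiffeo, hg1.mono (by linarith), hgR.mono (by linarith)⟩
        · exact ⟨h.hT, hT1.mono (by linarith), hTR.mono (by linarith)⟩)
      (by
        have := small (C₄ * 2 * E₄ * 2) c1
        simp only [List.length_cons, List.length_nil, zero_add, Nat.reduceAdd, Nat.cast_ofNat]
        linarith)).2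
    simpa using this
  rw [← hb, ← hM]
  have hMb : 0 < M + b := by positivity
  refine ⟨hgR.mono (by gcongr; linarith), ?_, ?_⟩
  · refine push_DB h.a_isDiffeo (h.abs_alpha.trans (by norm_num)) (fun _ hy => h.a_of_ge' hy)
      (fun x _ => (ha x).trans ?_)
      fun x hx => (h₅ _ _ (h.abs_alpha.trans (by norm_num)) hx).trans ?_
    · rw [← mul_assoc]
      have : C₄ * 2 * E₂ ≤ C := by linarith
      calc C₄ * 2 * E₂ * M ≤ C * M := by gcongr
        _ ≤ C * (M + b) := by gcongr; linarith
    · have h1 := abs_stepK_zero h.hf h.hs h.one_le hk1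
      calc C₅ * |stepK f N 0| ≤ C₅ * (12 * (C₁ * b)) := by gcongr
        _ = 12 * (C₁ * C₅) * b := by ring
        _ ≤ C * b := by gcongr
        _ ≤ C * (M + b) := by gcongr; linarith
  · refine push_DB (h.stepG_isDiffeo.mul h.hT) h.abs_inv_le (fun _ hy => h.mul_T_of_ge hy)
      (fun x _ => (hbb x).trans ?_) fun x hx => (h₅ _ _ h.abs_inv_le hx).trans ?_
    · have a1 : C₄ * 2 * E₄ ≤ C := by linarith
      have a2 : C₄ * 2 * X ≤ C := by linarith
      calc C₄ * 2 * (E₄ * M + X * (N : ℝ)⁻¹) = C₄ * 2 * E₄ * M + C₄ * 2 * X * (N : ℝ)⁻¹ := by ring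
        _ ≤ C * M + C * (N : ℝ)⁻¹ := by gcongr
        _ = _ := by ring
    · rw [abs_of_pos hi]
      have : 0 ≤ C := by linarith
      gcongr
      linarith

/-- `f` is the commutator of `a` and `b` up to a diffeomorphism `g` that is `C N`-times larger but
is concentrated on an interval of length `2 / N`. -/
structure IsStep (C : ℕ → ℝ) (N : ℕ) (f a b g : Equiv.Perm ℝ) : Prop where
  a_isDiffeo : IsDiffeo a
  b_isDiffeo : IsDiffeo b
  g_isDiffeo : IsDiffeo g
  suppIn_a : SuppIn a (-14) 5
  suppIn_b : SuppIn b (-14) 5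
  suppIn_g : SuppIn g 0 (2 / N)
  eq : f = ⁅a, b⁆ * g
  bounds : ∀ R, 2 ≤ R → ∀ β m : ℝ, 0 < β → 0 < m → DB f 1 β → DB f R m → C R * (N * β) ≤ 1 →
    C R ≤ N → DB g R (C R * (N * m)) ∧ DB a R (C R * (N * m + N * β)) ∧
      DB b R (C R * (N * m + (N : ℝ)⁻¹))

theorem exists_step : ∃ C : ℕ → ℝ, (∀ R, 1 ≤ C R) ∧ ∀ (N : ℕ) (f : Equiv.Perm ℝ), ∃ a b g,
    ∀ β : ℝ, 0 < β → IsDiffeo f → SuppIn f (-12) (-47 / 4) → DB f 1 β → C 0 * (N * β) ≤ 1 →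
      C 0 ≤ N → IsStep C N f a b g := by
  obtain ⟨C₀, hC₀, h₀⟩ := exists_stepData
  choose C₁ hC₁ h₁ using step_bounds
  set C : ℕ → ℝ := fun R => if h : 2 ≤ R then C₁ R h else C₀ with hC
  have hC0 : C 0 = C₀ := by simp [hC]
  have hCR : ∀ R (h : 2 ≤ R), C R = C₁ R h := fun R h => by simp [hC, h]
  refine ⟨C, fun R => ?_, fun N f => ?_⟩
  · by_cases h : 2 ≤ R
    · rw [hCR R h]; exact hC₁ R h
    · simpa [hC, h] using hC₀
  · by_cases h : ∃ q T, StepData f N q T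
    · obtain ⟨q, T, h⟩ := h
      refine ⟨push (stepK f N * q), push (stepG f N q T * T), stepG f N q T, fun _ _ _ _ _ _ _ =>
        ⟨h.push_a_isDiffeo, h.push_b_isDiffeo, h.stepG_isDiffeo, h.suppIn_push_a, h.suppIn_push_b,
          h.suppIn_stepG, h.eq_commutator_mul, fun R hR β m hβ hm h1 h2 h3 h4 => ?_⟩⟩
      rw [hCR R hR] at *
      exact h₁ R hR N f q T β m h hβ hm h1 h2 h3 h4
    · refine ⟨1, 1, 1, fun β hβ hf hs h1 h2 h3 => absurd ?_ h⟩
      rw [hC0] at *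
      exact h₀ N f β hβ hf hs h1 h2 h3

/-- The rescaling that moves the remainder of a decomposition step back into position. -/
def rescale : Equiv.Perm ℝ := affP 2 (-12) two_pos

theorem SuppIn.conj_rescale {g : Equiv.Perm ℝ} {N : ℕ} (hs : SuppIn g 0 (2 / N)) :
    SuppIn (rescale * g * rescale⁻¹) (-12) (-12 + 4 / N) := by
  have := hs.conj_affP 2 (-12) two_pos
  rwa [mul_zero, zero_add, mul_div_assoc', add_comm, show (2 : ℝ) * 2 = 4 by norm_num] at this

theorem DB.conj_rescale {g : Equiv.Perm ℝ} {R : ℕ} {m : ℝ} (hm : DB g R m) (hg : IsDiffeo g)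
    (hR : 1 ≤ R) (hm0 : 0 ≤ m) : DB (rescale * g * rescale⁻¹) R m := by
  refine (hm.conj_affP hg 2 (-12) two_pos).mono ?_
  obtain ⟨R, rfl⟩ := Nat.exists_eq_add_of_le' hR
  rw [pow_succ', ← mul_assoc, mul_inv_cancel₀ two_ne_zero, one_mul]
  exact mul_le_of_le_one_left hm0 (pow_le_one₀ (by norm_num) (by norm_num))

/-- A sequence of decomposition steps along a sequence of squared scales. -/
structure IsStepSeq (C : ℕ → ℝ) (N : ℕ → ℕ) (f a b g : ℕ → Equiv.Perm ℝ) : Prop where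
  scale_succ : ∀ k, N (k + 1) = N k ^ 2
  step : ∀ k, IsStep C (N k) (f k) (a k) (b k) (g k)
  succ : ∀ k, f (k + 1) = rescale * g k * rescale⁻¹

theorem IsStep.le_of_le {C : ℕ → ℝ} {N R : ℕ} {f a b g : Equiv.Perm ℝ}
    (h : IsStep C N f a b g) (hR : 2 ≤ R) {β D : ℝ} (hβ : 0 < β) (h1 : DB f 1 β)
    (h2 : DB f R β) (hC : C R ≤ D) (h3 : D * (N * β) ≤ 1) (h4 : D ≤ N) :
    DB a R (D * (2 * (N * β))) ∧ DB b R (D * (N * β + (N : ℝ)⁻¹)) := by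
  obtain ⟨-, ha, hb⟩ := h.bounds R hR β β hβ hβ h1 h2
    ((mul_le_mul_of_nonneg_right hC (by positivity)).trans h3) (hC.trans h4)
  refine ⟨ha.mono ?_, hb.mono ?_⟩
  · rw [two_mul]; gcongr
  · gcongr

theorem IsStep.next_le {C : ℕ → ℝ} {N R : ℕ} {f a b g : Equiv.Perm ℝ}
    (h : IsStep C N f a b g) (hR : 2 ≤ R) {β m D : ℝ} (hβ : 0 < β) (hm : 0 < m) (h1 : DB f 1 β)
    (h2 : DB f R m) (hC0 : 0 ≤ D) (hC : C R ≤ D) (h3 : D * (N * β) ≤ 1) (h4 : D ≤ N) :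
    DB (rescale * g * rescale⁻¹) R (D * (N * m)) := by
  obtain ⟨hg, -, -⟩ := h.bounds R hR β m hβ hm h1 h2
    ((mul_le_mul_of_nonneg_right hC (by positivity)).trans h3) (hC.trans h4)
  exact (hg.mono (by gcongr)).conj_rescale h.g_isDiffeo (by omega) (by positivity)

/-- The high order bound turns into a decaying low order bound, because of the small support. -/
theorem IsStep.next_lower {C : ℕ → ℝ} {N L i : ℕ} {f a b g : Equiv.Perm ℝ}
    (h : IsStep C N f a b g) (hN : 4 ≤ N) (hi : i + 8 ≤ L) {m : ℝ} (hm : 0 ≤ m)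
    (hL : DB (rescale * g * rescale⁻¹) L m) :
    DB (rescale * g * rescale⁻¹) i ((4 / N) ^ 8 * m) := by
  obtain ⟨d, rfl⟩ := Nat.exists_eq_add_of_le hi
  have hN' : (4 : ℝ) ≤ N := by exact_mod_cast hN
  have h4 : (4 : ℝ) / N ≤ 1 := (div_le_one (by linarith)).2 hN'
  have h4' : (0 : ℝ) ≤ 4 / N := by positivity
  have hd : IsDiffeo (rescale * g * rescale⁻¹) := h.g_isDiffeo.conj_affP 2 (-12) two_pos
  refine (h.suppIn_g.conj_rescale.DB_lower hd (by linarith) hm i (8 + d)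
    (by rwa [← add_assoc])).mono ?_
  rw [show -12 + 4 / (N : ℝ) - -12 = 4 / N by ring]
  exact mul_le_mul_of_nonneg_right (pow_le_pow_of_le_one h4' h4 (by omega)) hm

/-- A sequence that is squared at every step beats every geometric sequence. -/
theorem eventually_geometric_le {N : ℕ → ℕ} (h0 : 2 ≤ N 0) (hN : ∀ k, N (k + 1) = N k ^ 2)
    (K x : ℝ) (hx : 0 ≤ x) : ∀ᶠ k in atTop, K * x ^ (k + 1) ≤ N k := by
  have h1 : ∀ k, N k = N 0 ^ 2 ^ k := fun k => by
    induction k with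
    | zero => simp
    | succ k ih => rw [hN, ih, ← pow_mul, pow_succ]
  obtain ⟨t, ht⟩ := pow_unbounded_of_one_lt (max K x) (one_lt_two (α := ℝ))
  have h2 := tendsto_pow_const_div_const_pow_of_one_lt 1 (one_lt_two (α := ℝ))
  have h3 := h2.eventually (gt_mem_nhds (show (0 : ℝ) < 1 / (3 * t + 1) by positivity))
  filter_upwards [h3, eventually_ge_atTop 1] with k hk hk1
  have hk' : t * (k + 2) ≤ 2 ^ k := by
    rw [pow_one, div_lt_div_iff₀ (by positivity) (by positivity)] at hk
    have hk1' : (1 : ℝ) ≤ k := by exact_mod_cast hk1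
    have : (t : ℝ) * (k + 2) ≤ 2 ^ k := by nlinarith [Nat.cast_nonneg (α := ℝ) t]
    exact_mod_cast this
  have hK : K ≤ 2 ^ t := (le_max_left _ _).trans ht.le
  have hx' : x ≤ 2 ^ t := (le_max_right _ _).trans ht.le
  calc K * x ^ (k + 1) ≤ 2 ^ t * (2 ^ t) ^ (k + 1) := by gcongr
    _ = 2 ^ (t * (k + 2)) := by rw [← pow_mul, ← pow_add]; congr 1; ring
    _ ≤ 2 ^ 2 ^ k := pow_le_pow_right₀ one_le_two hk'
    _ ≤ (N 0 : ℝ) ^ 2 ^ k := by gcongr; exact_mod_cast h0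
    _ = N k := by rw [h1 k]; push_cast; rfl

namespace IsStepSeq

variable {C : ℕ → ℝ} {N : ℕ → ℕ} {f a b g : ℕ → Equiv.Perm ℝ}

theorem eventually_le (h : IsStepSeq C N f a b g) (hC : ∀ R, 1 ≤ C R) (h0 : 2 ≤ N 0)
    (hf : ∀ k, IsDiffeo (f k)) (hs : ∀ k, SuppIn (f k) (-12) (-47 / 4)) {β : ℕ → ℝ}
    (hβ : ∀ k, 0 < β k) (hfβ : ∀ k, DB (f k) 1 (β k))
    (hβN : ∀ D : ℝ, ∀ᶠ k in atTop, D * (N k * β k) ≤ 1) (j : ℕ) (Λ : ℝ) (hΛ : 0 < Λ) :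
    ∀ᶠ k in atTop, DB (a k) j (Λ ^ k) ∧ DB (b k) j (Λ ^ k) := by
  have hgrow := eventually_geometric_le h0 h.scale_succ
  set R := j + 2 with hR
  set L := R + 8 with hL
  set D := C R + C L with hD
  have hCR := hC R
  have hCL := hC L
  obtain ⟨k₀, hk₀⟩ := eventually_atTop.1 ((hβN D).and (hgrow D 1 zero_le_one))
  simp only [one_pow, mul_one] at hk₀
  obtain ⟨A', hA'0, hA'⟩ := (hs k₀).exists_DB (hf k₀) L
  set A := A' + 1 with hA
  have hN1 : ∀ k, k₀ ≤ k → (1 : ℝ) ≤ N k := fun k hk => by linarith [(hk₀ k hk).2]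
  have hhigh : ∀ k, k₀ ≤ k → DB (f k) L (A * D ^ k * N k) := by
    intro k hk
    induction k, hk using Nat.le_induction with
    | base =>
      refine hA'.mono ?_
      have h1 : 1 ≤ D ^ k₀ := one_le_pow₀ (by linarith)
      have h2 := hN1 k₀ le_rfl
      calc A' ≤ A * 1 * 1 := by linarith
        _ ≤ A * D ^ k₀ * N k₀ := by gcongr
    | succ k hk ih =>
      have hN := hN1 k hk
      have := (h.step k).next_le (by omega) (hβ k) (by positivity) (hfβ k) ih (by linarith)
        (show C L ≤ D by linarith) (hk₀ k hk).1 (hk₀ k hk).2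
      rw [← h.succ] at this
      refine this.mono (le_of_eq ?_)
      rw [h.scale_succ]
      push_cast
      ring
  have key : ∀ᶠ k in atTop, DB (a (k + 1)) j (Λ ^ (k + 1)) ∧ DB (b (k + 1)) j (Λ ^ (k + 1)) := by
    filter_upwards [eventually_ge_atTop k₀, hgrow 4 1 zero_le_one,
      hgrow (4 ^ 8 * A) D (by linarith), hgrow (19 ^ 2 * (2 * D)) Λ⁻¹ (by positivity),
      (tendsto_add_atTop_nat 1).eventually (hgrow D 1 zero_le_one), hgrow D 1 zero_le_one]
      with k hk h4 hm hΛk hDN hDNk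
    simp only [one_pow, mul_one] at h4 hDN hDNk
    have hN0 : (0 : ℝ) < N k := by linarith
    set m : ℝ := (4 / N k) ^ 8 * (A * D ^ (k + 1) * N (k + 1)) with hmdef
    have hNs : (N (k + 1) : ℝ) = (N k : ℝ) ^ 2 := by rw [h.scale_succ]; push_cast; rfl
    have hNm : N (k + 1) * m ≤ ((N k : ℝ) ^ 3)⁻¹ := by
      have : N (k + 1) * m = (4 ^ 8 * A * D ^ (k + 1)) / N k ^ 4 := by
        rw [hmdef, hNs]; field_simp
      rw [this, div_le_iff₀ (by positivity)]
      refine hm.trans (le_of_eq ?_)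
      field_simp
    have hm0 : 0 < m := by
      have : (0 : ℝ) < N (k + 1) := by rw [hNs]; positivity
      positivity
    have hlow : ∀ i, i ≤ R → DB (f (k + 1)) i m := fun i hi => by
      rw [h.succ]
      exact (h.step k).next_lower (L := L) (by exact_mod_cast h4) (by omega) (by positivity)
        (by rw [← h.succ]; exact hhigh (k + 1) (by omega))
    have h3 : ((N k : ℝ) ^ 3)⁻¹ ≤ (N k : ℝ)⁻¹ := by
      gcongr
      exact le_self_pow₀ (by linarith) (by norm_num)
    have h2 : (N (k + 1) : ℝ)⁻¹ ≤ (N k : ℝ)⁻¹ := by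
      rw [hNs]
      gcongr
      exact le_self_pow₀ (by linarith) (by norm_num)
    obtain ⟨ha, hb⟩ := (h.step (k + 1)).le_of_le (show 2 ≤ R by omega) hm0
      (hlow 1 (by omega)) (hlow R le_rfl) (show C R ≤ D by linarith)
      (by
        calc D * (N (k + 1) * m) ≤ N k * (N k : ℝ)⁻¹ := by gcongr; exact hNm.trans h3
          _ = 1 := mul_inv_cancel₀ hN0.ne') hDN
    have hfin : (5 - (-14 : ℝ)) ^ 2 * (D * (2 * (N k : ℝ)⁻¹)) ≤ Λ ^ (k + 1) := by
      rw [inv_pow, ← div_eq_mul_inv, div_le_iff₀ (by positivity)] at hΛk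
      calc (5 - (-14 : ℝ)) ^ 2 * (D * (2 * (N k : ℝ)⁻¹))
          = (19 ^ 2 * (2 * D)) * (N k : ℝ)⁻¹ := by ring
        _ ≤ N k * Λ ^ (k + 1) * (N k : ℝ)⁻¹ := by gcongr
        _ = Λ ^ (k + 1) := by field_simp
    have hD0 : 0 ≤ D := by linarith
    have hmk := hNm.trans h3
    refine ⟨((h.step (k + 1)).suppIn_a.DB_lower (h.step (k + 1)).a_isDiffeo (by norm_num)
        (by positivity) j 2 ha).mono (le_trans ?_ hfin),
      ((h.step (k + 1)).suppIn_b.DB_lower (h.step (k + 1)).b_isDiffeo (by norm_num)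
        (by positivity) j 2 hb).mono (le_trans ?_ hfin)⟩
    · gcongr
    · gcongr
      linarith
  exact (eventually_atTop.2 ⟨(eventually_atTop.1 key).choose + 1, fun k hk => by
    obtain ⟨k, rfl⟩ := Nat.exists_eq_add_of_le' (show 1 ≤ k by omega)
    exact (eventually_atTop.1 key).choose_spec k (by omega)⟩)

end IsStepSeq

theorem exists_stepSeq (r : ℕ) {η : ℝ} (hη : 0 < η) : ∃ (R : ℕ) (ε : ℝ), 1 ≤ R ∧ 0 < ε ∧
    ∀ f, IsDiffeo f → SuppIn f (-12) (-47 / 4) → DB f R ε →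
      ∃ (C : ℕ → ℝ) (N : ℕ → ℕ) (F a b g : ℕ → Equiv.Perm ℝ), IsStepSeq C N F a b g ∧ F 0 = f ∧
        (∀ k, IsDiffeo (F k)) ∧ (∀ k, SuppIn (F k) (-12) (-47 / 4)) ∧
        (∀ k, ∀ j ≤ r + 2, DB (a k) j (η / (2 ^ (r + 2)) ^ k) ∧
          DB (b k) j (η / (2 ^ (r + 2)) ^ k)) ∧
        ∀ j Λ, 0 < Λ → ∀ᶠ k in atTop, DB (a k) j (Λ ^ k) ∧ DB (b k) j (Λ ^ k) := by
  obtain ⟨C, hC, hstep⟩ := exists_step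
  choose a b g hstep using hstep
  set r' := r + 2 with hr'
  set L := r' + 8 with hL
  set Q : ℝ := 2 ^ r' with hQ
  set D := C 0 + C r' + C L with hD
  have hC0 := hC 0
  have hCr := hC r'
  have hCL := hC L
  have hD1 : 1 ≤ D := by linarith
  have hQ1 : 1 ≤ Q := one_le_pow₀ one_le_two
  set δ := min 1 (η / (2 * 19 ^ r')) with hδ
  have hδ0 : 0 < δ := by positivity
  have hδ1 : δ ≤ 1 := min_le_left _ _
  have hδη : 2 * 19 ^ r' * δ ≤ η := by
    have := min_le_right 1 (η / (2 * 19 ^ r'))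
    rwa [← hδ, le_div_iff₀ (by positivity), mul_comm] at this
  obtain ⟨N₀, hN₀⟩ := exists_nat_ge (4 ^ 8 + D * Q / δ)
  have hDQ : D * Q ≤ D * Q / δ := le_div_self (by positivity) hδ0 hδ1
  have hDDQ : D ≤ D * Q := le_mul_of_one_le_right (by linarith) hQ1
  have hQDQ : Q ≤ D * Q := le_mul_of_one_le_left (by linarith) hD1
  have hN₀4 : (4 : ℝ) ^ 8 ≤ N₀ := by linarith
  have hN₀1 : (1 : ℝ) ≤ N₀ := by linarith
  have hN₀0 : (0 : ℝ) < N₀ := by linarith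
  set N : ℕ → ℕ := fun k => N₀ ^ 2 ^ k with hN
  have hNs : ∀ k, N (k + 1) = N k ^ 2 := fun k => by
    simp only [hN]; rw [← pow_mul, pow_succ]
  have hNge : ∀ k, (N₀ : ℝ) ^ (k + 1) ≤ N k := fun k => by
    simp only [hN, Nat.cast_pow]
    exact pow_le_pow_right₀ hN₀1 Nat.lt_two_pow_self
  have hN₀k : ∀ k, (N₀ : ℝ) ≤ N k := fun k => (le_self_pow₀ hN₀1 (by omega)).trans (hNge k)
  have hNpos : ∀ k, (0 : ℝ) < N k := fun k => hN₀0.trans_le (hN₀k k)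
  set ε := δ / (D * N₀) with hε
  have hε0 : 0 < ε := by positivity
  set β : ℕ → ℝ := fun k => δ / (D * N k * Q ^ k) with hβ
  have hβ0 : ∀ k, 0 < β k := fun k => by
    have := hNpos k
    simp only [hβ]; positivity
  have hNβ : ∀ k, N k * β k = δ / (D * Q ^ k) := fun k => by
    have := (hNpos k).ne'
    simp only [hβ]; field_simp
  have hDNβ : ∀ k, D * (N k * β k) = δ / Q ^ k := fun k => by
    rw [hNβ]; field_simp
  have hDNβ1 : ∀ k, D * (N k * β k) ≤ 1 := fun k => by
    rw [hDNβ]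
    exact div_le_one_of_le₀ (hδ1.trans (one_le_pow₀ hQ1)) (by positivity)
  refine ⟨L, ε, by omega, hε0, fun f hf hs hfL => ?_⟩
  set F : ℕ → Equiv.Perm ℝ :=
    fun k => Nat.rec f (fun k φ => rescale * g (N k) φ * rescale⁻¹) k with hF
  have hFs : ∀ k, F (k + 1) = rescale * g (N k) (F k) * rescale⁻¹ := fun k => rfl
  have hstep' : ∀ k, IsDiffeo (F k) → SuppIn (F k) (-12) (-47 / 4) → DB (F k) 1 (β k) →
      IsStep C (N k) (F k) (a (N k) (F k)) (b (N k) (F k)) (g (N k) (F k)) :=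
    fun k h1 h2 h3 => by
      have := hN₀k k
      refine hstep (N k) (F k) (β k) (hβ0 k) h1 h2 h3 (le_trans ?_ (hDNβ1 k)) (by linarith)
      exact mul_le_mul_of_nonneg_right (by linarith) (mul_pos (hNpos k) (hβ0 k)).le
  have inv : ∀ k, IsDiffeo (F k) ∧ SuppIn (F k) (-12) (-47 / 4) ∧
      DB (F k) L (ε * D ^ k * N k) ∧ ∀ j ≤ r', DB (F k) j (β k) := by
    intro k
    induction k with
    | zero =>
      refine ⟨hf, hs, hfL.mono ?_, fun j hj => ?_⟩
      · rw [pow_zero, mul_one]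
        exact le_mul_of_one_le_right hε0.le (hN₀1.trans (hN₀k 0))
      · obtain ⟨d, hd⟩ := Nat.exists_eq_add_of_le (show j ≤ L by omega)
        rw [hd] at hfL
        refine (hs.DB_lower hf (by norm_num) hε0.le j d hfL).mono ?_
        have : β 0 = ε := by simp [hβ, hε, hN]
        rw [this]
        exact mul_le_of_le_one_left hε0.le (pow_le_one₀ (by norm_num) (by norm_num))
    | succ k ih =>
      obtain ⟨h1, h2, h3, h4⟩ := ih
      have hk := hstep' k h1 h2 (h4 1 (by omega))
      have hNk := hN₀k k
      have hNk0 := hNpos k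
      have hNk100 : (100 : ℝ) ≤ N k := by linarith
      have hL' : DB (F (k + 1)) L (ε * D ^ (k + 1) * N (k + 1)) := by
        refine (hk.next_le (by omega) (hβ0 k) (by positivity) (h4 1 (by omega)) h3 (by linarith)
          (show C L ≤ D by linarith) (hDNβ1 k) (by linarith)).mono (le_of_eq ?_)
        rw [hNs]
        push_cast
        ring
      refine ⟨hk.g_isDiffeo.conj_affP 2 (-12) two_pos,
        hk.suppIn_g.conj_rescale.mono le_rfl ?_, hL', fun j hj => ?_⟩
      · have : 4 / (N k : ℝ) ≤ 1 / 4 := by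
          rw [div_le_div_iff₀ hNk0 (by norm_num)]; linarith
        linarith
      · refine (hk.next_lower (L := L) (by exact_mod_cast (by linarith : (4 : ℝ) ≤ N k))
          (by omega) (by positivity) hL').mono ?_
        have e1 : ε * D ≤ δ := by
          rw [hε, div_mul_eq_mul_div, div_le_iff₀ (by positivity)]
          calc δ * D = δ * (D * 1) := by ring
            _ ≤ δ * (D * N₀) := by gcongr
        have e2 : (D * Q) ^ (k + 1) ≤ N k := by
          refine le_trans ?_ (hNge k)
          gcongr
          linarith
        simp only [hβ, hNs]
        push_cast
        rw [le_div_iff₀ (by positivity)]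
        calc (4 / (N k : ℝ)) ^ 8 * (ε * D ^ (k + 1) * N k ^ 2) * (D * N k ^ 2 * Q ^ (k + 1))
            = 4 ^ 8 * (D * Q) ^ (k + 1) * (ε * D) / N k ^ 4 := by
              rw [mul_pow]; field_simp
          _ ≤ N k * N k * δ / N k ^ 4 := by gcongr; linarith
          _ ≤ δ := by
            rw [div_le_iff₀ (by positivity)]
            have : (1 : ℝ) ≤ N k ^ 2 := one_le_pow₀ (by linarith)
            calc (N k : ℝ) * N k * δ = δ * (N k ^ 2 * 1) := by ring
              _ ≤ δ * (N k ^ 2 * N k ^ 2) := by gcongr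
              _ = δ * N k ^ 4 := by ring
  have hst := fun k => hstep' k (inv k).1 (inv k).2.1 ((inv k).2.2.2 1 (by omega))
  have hseq : IsStepSeq C N F (fun k => a (N k) (F k)) (fun k => b (N k) (F k))
    (fun k => g (N k) (F k)) := ⟨hNs, hst, hFs⟩
  refine ⟨C, N, F, _, _, _, hseq, rfl, fun k => (inv k).1, fun k => (inv k).2.1, ?_,
    hseq.eventually_le hC ?_ (fun k => (inv k).1) (fun k => (inv k).2.1) hβ0
      (fun k => (inv k).2.2.2 1 (by omega)) ?_⟩
  · intro k j hj
    obtain ⟨ha, hb⟩ := (hst k).le_of_le (show 2 ≤ r' by omega) (hβ0 k)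
      ((inv k).2.2.2 1 (by omega)) ((inv k).2.2.2 r' le_rfl) (show C r' ≤ D by linarith)
      (hDNβ1 k) (by linarith [hN₀k k])
    have h1 : D * (N k : ℝ)⁻¹ ≤ δ / Q ^ k := by
      rw [← div_eq_mul_inv, div_le_div_iff₀ (hNpos k) (by positivity)]
      have h2 : D / δ * Q ≤ N₀ := by
        rw [div_mul_eq_mul_div]; linarith [show (0 : ℝ) ≤ 4 ^ 8 by positivity]
      have h3 : D / δ ≤ D / δ * Q := le_mul_of_one_le_right (by positivity) hQ1
      calc D * Q ^ k = δ * (D / δ * Q ^ k) := by field_simp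
        _ ≤ δ * (N₀ * N₀ ^ k) := by gcongr <;> linarith
        _ = δ * N₀ ^ (k + 1) := by ring
        _ ≤ δ * N k := by gcongr; exact hNge k
    obtain ⟨d, hd⟩ := Nat.exists_eq_add_of_le hj
    rw [hd] at ha hb
    have hfin : (5 - (-14 : ℝ)) ^ d * (2 * (δ / Q ^ k)) ≤ η / Q ^ k := by
      rw [mul_div_assoc', mul_div_assoc']
      gcongr
      calc (5 - (-14 : ℝ)) ^ d * (2 * δ) = 2 * 19 ^ d * δ := by norm_num; ring
        _ ≤ 2 * 19 ^ r' * δ := by gcongr <;> [norm_num; omega]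
        _ ≤ η := hδη
    have h0 : 0 ≤ δ / Q ^ k := by positivity
    constructor
    · refine ((hst k).suppIn_a.DB_lower (hst k).a_isDiffeo (by norm_num) ?_ j d ha).mono
        (le_trans ?_ hfin)
      · rw [mul_left_comm, hDNβ]; positivity
      · rw [mul_left_comm D, hDNβ]
    · refine ((hst k).suppIn_b.DB_lower (hst k).b_isDiffeo (by norm_num) ?_ j d hb).mono
        (le_trans ?_ hfin)
      · rw [mul_add, hDNβ]; positivity
      · rw [mul_add D, hDNβ]
        gcongr
        linarith
  · have : (2 : ℝ) ≤ N 0 := by linarith [hN₀k 0]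
    exact_mod_cast this
  · intro E
    have hQ2 : (1 : ℝ) < Q := one_lt_pow₀ one_lt_two (by omega)
    have : Tendsto (fun k => E * (N k * β k)) atTop (nhds 0) := by
      have h1 : (fun k => E * (N k * β k)) = fun k => E * δ / D * (Q⁻¹) ^ k := by
        ext k; rw [hNβ, inv_pow]; field_simp
      rw [h1]
      simpa using (tendsto_pow_atTop_nhds_zero_of_lt_one (by positivity)
        (inv_lt_one_of_one_lt₀ hQ2)).const_mul (E * δ / D)
    exact this.eventually (ge_mem_nhds one_pos)

theorem SuppIn.apply_mem_Icc {f : Equiv.Perm ℝ} {a b x : ℝ} (hf : SuppIn f a b)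
    (ha : a ≤ x) (hb : x ≤ b) : a ≤ f x ∧ f x ≤ b := by
  by_contra hc
  have h : f x ≤ a ∨ b ≤ f x := by
    rw [not_and_or, not_le, not_le] at hc
    exact hc.imp le_of_lt le_of_lt
  rw [f.injective (hf _ h)] at hc
  exact hc ⟨ha, hb⟩

theorem SuppIn.apply_notMem {f : Equiv.Perm ℝ} {a b x : ℝ} (hf : SuppIn f a b)
    (hx : ¬ (x ≤ a ∨ b ≤ x)) : ¬ (f x ≤ a ∨ b ≤ f x) := fun h => by
  rw [f.injective (hf _ h)] at h
  exact hx h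

/-- The commutator of two diffeomorphisms glued from pieces is glued from the commutators. -/
theorem glued_commutator {A B : Equiv.Perm ℝ} {a b : ℕ → Equiv.Perm ℝ} {u v : ℕ → ℝ}
    (ha : ∀ n, SuppIn (a n) (u n) (v n)) (hb : ∀ n, SuppIn (b n) (u n) (v n))
    (hA : ∀ n x, u n ≤ x → x ≤ v n → A x = a n x) (hB : ∀ n x, u n ≤ x → x ≤ v n → B x = b n x)
    (hA' : ∀ x, (∀ n, x ≤ u n ∨ v n ≤ x) → A x = x)
    (hB' : ∀ x, (∀ n, x ≤ u n ∨ v n ≤ x) → B x = x) :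
    (∀ n x, u n ≤ x → x ≤ v n → ⁅A, B⁆ x = ⁅a n, b n⁆ x) ∧
      ∀ x, (∀ n, x ≤ u n ∨ v n ≤ x) → ⁅A, B⁆ x = x := by
  have inv : ∀ {G g : Equiv.Perm ℝ} {s t : ℝ}, SuppIn g s t →
      (∀ x, s ≤ x → x ≤ t → G x = g x) → ∀ x, s ≤ x → x ≤ t → G⁻¹ x = g⁻¹ x :=
    fun {G g s t} hs hG x h1 h2 => by
      rw [Equiv.Perm.inv_eq_iff_eq, hG _ (hs.inv.apply_mem_Icc h1 h2).1
        (hs.inv.apply_mem_Icc h1 h2).2]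
      exact (g.apply_symm_apply x).symm
  refine ⟨fun n x h1 h2 => ?_, fun x hx => ?_⟩
  · simp only [commutatorElement_def, Equiv.Perm.mul_apply]
    obtain ⟨p1, p2⟩ := (hb n).inv.apply_mem_Icc h1 h2
    obtain ⟨q1, q2⟩ := (ha n).inv.apply_mem_Icc p1 p2
    obtain ⟨r1, r2⟩ := (hb n).apply_mem_Icc q1 q2
    rw [inv (hb n) (hB n) x h1 h2, inv (ha n) (hA n) _ p1 p2, hB n _ q1 q2, hA n _ r1 r2]
  · have h1 : A⁻¹ x = x := by rw [Equiv.Perm.inv_eq_iff_eq, hA' x hx]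
    have h2 : B⁻¹ x = x := by rw [Equiv.Perm.inv_eq_iff_eq, hB' x hx]
    simp only [commutatorElement_def, Equiv.Perm.mul_apply]
    rw [h2, h1, hB' x hx, hA' x hx]

/-- A telescoping product, rearranged into its even part times its odd part. -/
theorem eq_even_mul_odd {F P : ℕ → Equiv.Perm ℝ} {l r u v : ℕ → ℝ} {E O : Equiv.Perm ℝ}
    (hF : ∀ k, F k = P k * F (k + 1)) (hs : ∀ k, SuppIn (F k) (l k) (r k))
    (hd : ∀ k m, k ≠ m → r k ≤ l m ∨ r m ≤ l k) (hu : ∀ k, u k ≤ l k) (hv : ∀ k, r k ≤ v k)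
    (hu' : ∀ k, u k ≤ l (k + 1)) (hv' : ∀ k, r (k + 1) ≤ v k)
    (hE : ∀ n x, u (2 * n) ≤ x → x ≤ v (2 * n) → E x = P (2 * n) x)
    (hE' : ∀ x, (∀ n, x ≤ u (2 * n) ∨ v (2 * n) ≤ x) → E x = x)
    (hO : ∀ n x, u (2 * n + 1) ≤ x → x ≤ v (2 * n + 1) → O x = P (2 * n + 1) x)
    (hO' : ∀ x, (∀ n, x ≤ u (2 * n + 1) ∨ v (2 * n + 1) ≤ x) → O x = x) : F 0 = E * O := by
  have hP : ∀ k x, P k x = F k ((F (k + 1))⁻¹ x) := fun k x => by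
    rw [hF k, Equiv.Perm.mul_apply]
    exact congrArg (P k) ((F (k + 1)).apply_symm_apply x).symm
  have fix : ∀ k m x, k ≠ m → ¬ (x ≤ l k ∨ r k ≤ x) → F m x = x := fun k m x hkm hx => by
    push Not at hx
    refine hs m x ?_
    rcases hd k m hkm with h | h
    · left; linarith
    · right; linarith
  have fix' : ∀ k m x, k ≠ m → ¬ (x ≤ l k ∨ r k ≤ x) → (F m)⁻¹ x = x := fun k m x hkm hx => by
    rw [Equiv.Perm.inv_eq_iff_eq, fix k m x hkm hx]
  have hP1 : ∀ k x, ¬ (x ≤ l k ∨ r k ≤ x) → P k x = F k x := fun k x hx => by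
    rw [hP, fix' k (k + 1) x (by omega) hx]
  have hP2 : ∀ k x, ¬ (x ≤ l (k + 1) ∨ r (k + 1) ≤ x) → P k x = (F (k + 1))⁻¹ x :=
    fun k x hx => by
      rw [hP, fix (k + 1) k _ (by omega) ((hs (k + 1)).inv.apply_notMem hx)]
  have hP3 : ∀ k x, F k x = x → F (k + 1) x = x → P k x = x := fun k x h1 h2 => by
    rw [hP, Equiv.Perm.inv_eq_iff_eq.2 h2.symm, h1]
  have memZ : ∀ k x, ¬ (x ≤ l k ∨ r k ≤ x) → u k ≤ x ∧ x ≤ v k := fun k x hx => by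
    push Not at hx
    have := hu k
    have := hv k
    constructor <;> linarith
  have memZ' : ∀ k x, ¬ (x ≤ l (k + 1) ∨ r (k + 1) ≤ x) → u k ≤ x ∧ x ≤ v k := fun k x hx => by
    push Not at hx
    have := hu' k
    have := hv' k
    constructor <;> linarith
  have hE3 : ∀ x, (∀ k, F k x = x) → E x = x := fun x hx => by
    by_cases h : ∀ n, x ≤ u (2 * n) ∨ v (2 * n) ≤ x
    · exact hE' x h
    · push Not at h
      obtain ⟨n, h1, h2⟩ := h
      rw [hE n x h1.le h2.le, hP3 _ _ (hx _) (hx _)]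
  have hO3 : ∀ x, (∀ k, 1 ≤ k → F k x = x) → O x = x := fun x hx => by
    by_cases h : ∀ n, x ≤ u (2 * n + 1) ∨ v (2 * n + 1) ≤ x
    · exact hO' x h
    · push Not at h
      obtain ⟨n, h1, h2⟩ := h
      rw [hO n x h1.le h2.le, hP3 _ _ (hx _ (by omega)) (hx _ (by omega))]
  ext x
  rw [Equiv.Perm.mul_apply]
  by_cases hx : ∀ k, x ≤ l k ∨ r k ≤ x
  · have := fun k => hs k x (hx k)
    rw [hO3 x fun k _ => this k, hE3 x this, this]
  · rw [not_forall] at hx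
    obtain ⟨k, hk⟩ := hx
    rcases Nat.even_or_odd' k with ⟨n, rfl | rfl⟩
    · rcases n with _ | n
      · rw [hO3 x fun m hm => fix _ m x (by omega) hk, hE 0 x (memZ _ x hk).1 (memZ _ x hk).2,
          hP1 _ x hk]
      · rw [fix _ 0 x (by omega) hk]
        have hk' : ¬ (x ≤ l (2 * n + 1 + 1) ∨ r (2 * n + 1 + 1) ≤ x) := hk
        rw [hO n x (memZ' _ x hk').1 (memZ' _ x hk').2, hP2 _ x hk']
        have hy := (hs (2 * (n + 1))).inv.apply_notMem hk
        have hz := memZ _ _ hy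
        rw [show 2 * n + 1 + 1 = 2 * (n + 1) by ring, hE (n + 1) _ hz.1 hz.2, hP1 _ _ hy]
        exact ((F (2 * (n + 1))).apply_symm_apply x).symm
    · rw [fix _ 0 x (by omega) hk, hO n x (memZ _ x hk).1 (memZ _ x hk).2, hP1 _ x hk]
      have hy := (hs (2 * n + 1)).apply_notMem hk
      have hz := memZ' _ _ hy
      rw [hE n _ hz.1 hz.2, hP2 _ _ hy]
      exact ((F (2 * n + 1)).symm_apply_apply x).symm

theorem homot_succ_mul_rescale (k : ℕ) :
    homot (1 / 2) 12 one_half_pos (k + 1) * rescale = homot (1 / 2) 12 one_half_pos k := by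
  ext x
  simp only [homot, rescale, Equiv.Perm.mul_apply, affP_apply]
  ring

theorem SuppIn.conj_homot {f : Equiv.Perm ℝ} {a b : ℝ} (hf : SuppIn f a b) (k : ℕ) :
    SuppIn (homot (1 / 2) 12 one_half_pos k * f * (homot (1 / 2) 12 one_half_pos k)⁻¹)
      (12 + (1 / 2) ^ k * (a - 12)) (12 + (1 / 2) ^ k * (b - 12)) := by
  have := SuppIn.conj_affP hf ((1 / 2) ^ k) (12 - (1 / 2) ^ k * 12) (by positivity)
  have h : ∀ x : ℝ, (1 / 2) ^ k * x + (12 - (1 / 2) ^ k * 12) = 12 + (1 / 2) ^ k * (x - 12) :=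
    fun x => by ring
  rwa [h a, h b] at this

theorem DB.conj_homot {f : Equiv.Perm ℝ} {j r : ℕ} {η : ℝ} (k : ℕ) (hj : j ≤ r) (hη : 0 ≤ η)
    (hf : IsDiffeo f) (hm : DB f j (η / (2 ^ r) ^ k)) :
    DB (homot (1 / 2) 12 one_half_pos k * f * (homot (1 / 2) 12 one_half_pos k)⁻¹) j η := by
  refine (hm.conj_affP hf _ _ _).mono ?_
  have h1 : ((1 / 2 : ℝ) ^ k)⁻¹ ^ j ≤ (2 ^ r) ^ k := by
    rw [one_div, inv_pow 2, inv_inv, ← pow_mul, ← pow_mul, mul_comm k]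
    exact pow_le_pow_right₀ one_le_two (by gcongr)
  calc (1 / 2 : ℝ) ^ k * ((1 / 2) ^ k)⁻¹ ^ j * (η / (2 ^ r) ^ k)
      ≤ 1 * (2 ^ r) ^ k * (η / (2 ^ r) ^ k) := by
        gcongr
        exact pow_le_one₀ (by norm_num) (by norm_num)
    _ = η := by field_simp

/-- The rescaled pieces of a sequence whose indices have a fixed parity can be combined. -/
theorem exists_isSmall_glue {r : ℕ} {η : ℝ} (hη : 0 < η) (hη' : η ≤ 1 / 2) (s : ℕ)
    {a : ℕ → Equiv.Perm ℝ} (ha : ∀ k, IsDiffeo (a k)) (hs : ∀ k, SuppIn (a k) (-14) 5)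
    (hb : ∀ k, ∀ j ≤ r + 2, DB (a k) j (η / (2 ^ (r + 2)) ^ k))
    (hdec : ∀ j Λ, 0 < Λ → ∀ᶠ k in atTop, DB (a k) j (Λ ^ k)) :
    ∃ G, IsSmall r η G ∧
      (∀ n x, 12 + (1 / 2) ^ (2 * n + s) * (-14 - 12) ≤ x →
        x ≤ 12 + (1 / 2) ^ (2 * n + s) * (5 - 12) → G x =
          (homot (1 / 2) 12 one_half_pos (2 * n + s) * a (2 * n + s) *
            (homot (1 / 2) 12 one_half_pos (2 * n + s))⁻¹) x) ∧
      ∀ x, (∀ n, x ≤ 12 + (1 / 2) ^ (2 * n + s) * (-14 - 12) ∨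
        12 + (1 / 2) ^ (2 * n + s) * (5 - 12) ≤ x) → G x = x := by
  have hlt : ∀ n m : ℕ, n < m → (12 : ℝ) + (1 / 2) ^ (2 * n + s) * (5 - 12) ≤
      12 + (1 / 2) ^ (2 * m + s) * (-14 - 12) := fun n m hnm => by
    have h1 : (1 / 2 : ℝ) ^ (2 * m + s) ≤ (1 / 2) ^ (2 * n + s + 2) :=
      pow_le_pow_of_le_one (by norm_num) (by norm_num) (by omega)
    rw [pow_add _ (2 * n + s)] at h1
    have : (0 : ℝ) < (1 / 2) ^ (2 * n + s) := by positivity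
    linarith
  obtain ⟨G, hG, hGs, hG1, hG2, hG3⟩ := exists_glue (U := -14) (V := 12)
    (fun n => (ha (2 * n + s)).conj_affP ((1 / 2) ^ (2 * n + s))
      (12 - (1 / 2) ^ (2 * n + s) * 12) (by positivity))
    (fun n => (hs (2 * n + s)).conj_homot (2 * n + s))
    (fun n => by
      have : (1 / 2 : ℝ) ^ (2 * n + s) ≤ 1 := pow_le_one₀ (by norm_num) (by norm_num)
      linarith)
    (fun n => by
      have : (0 : ℝ) < (1 / 2) ^ (2 * n + s) := by positivity
      linarith)
    (fun n m hnm => (lt_or_gt_of_ne hnm).imp (hlt n m) (hlt m n))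
    (fun n => ((hb (2 * n + s) 1 (by omega)).conj_homot _ (by omega) hη.le (ha _)).mono hη')
    (fun j => by
      obtain ⟨B, hB, hB'⟩ := summable_bounds_homot 12 one_half_pos ha hs hdec j
      exact ⟨fun n => B (2 * n + s), hB.comp_injective fun x y h => by simpa using h,
        fun n => hB' (2 * n + s)⟩)
  exact ⟨G, ⟨hG, hGs, fun j hj => hG3 j η fun n =>
    (hb (2 * n + s) j (by omega)).conj_homot _ (by omega) hη.le (ha _)⟩, hG1, hG2⟩

/-- Diffeomorphisms close to the identity are products of two commutators of diffeomorphisms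
close to the identity. -/
theorem exists_eq_commutator_mul_commutator (r : ℕ) (η : ℝ) (hη : 0 < η) :
    ∃ (R : ℕ) (ε : ℝ), 1 ≤ R ∧ 0 < ε ∧ ∀ f, IsDiffeo f → SuppIn f (-12) (-47 / 4) → DB f 1 ε →
      DB f R ε → ∃ a b a' b', IsSmall r η a ∧ IsSmall r η b ∧ IsSmall r η a' ∧ IsSmall r η b' ∧
        f = ⁅a, b⁆ * ⁅a', b'⁆ := by
  set η' := min η (1 / 2) with hη'
  have hη0 : 0 < η' := by positivity
  have mono : ∀ {a}, IsSmall r η' a → IsSmall r η a := fun h =>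
    ⟨h.1, h.2.1, fun j hj => (h.2.2 j hj).mono (min_le_left _ _)⟩
  obtain ⟨R, ε, hR, hε, H⟩ := exists_stepSeq r hη0
  refine ⟨R, ε, hR, hε, fun f hf hs _ hfR => ?_⟩
  obtain ⟨C, N, F, a, b, g, hseq, rfl, -, hFs, hbd, hdec⟩ := H f hf hs hfR
  have hda := fun k => (hseq.step k).a_isDiffeo
  have hdb := fun k => (hseq.step k).b_isDiffeo
  have hsa := fun k => (hseq.step k).suppIn_a
  have hsb := fun k => (hseq.step k).suppIn_b
  have glue_a := fun s => exists_isSmall_glue hη0 (min_le_right _ _) s hda hsa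
    (fun k j hj => (hbd k j hj).1) (fun j Λ hΛ => (hdec j Λ hΛ).mono fun _ h => h.1)
  have glue_b := fun s => exists_isSmall_glue hη0 (min_le_right _ _) s hdb hsb
    (fun k j hj => (hbd k j hj).2) (fun j Λ hΛ => (hdec j Λ hΛ).mono fun _ h => h.2)
  obtain ⟨A, hA, hA1, hA2⟩ := glue_a 0
  obtain ⟨B, hB, hB1, hB2⟩ := glue_b 0
  obtain ⟨A', hA', hA1', hA2'⟩ := glue_a 1
  obtain ⟨B', hB', hB1', hB2'⟩ := glue_b 1
  refine ⟨A, B, A', B', mono hA, mono hB, mono hA', mono hB', ?_⟩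
  obtain ⟨hE, hE'⟩ := glued_commutator (fun n => (hsa _).conj_homot _)
    (fun n => (hsb _).conj_homot _) hA1 hB1 hA2 hB2
  obtain ⟨hO, hO'⟩ := glued_commutator (fun n => (hsa _).conj_homot _)
    (fun n => (hsb _).conj_homot _) hA1' hB1' hA2' hB2'
  set h := homot (1 / 2) 12 one_half_pos with hh
  have h0 : h 0 = 1 := by ext x; simp [hh, homot]
  have key := eq_even_mul_odd (F := fun k => h k * F k * (h k)⁻¹)
    (P := fun k => ⁅h k * a k * (h k)⁻¹, h k * b k * (h k)⁻¹⁆)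
    (u := fun k => 12 + (1 / 2) ^ k * (-14 - 12)) (v := fun k => 12 + (1 / 2) ^ k * (5 - 12))
    ?_ (fun k => (hFs k).conj_homot k) ?_ ?_ ?_ ?_ ?_ hE hE' hO hO'
  · simpa [h0] using key
  · intro k
    have e1 : h k * F k * (h k)⁻¹ = h k * (⁅a k, b k⁆ * g k) * (h k)⁻¹ := by
      rw [← (hseq.step k).eq]
    have e2 : h (k + 1) * F (k + 1) * (h (k + 1))⁻¹ = h k * g k * (h k)⁻¹ := by
      rw [hseq.succ, hh, ← homot_succ_mul_rescale k]
      group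
    simp only [e1, e2, commutatorElement_def]
    group
  · have hlt : ∀ n m : ℕ, n < m → (12 : ℝ) + (1 / 2) ^ n * (-47 / 4 - 12) ≤
        12 + (1 / 2) ^ m * (-12 - 12) := fun n m hnm => by
      have h1 : (1 / 2 : ℝ) ^ m ≤ (1 / 2) ^ (n + 1) :=
        pow_le_pow_of_le_one (by norm_num) (by norm_num) (by omega)
      rw [pow_succ] at h1
      have : (0 : ℝ) < (1 / 2) ^ n := by positivity
      linarith
    exact fun n m hnm => (lt_or_gt_of_ne hnm).imp (hlt n m) (hlt m n)
  all_goals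
    intro k
    have : (0 : ℝ) < (1 / 2) ^ k := by positivity
    linarith [pow_succ (1 / 2 : ℝ) k]

/-- Any sequence of elements of `Diff^∞_c(ℝ)` with a common compact support converging
sufficiently fast to the identity lies in a finitely generated subgroup, with linear
control on the word lengths. -/
theorem sequence_in_fg_group :
    ∃ (r : ℕ → ℕ) (ε : ℕ → ℝ), (∀ n, 0 < ε n) ∧
      ∀ f : ℕ → Equiv.Perm ℝ,
        (∀ n, IsCDiffC (f n)) →
        (∃ K : Set ℝ, IsCompact K ∧ ∀ n, ∀ x ∉ K, f n x = x) →
        (∀ n, DistLt (r n) (ε n) (⇑(f n)) id) →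
        ∃ S : Finset (Equiv.Perm ℝ), (∀ s ∈ S, IsCDiffC s) ∧
          ∀ n, f n ∈ Subgroup.closure (S : Set (Equiv.Perm ℝ)) ∧
            wordLength S (f n) ≤ 70 * n + 70 :=
  sequence_of_commutators exists_eq_commutator_mul_commutator
end
end
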